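/- arXiv:1510.03493 — 4 statements merged into one kernel-verified Lean document; each statement's English description precedes it below -/
import Mathlib

section
/- Let n ≥ 1 and let X ⊊ Y be consistent subsets of binom([n], 3) such that the pair (X, Y) is not facial. Then the Möbius function of the poset of consistent subsets of binom([n], 3) ordered by inclusion satisfies μ(X, Y) = 0. -/
open Finset

/-- `[n] = {1, …, n}`. -/
def box (n : ℕ) : Finset ℕ := Finset.Icc 1 n

/-- `binom([n], k)`, the set of `k`-element subsets of `[n]`. -/
def binom (n k : ℕ) : Finset (Finset ℕ) := Finset.powersetCard k (box n)

/-- `X ⊆ binom([n], d+1)` is closed if for every `(d-1)`-subset `I` of `[n]` and all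
`i < j < k` in `[n] ∖ I`, membership of `I∪{i,j}` and `I∪{j,k}` in `X` forces
`I∪{i,k} ∈ X`. -/
def IsClosedSet (n d : ℕ) (X : Finset (Finset ℕ)) : Prop :=
  ∀ I ∈ binom n (d - 1), ∀ i ∈ box n, ∀ j ∈ box n, ∀ k ∈ box n,
    i ∉ I → j ∉ I → k ∉ I → i < j → j < k →
      I ∪ {i, j} ∈ X → I ∪ {j, k} ∈ X → I ∪ {i, k} ∈ X

/-- `X` is a consistent subset of `binom([n], d+1)`:
both `X` and its complement in `binom([n], d+1)` are closed. -/
def Consistent (n d : ℕ) (X : Finset (Finset ℕ)) : Prop :=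
  X ⊆ binom n (d + 1) ∧ IsClosedSet n d X ∧ IsClosedSet n d (binom n (d + 1) \ X)

open Classical in
/-- The smallest closed subset of `binom([n], d+1)` containing `S`. -/
noncomputable def closureHB (n d : ℕ) (S : Finset (Finset ℕ)) : Finset (Finset ℕ) :=
  (binom n (d + 1)).filter fun I =>
    ∀ T ⊆ binom n (d + 1), S ⊆ T → IsClosedSet n d T → I ∈ T

open Classical in
/-- The ascent set `Asc(X, Y) = {I ∈ Y ∖ X : X ∪ {I} is consistent}`. -/
noncomputable def ascSet (n d : ℕ) (X Y : Finset (Finset ℕ)) : Finset (Finset ℕ) :=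
  (Y \ X).filter fun I => Consistent n d (X ∪ {I})

/-- The pair `(X, Y)` of consistent sets is facial if `Y = X ∪ cl(Asc(X,Y))` and
`X ∪ cl(𝓘)` is consistent for every `𝓘 ⊆ Asc(X,Y)`. -/
def Facial (n : ℕ) (X Y : Finset (Finset ℕ)) : Prop :=
  Consistent n 2 X ∧ Consistent n 2 Y ∧ X ⊆ Y ∧
  Y = X ∪ closureHB n 2 (ascSet n 2 X Y) ∧
  ∀ S ⊆ ascSet n 2 X Y, Consistent n 2 (X ∪ closureHB n 2 S)

/-- The poset of consistent subsets of `binom([n], 3)`, ordered by inclusion. -/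
def ConsPoset (n : ℕ) := {X : Finset (Finset ℕ) // Consistent n 2 X}

noncomputable instance (n : ℕ) : PartialOrder (ConsPoset n) :=
  Subtype.partialOrder _

open Classical in
noncomputable instance (n : ℕ) : LocallyFiniteOrder (ConsPoset n) :=
  Subtype.instLocallyFiniteOrder _

open Classical in
/-- The Möbius function of the poset of consistent subsets of `binom([n],3)`
ordered by inclusion. -/
noncomputable def muHB (n : ℕ) : ConsPoset n → ConsPoset n → ℤ :=
  fun X Y => IncidenceAlgebra.mu ℤ X Y

set_option linter.unusedSimpArgs false

namespace HB

section Triples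

/-- A trace on the packet of four lines that is an initial or a final segment. -/
def Good4 (p q r s : Prop) : Prop :=
  (p → r → q) ∧ (p → s → q) ∧ (p → s → r) ∧ (q → s → r) ∧
  (q → p ∨ r) ∧ (q → p ∨ s) ∧ (r → p ∨ s) ∧ (r → q ∨ s)

/-- `X` restricted to the lines in `V` is consistent: every packet has a good trace. -/
def Cons (V : Finset ℕ) (X : ℕ → ℕ → ℕ → Prop) : Prop :=
  ∀ ⦃a b c d⦄, a ∈ V → b ∈ V → c ∈ V → d ∈ V → a < b → b < c → c < d →
    Good4 (X a b c) (X a b d) (X a c d) (X b c d)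

/-- The crossing with `v` precedes the crossing with `w` along the line `u`. -/
def Lt (X : ℕ → ℕ → ℕ → Prop) (u v w : ℕ) : Prop :=
  (u < v ∧ v < w ∧ ¬ X u v w) ∨ (v < u ∧ u < w ∧ ¬ X v u w) ∨ (v < w ∧ w < u ∧ ¬ X v w u) ∨
  (u < w ∧ w < v ∧ X u w v) ∨ (w < u ∧ u < v ∧ X w u v) ∨ (w < v ∧ v < u ∧ X w v u)

/-- The line `h` is below the crossing of `i < k`. -/
def Bel (X : ℕ → ℕ → ℕ → Prop) (h i k : ℕ) : Prop :=
  (h < i ∧ X h i k) ∨ (i < h ∧ h < k ∧ ¬ X i h k) ∨ (k < h ∧ X i k h)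

/-- The line `h` does not separate the vertices of the triangle `i, j, k`. -/
def Uncut (X : ℕ → ℕ → ℕ → Prop) (h i j k : ℕ) : Prop :=
  (Bel X h i j ↔ Bel X h i k) ∧ (Bel X h j k ↔ Bel X h i k)

/-- The triple `i, j, k` is not in `X`, and no line cuts its triangle. -/
def Addable (V : Finset ℕ) (X : ℕ → ℕ → ℕ → Prop) (i j k : ℕ) : Prop :=
  i ∈ V ∧ j ∈ V ∧ k ∈ V ∧ i < j ∧ j < k ∧ ¬ X i j k ∧
    ∀ h ∈ V, h ≠ i → h ≠ j → h ≠ k → Uncut X h i j k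

variable {V : Finset ℕ} {X Y : ℕ → ℕ → ℕ → Prop}

theorem lt_iff₁ {u v w : ℕ} (h : u < v) (h' : v < w) : Lt X u v w ↔ ¬ X u v w := by
  unfold Lt; grind

theorem lt_iff₂ {u v w : ℕ} (h : v < u) (h' : u < w) : Lt X u v w ↔ ¬ X v u w := by
  unfold Lt; grind

theorem lt_iff₃ {u v w : ℕ} (h : v < w) (h' : w < u) : Lt X u v w ↔ ¬ X v w u := by
  unfold Lt; grind

theorem lt_iff₄ {u v w : ℕ} (h : u < w) (h' : w < v) : Lt X u v w ↔ X u w v := by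
  unfold Lt; grind

theorem lt_iff₅ {u v w : ℕ} (h : w < u) (h' : u < v) : Lt X u v w ↔ X w u v := by
  unfold Lt; grind

theorem lt_iff₆ {u v w : ℕ} (h : w < v) (h' : v < u) : Lt X u v w ↔ X w v u := by
  unfold Lt; grind

theorem bel_iff₁ {h i k : ℕ} (h1 : h < i) (h2 : i < k) : Bel X h i k ↔ X h i k := by
  unfold Bel; grind

theorem bel_iff₂ {h i k : ℕ} (h1 : i < h) (h2 : h < k) : Bel X h i k ↔ ¬ X i h k := by
  unfold Bel; grind

theorem bel_iff₃ {h i k : ℕ} (h1 : i < k) (h2 : k < h) : Bel X h i k ↔ X i k h := by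
  unfold Bel; grind

theorem Lt.asymm {u v w : ℕ} (h : Lt X u v w) : ¬ Lt X u w v := by
  unfold Lt at *; grind

theorem Lt.ne {u v w : ℕ} (h : Lt X u v w) : u ≠ v ∧ u ≠ w ∧ v ≠ w := by
  unfold Lt at *; omega

theorem lt_or_lt {u v w : ℕ} (h1 : u ≠ v) (h2 : u ≠ w) (h3 : v ≠ w) :
    Lt X u v w ∨ Lt X u w v := by
  unfold Lt; grind (splits := 30)

theorem Lt.trans (hX : Cons V X) {u v w x : ℕ} (hu : u ∈ V) (hv : v ∈ V) (hw : w ∈ V)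
    (hx : x ∈ V) (h1 : Lt X u v w) (h2 : Lt X u w x) : Lt X u v x := by
  by_cases hne : v = x
  · subst hne; exact absurd h2 h1.asymm
  unfold Lt at h1 h2 ⊢
  have huv : u ≠ v := by omega
  have huw : u ≠ w := by omega
  have hux : u ≠ x := by omega
  grind (splits := 30) [Cons, Good4]

theorem bel_left {h i k : ℕ} (h1 : h ≠ i) (hik : i < k) :
    Bel X h i k ↔ (Lt X i h k ↔ i < h) := by
  unfold Bel Lt; grind

theorem bel_right {h i k : ℕ} (h1 : h ≠ i) (h2 : h ≠ k) (hik : i < k) :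
    Bel X h i k ↔ (Lt X k h i ↔ k < h) := by
  unfold Bel Lt; grind

theorem exists_last {s : Finset ℕ} (hs : s.Nonempty) (r : ℕ → ℕ → Prop) (hir : ∀ a ∈ s, ¬ r a a)
    (htr : ∀ a ∈ s, ∀ b ∈ s, ∀ c ∈ s, r a b → r b c → r a c) :
    ∃ a ∈ s, ∀ b ∈ s, ¬ r a b := by
  induction hs using Finset.Nonempty.cons_induction with
  | singleton a => exact ⟨a, by simp, by simpa using hir⟩
  | cons a s ha hs ih =>
    simp only [Finset.mem_cons] at *
    obtain ⟨m, hm, hl⟩ := ih (fun a ha => hir a (.inr ha))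
      (fun a ha b hb c hc => htr a (.inr ha) b (.inr hb) c (.inr hc))
    by_cases hma : r m a
    · refine ⟨a, .inl rfl, ?_⟩
      rintro b (rfl | hb)
      · exact hir _ (.inl rfl)
      · exact fun hab => hl b hb (htr _ (.inr hm) _ (.inl rfl) _ (.inr hb) hma hab)
    · refine ⟨m, .inr hm, ?_⟩
      rintro b (rfl | hb)
      · exact hma
      · exact hl b hb

theorem exists_last_on_line (hX : Cons V X) {u : ℕ} (hu : u ∈ V) {p : ℕ → Prop}
    (hp : ∃ a ∈ V, p a) : ∃ a ∈ V, p a ∧ ∀ b ∈ V, p b → ¬ Lt X u a b := by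
  classical
  obtain ⟨a, ha, hpa⟩ := hp
  obtain ⟨m, hm, hl⟩ := exists_last (s := V.filter p) ⟨a, by simp [ha, hpa]⟩ (Lt X u)
    (fun a _ h => h.ne.2.2 rfl) (fun a ha b hb c hc => by
      simp only [Finset.mem_filter] at *
      exact Lt.trans hX hu ha.1 hb.1 hc.1)
  simp only [Finset.mem_filter] at *
  exact ⟨m, hm.1, hm.2, fun b hb hpb => hl b ⟨hb, hpb⟩⟩

theorem exists_first_on_line (hX : Cons V X) {u : ℕ} (hu : u ∈ V) {p : ℕ → Prop}
    (hp : ∃ a ∈ V, p a) : ∃ a ∈ V, p a ∧ ∀ b ∈ V, p b → ¬ Lt X u b a := by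
  classical
  obtain ⟨a, ha, hpa⟩ := hp
  obtain ⟨m, hm, hl⟩ := exists_last (s := V.filter p) ⟨a, by simp [ha, hpa]⟩
    (fun a b => Lt X u b a)
    (fun a _ h => h.ne.2.2 rfl) (fun a ha b hb c hc h1 h2 => by
      simp only [Finset.mem_filter] at *
      exact Lt.trans hX hu hc.1 hb.1 ha.1 h2 h1)
  simp only [Finset.mem_filter] at *
  exact ⟨m, hm.1, hm.2, fun b hb hpb => hl b ⟨hb, hpb⟩⟩

theorem exists_rightmost (hX : Cons V X) (D : ℕ → ℕ → Prop) (hsymm : ∀ u v, D u v → D v u)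
    (hirr : ∀ u, ¬ D u u) (hmem : ∀ u v, D u v → u ∈ V) (hne : ∃ u v, D u v) :
    ∃ i j, D i j ∧ ∀ h, (D i h → ¬ Lt X i j h) ∧ (D j h → ¬ Lt X j i h) := by
  induction V using Finset.induction_on_max generalizing D with
  | empty => obtain ⟨u, v, h⟩ := hne; simpa using hmem u v h
  | insert n s hn ih =>
    have hXs : Cons s X := fun a b c d ha hb hc hd => hX (by simp [ha]) (by simp [hb])
      (by simp [hc]) (by simp [hd])
    have hns : n ∉ s := fun h => lt_irrefl _ (hn n h)
    have hmem' : ∀ u v, D u v → v ∈ insert n s := fun u v h => hmem v u (hsymm u v h)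
    have hnX : n ∈ insert n s := by simp
    by_cases h1 : ∃ a ∈ s, ∃ b ∈ s, D a b ∧ Lt X a n b
    · obtain ⟨i, j, ⟨hi, hj, hij, hl⟩, hr⟩ :=
        ih hXs (fun u v => u ∈ s ∧ v ∈ s ∧ D u v ∧ Lt X u n v)
          (fun u v ⟨hu, hv, hD, hl⟩ => ⟨hv, hu, hsymm _ _ hD, by
            have := hn u hu; have := hn v hv; unfold Lt at *; grind⟩)
          (fun u h => hirr u h.2.2.1) (fun u v h => h.1)
          (by obtain ⟨a, ha, b, hb, h⟩ := h1; exact ⟨a, b, ha, hb, h⟩)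
      have hl' : Lt X j n i := by
        have := hn i hi; have := hn j hj; unfold Lt at *; grind
      have hiV : i ∈ insert n s := by simp [hi]
      have hjV : j ∈ insert n s := by simp [hj]
      refine ⟨i, j, hij, fun h => ⟨fun hD hlt => ?_, fun hD hlt => ?_⟩⟩
      · have hhV := hmem' _ _ hD
        have hh : h ∈ s := by
          rcases Finset.mem_insert.1 hhV with rfl | h
          · exact absurd hlt hl.asymm
          · exact h
        exact (hr h).1 ⟨hi, hh, hD, Lt.trans hX hiV hnX hjV hhV hl hlt⟩ hlt
      · have hhV := hmem' _ _ hD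
        have hh : h ∈ s := by
          rcases Finset.mem_insert.1 hhV with rfl | h
          · exact absurd hlt hl'.asymm
          · exact h
        exact (hr h).2 ⟨hj, hh, hD, Lt.trans hX hjV hnX hiV hhV hl' hlt⟩ hlt
    push Not at h1
    by_cases h2 : ∃ a ∈ insert n s, D n a
    · obtain ⟨a, ha, hD, hl⟩ := exists_last_on_line hX hnX h2
      have has : a ∈ s := by
        rcases Finset.mem_insert.1 ha with rfl | h
        · exact absurd hD (hirr _)
        · exact h
      refine ⟨n, a, hD, fun h => ⟨fun hD hlt => hl h (hmem' _ _ hD) hD hlt, fun hD hlt => ?_⟩⟩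
      rcases Finset.mem_insert.1 (hmem' _ _ hD) with rfl | hh
      · exact hlt.ne.2.2 rfl
      · exact h1 a has h hh hD hlt
    · have hm : ∀ u v, D u v → u ∈ s := by
        intro u v hD
        rcases Finset.mem_insert.1 (hmem _ _ hD) with rfl | hh
        · exact absurd ⟨v, hmem' _ _ hD, hD⟩ h2
        · exact hh
      exact ih hXs D hsymm hirr hm hne

theorem Cons.five (hX : Cons V X) {a b c d e : ℕ} (ha : a ∈ V) (hb : b ∈ V) (hc : c ∈ V)
    (hd : d ∈ V) (he : e ∈ V) (hab : a < b) (hbc : b < c) (hcd : c < d) (hde : d < e) :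
    Good4 (X a b c) (X a b d) (X a c d) (X b c d) ∧ Good4 (X a b c) (X a b e) (X a c e) (X b c e) ∧
    Good4 (X a b d) (X a b e) (X a d e) (X b d e) ∧ Good4 (X a c d) (X a c e) (X a d e) (X c d e) ∧
    Good4 (X b c d) (X b c e) (X b d e) (X c d e) :=
  ⟨hX ha hb hc hd hab hbc hcd, hX ha hb hc he hab hbc (hcd.trans hde),
    hX ha hb hd he hab (hbc.trans hcd) hde, hX ha hc hd he (hab.trans hbc) hcd hde,
    hX hb hc hd he hbc hcd hde⟩

/-- Inclusion on the triples of lines in `V`. -/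
def Sub (V : Finset ℕ) (X Y : ℕ → ℕ → ℕ → Prop) : Prop :=
  ∀ ⦃a b c⦄, a ∈ V → b ∈ V → c ∈ V → a < b → b < c → X a b c → Y a b c

theorem Sub.four (h : Sub V X Y) {a b c d : ℕ} (ha : a ∈ V) (hb : b ∈ V) (hc : c ∈ V)
    (hd : d ∈ V) (hab : a < b) (hbc : b < c) (hcd : c < d) :
    (X a b c → Y a b c) ∧ (X a b d → Y a b d) ∧ (X a c d → Y a c d) ∧ (X b c d → Y b c d) :=
  ⟨h ha hb hc hab hbc, h ha hb hd hab (hbc.trans hcd), h ha hc hd (hab.trans hbc) hcd,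
    h hb hc hd hbc hcd⟩

theorem Sub.five (h : Sub V X Y) {a b c d e : ℕ} (ha : a ∈ V) (hb : b ∈ V) (hc : c ∈ V)
    (hd : d ∈ V) (he : e ∈ V) (hab : a < b) (hbc : b < c) (hcd : c < d) (hde : d < e) :
    ((X a b c → Y a b c) ∧ (X a b d → Y a b d) ∧ (X a c d → Y a c d) ∧ (X b c d → Y b c d)) ∧
    (X a b e → Y a b e) ∧ (X a c e → Y a c e) ∧ (X a d e → Y a d e) ∧ (X b c e → Y b c e) ∧
    (X b d e → Y b d e) ∧ (X c d e → Y c d e) :=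
  ⟨h.four ha hb hc hd hab hbc hcd, h ha hb he hab (by omega), h ha hc he (by omega) (by omega),
    h ha hd he (by omega) hde, h hb hc he hbc (by omega), h hb hd he (by omega) hde,
    h hc hd he hcd hde⟩

/-- `{u, v, m}` with `u, v < m` lies in `Y` but not in `X`. -/
def New (X Y : ℕ → ℕ → ℕ → Prop) (m u v : ℕ) : Prop :=
  (u < v ∧ v < m ∧ Y u v m ∧ ¬ X u v m) ∨ (v < u ∧ u < m ∧ Y v u m ∧ ¬ X v u m)

theorem new_iff₁ {m u v : ℕ} (h : u < v) (h' : v < m) :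
    New X Y m u v ↔ Y u v m ∧ ¬ X u v m := by
  unfold New; grind

theorem new_iff₂ {m u v : ℕ} (h : v < u) (h' : u < m) :
    New X Y m u v ↔ Y v u m ∧ ¬ X v u m := by
  unfold New; grind

theorem exists_top (hX : Cons V X) (hY : Cons V Y)
    (hXY : Sub V X Y)
    (hne : ∃ a ∈ V, ∃ b ∈ V, ∃ c ∈ V, a < b ∧ b < c ∧ Y a b c ∧ ¬ X a b c) :
    ∃ i ∈ V, ∃ j ∈ V, ∃ m ∈ V, i < j ∧ j < m ∧ Y i j m ∧ ¬ X i j m ∧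
      ∀ h ∈ V, h ≠ i → h ≠ j → h ≠ m → Uncut X h i j m ∨
        (j < h ∧ h < m ∧ ¬ X i j h ∧ ¬ X i h m ∧ ¬ X j h m ∧ Y i j h) := by
  classical
  obtain ⟨m, hm, hmax⟩ :=
    exists_last (s := V.filter fun m => ∃ a ∈ V, ∃ b ∈ V, a < b ∧ b < m ∧ Y a b m ∧ ¬ X a b m)
      (by obtain ⟨a, ha, b, hb, c, hc, h⟩ := hne
          exact ⟨c, by simpa using ⟨hc, a, ha, b, hb, h⟩⟩) (· < ·) (by simp)
      (fun a _ b _ c _ => lt_trans)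
  simp only [Finset.mem_filter] at hm hmax
  have hmax' : ∀ a ∈ V, ∀ b ∈ V, ∀ c ∈ V, a < b → b < c → m < c → Y a b c → X a b c := by
    intro a ha b hb c hc hab hbc hmc hYc
    by_contra hXc
    exact hmax c ⟨hc, a, ha, b, hb, hab, hbc, hYc, hXc⟩ hmc
  clear hmax
  obtain ⟨i, k, hi, hk, hik, hr⟩ : ∃ i k, i ∈ V ∧ k ∈ V ∧ (i < k ∧ k < m ∧ Y i k m ∧ ¬ X i k m) ∧
      ∀ h ∈ V, (New X Y m i h → ¬ Lt Y i k h) ∧ (New X Y m k h → ¬ Lt Y k i h) := by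
    obtain ⟨_, a, ha, b, hb, hab, hbm, h1, h2⟩ := hm
    obtain ⟨i, k, ⟨hi, hk, hD⟩, hr⟩ := exists_rightmost hY
      (fun u v => u ∈ V ∧ v ∈ V ∧ New X Y m u v)
      (fun u v ⟨hu, hv, h⟩ => ⟨hv, hu, h.symm⟩) (fun u ⟨_, _, h⟩ => by unfold New at h; omega)
      (fun u v h => h.1) ⟨a, b, ha, hb, .inl ⟨hab, hbm, h1, h2⟩⟩
    rcases hD with hD | hD
    · exact ⟨i, k, hi, hk, hD, fun h hh =>
        ⟨fun h1 => (hr h).1 ⟨hi, hh, h1⟩, fun h1 => (hr h).2 ⟨hk, hh, h1⟩⟩⟩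
    · exact ⟨k, i, hk, hi, hD, fun h hh =>
        ⟨fun h1 => (hr h).2 ⟨hk, hh, h1⟩, fun h1 => (hr h).1 ⟨hi, hh, h1⟩⟩⟩
  replace hm := hm.1
  obtain ⟨j, hj, ⟨hij, hjm, hy, hx⟩, hjmin⟩ :=
    exists_first_on_line hX hm (p := fun b => i < b ∧ b < m ∧ Y i b m ∧ ¬ X i b m) ⟨k, hk, hik⟩
  have hkj := hjmin k hk hik
  refine ⟨i, hi, j, hj, m, hm, hij, hjm, hy, hx, fun h hh h1 h2 h3 => ?_⟩
  rcases lt_or_gt_of_ne h3 with h3 | h3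
  swap
  · have q1 := hX hi hj hm hh hij hjm h3
    have q2 := hY hi hj hm hh hij hjm h3
    have q3 := hXY.four hi hj hm hh hij hjm h3
    have hY1 := hmax' i hi j hj h hh
    have hY2 := hmax' i hi m hm h hh
    have hY3 := hmax' j hj m hm h hh
    simp (disch := omega) only [Uncut, bel_iff₃]
    unfold Good4 at q1 q2
    grind (splits := 30)
  have hkj' : j = k ∨ Lt X m j k := by
    have := lt_or_lt (X := X) (u := m) (v := j) (w := k)
    grind
  have hjh := hjmin h hh
  have rj := hr j hj
  have rh := hr h hh
  clear hkj hr hjmin hmax'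
  obtain ⟨o1, o2, p1, p2⟩ := hik
  rcases hkj' with rfl | hkj
  · rcases lt_or_gt_of_ne h1 with h1 | h1
    · have q1 := hX hh hi hj hm (by omega) (by omega) (by omega)
      have q2 := hY hh hi hj hm (by omega) (by omega) (by omega)
      have q3 := hXY.four hh hi hj hm (by omega) (by omega) (by omega)
      simp (disch := omega) only [Uncut, new_iff₁, new_iff₂, lt_iff₁, lt_iff₂, lt_iff₃, lt_iff₄, lt_iff₅,
        lt_iff₆, bel_iff₁, bel_iff₂, bel_iff₃] at rh hjh ⊢
      unfold Good4 at q1 q2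
      clear hXY hX hY hne
      grind (splits := 60)
    rcases lt_or_gt_of_ne h2 with h2 | h2
    · have q1 := hX hi hh hj hm (by omega) (by omega) (by omega)
      have q2 := hY hi hh hj hm (by omega) (by omega) (by omega)
      have q3 := hXY.four hi hh hj hm (by omega) (by omega) (by omega)
      simp (disch := omega) only [Uncut, new_iff₁, new_iff₂, lt_iff₁, lt_iff₂, lt_iff₃, lt_iff₄, lt_iff₅,
        lt_iff₆, bel_iff₁, bel_iff₂, bel_iff₃] at rh hjh ⊢
      unfold Good4 at q1 q2
      clear hXY hX hY hne
      grind (splits := 60)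
    · have q1 := hX hi hj hh hm (by omega) (by omega) (by omega)
      have q2 := hY hi hj hh hm (by omega) (by omega) (by omega)
      have q3 := hXY.four hi hj hh hm (by omega) (by omega) (by omega)
      simp (disch := omega) only [Uncut, new_iff₁, new_iff₂, lt_iff₁, lt_iff₂, lt_iff₃, lt_iff₄, lt_iff₅,
        lt_iff₆, bel_iff₁, bel_iff₂, bel_iff₃] at rh hjh ⊢
      unfold Good4 at q1 q2
      clear hXY hX hY hne
      grind (splits := 60)
  · have hjk : j ≠ k := hkj.ne.2.2
    rcases lt_or_gt_of_ne h1 with h1 | h1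
    · rcases lt_or_gt_of_ne hjk with hjk | hjk
      · have q1 := hX.five hh hi hj hk hm (by omega) (by omega) (by omega) (by omega)
        have q2 := hY.five hh hi hj hk hm (by omega) (by omega) (by omega) (by omega)
        have q3 := hXY.five hh hi hj hk hm (by omega) (by omega) (by omega) (by omega)
        simp (disch := omega) only [Uncut, new_iff₁, new_iff₂, lt_iff₁, lt_iff₂, lt_iff₃, lt_iff₄, lt_iff₅,
          lt_iff₆, bel_iff₁, bel_iff₂, bel_iff₃] at rj rh hkj hjh ⊢
        unfold Good4 at q1 q2
        clear hXY hX hY hne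
        grind (splits := 60)
      · have q1 := hX.five hh hi hk hj hm (by omega) (by omega) (by omega) (by omega)
        have q2 := hY.five hh hi hk hj hm (by omega) (by omega) (by omega) (by omega)
        have q3 := hXY.five hh hi hk hj hm (by omega) (by omega) (by omega) (by omega)
        simp (disch := omega) only [Uncut, new_iff₁, new_iff₂, lt_iff₁, lt_iff₂, lt_iff₃, lt_iff₄, lt_iff₅,
          lt_iff₆, bel_iff₁, bel_iff₂, bel_iff₃] at rj rh hkj hjh ⊢
        unfold Good4 at q1 q2
        clear hXY hX hY hne
        grind (splits := 60)
    rcases eq_or_ne h k with rfl | hhk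
    · rcases lt_or_gt_of_ne h2 with h2 | h2
      · have q1 := hX hi hh hj hm (by omega) (by omega) (by omega)
        have q2 := hY hi hh hj hm (by omega) (by omega) (by omega)
        have q3 := hXY.four hi hh hj hm (by omega) (by omega) (by omega)
        simp (disch := omega) only [Uncut, new_iff₁, new_iff₂, lt_iff₁, lt_iff₂, lt_iff₃, lt_iff₄, lt_iff₅,
          lt_iff₆, bel_iff₁, bel_iff₂, bel_iff₃] at rj hkj hjh ⊢
        unfold Good4 at q1 q2
        clear hXY hX hY hne
        grind (splits := 60)
      · have q1 := hX hi hj hh hm (by omega) (by omega) (by omega)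
        have q2 := hY hi hj hh hm (by omega) (by omega) (by omega)
        have q3 := hXY.four hi hj hh hm (by omega) (by omega) (by omega)
        simp (disch := omega) only [Uncut, new_iff₁, new_iff₂, lt_iff₁, lt_iff₂, lt_iff₃, lt_iff₄, lt_iff₅,
          lt_iff₆, bel_iff₁, bel_iff₂, bel_iff₃] at rj hkj hjh ⊢
        unfold Good4 at q1 q2
        clear hXY hX hY hne
        grind (splits := 60)
    rcases lt_or_gt_of_ne h2 with h2 | h2
    · rcases lt_or_gt_of_ne hjk with hjk | hjk
      · have q1 := hX.five hi hh hj hk hm (by omega) (by omega) (by omega) (by omega)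
        have q2 := hY.five hi hh hj hk hm (by omega) (by omega) (by omega) (by omega)
        have q3 := hXY.five hi hh hj hk hm (by omega) (by omega) (by omega) (by omega)
        simp (disch := omega) only [Uncut, new_iff₁, new_iff₂, lt_iff₁, lt_iff₂, lt_iff₃, lt_iff₄, lt_iff₅,
          lt_iff₆, bel_iff₁, bel_iff₂, bel_iff₃] at rj rh hkj hjh ⊢
        unfold Good4 at q1 q2
        clear hXY hX hY hne
        grind (splits := 60)
      rcases lt_or_gt_of_ne hhk with hhk | hhk
      · have q1 := hX.five hi hh hk hj hm (by omega) (by omega) (by omega) (by omega)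
        have q2 := hY.five hi hh hk hj hm (by omega) (by omega) (by omega) (by omega)
        have q3 := hXY.five hi hh hk hj hm (by omega) (by omega) (by omega) (by omega)
        simp (disch := omega) only [Uncut, new_iff₁, new_iff₂, lt_iff₁, lt_iff₂, lt_iff₃, lt_iff₄, lt_iff₅,
          lt_iff₆, bel_iff₁, bel_iff₂, bel_iff₃] at rj rh hkj hjh ⊢
        unfold Good4 at q1 q2
        clear hXY hX hY hne
        grind (splits := 60)
      · have q1 := hX.five hi hk hh hj hm (by omega) (by omega) (by omega) (by omega)
        have q2 := hY.five hi hk hh hj hm (by omega) (by omega) (by omega) (by omega)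
        have q3 := hXY.five hi hk hh hj hm (by omega) (by omega) (by omega) (by omega)
        simp (disch := omega) only [Uncut, new_iff₁, new_iff₂, lt_iff₁, lt_iff₂, lt_iff₃, lt_iff₄, lt_iff₅,
          lt_iff₆, bel_iff₁, bel_iff₂, bel_iff₃] at rj rh hkj hjh ⊢
        unfold Good4 at q1 q2
        clear hXY hX hY hne
        grind (splits := 60)
    · rcases lt_or_gt_of_ne hjk with hjk | hjk
      · rcases lt_or_gt_of_ne hhk with hhk | hhk
        · have q1 := hX.five hi hj hh hk hm (by omega) (by omega) (by omega) (by omega)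
          have q2 := hY.five hi hj hh hk hm (by omega) (by omega) (by omega) (by omega)
          have q3 := hXY.five hi hj hh hk hm (by omega) (by omega) (by omega) (by omega)
          simp (disch := omega) only [Uncut, new_iff₁, new_iff₂, lt_iff₁, lt_iff₂, lt_iff₃, lt_iff₄, lt_iff₅,
            lt_iff₆, bel_iff₁, bel_iff₂, bel_iff₃] at rj rh hkj hjh ⊢
          unfold Good4 at q1 q2
          clear hXY hX hY hne
          grind (splits := 60)
        · have q1 := hX.five hi hj hk hh hm (by omega) (by omega) (by omega) (by omega)
          have q2 := hY.five hi hj hk hh hm (by omega) (by omega) (by omega) (by omega)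
          have q3 := hXY.five hi hj hk hh hm (by omega) (by omega) (by omega) (by omega)
          simp (disch := omega) only [Uncut, new_iff₁, new_iff₂, lt_iff₁, lt_iff₂, lt_iff₃, lt_iff₄, lt_iff₅,
            lt_iff₆, bel_iff₁, bel_iff₂, bel_iff₃] at rj rh hkj hjh ⊢
          unfold Good4 at q1 q2
          clear hXY hX hY hne
          grind (splits := 60)
      · have q1 := hX.five hi hk hj hh hm (by omega) (by omega) (by omega) (by omega)
        have q2 := hY.five hi hk hj hh hm (by omega) (by omega) (by omega) (by omega)
        have q3 := hXY.five hi hk hj hh hm (by omega) (by omega) (by omega) (by omega)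
        simp (disch := omega) only [Uncut, new_iff₁, new_iff₂, lt_iff₁, lt_iff₂, lt_iff₃, lt_iff₄, lt_iff₅,
          lt_iff₆, bel_iff₁, bel_iff₂, bel_iff₃] at rj rh hkj hjh ⊢
        unfold Good4 at q1 q2
        clear hXY hX hY hne
        grind (splits := 60)

theorem bel_conv_left (hX : Cons V X) {g u a w b : ℕ} (hu : u ∈ V) (ha : a ∈ V) (hw : w ∈ V)
    (hb : b ∈ V) (hg : g ∈ V) (h1 : Lt X u a w) (h2 : Lt X u w b)
    (h : Lt X u g a ↔ Lt X u g b) : Lt X u g w ↔ Lt X u g a := by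
  have t1 := fun q => Lt.trans hX hu hg ha hw q h1
  have t2 := fun q => Lt.trans hX hu hg hw hb q h2
  grind

/-- `g` is below the crossing of `u` and `w`, read along the line `u`. -/
def Below (X : ℕ → ℕ → ℕ → Prop) (g u w : ℕ) : Prop := Lt X u g w ↔ u < g

theorem below_comm {g u w : ℕ} (hgu : g ≠ u) (hgw : g ≠ w) (huw : u ≠ w) :
    Below X g u w ↔ Below X g w u := by
  rcases lt_or_gt_of_ne huw with h | h
  · exact (bel_left hgu h).symm.trans (bel_right hgu hgw h)
  · exact (bel_right hgw hgu h).symm.trans (bel_left hgw h)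

theorem bel_iff_below {g u w : ℕ} (hgu : g ≠ u) (huw : u < w) : Bel X g u w ↔ Below X g u w :=
  bel_left hgu huw

theorem Below.conv (hX : Cons V X) {g u a w b : ℕ} (hu : u ∈ V) (ha : a ∈ V) (hw : w ∈ V)
    (hb : b ∈ V) (hg : g ∈ V) (h1 : Lt X u a w) (h2 : Lt X u w b) {p : Prop}
    (h : Below X g u a ↔ p) (h' : Below X g u b ↔ p) :
    Below X g u w ↔ p := by
  have := bel_conv_left hX hu ha hw hb hg h1 h2
  unfold Below at *
  grind

theorem uncut_iff_below {g i j k : ℕ} (hij : i < j) (hjk : j < k) (hi : g ≠ i) (hj : g ≠ j) :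
    Uncut X g i j k ↔ (Below X g i j ↔ Below X g i k) ∧ (Below X g j k ↔ Below X g i k) := by
  unfold Uncut
  rw [bel_iff_below hi hij, bel_iff_below hi (hij.trans hjk), bel_iff_below hj hjk]

section Cell

variable {i j m : ℕ}

/-- `h` cuts the triangle `i, j, m` beyond `j`, and `Y` contains `i, j, h`. -/
def Cutter (V : Finset ℕ) (X Y : ℕ → ℕ → ℕ → Prop) (i j m h : ℕ) : Prop :=
  h ∈ V ∧ j < h ∧ h < m ∧ ¬ X i j h ∧ ¬ X i h m ∧ ¬ X j h m ∧ Y i j h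

/-- Two cutters cross inside the triangle `i, j, m`. -/
def Meet (V : Finset ℕ) (X Y : ℕ → ℕ → ℕ → Prop) (i j m u v : ℕ) : Prop :=
  Cutter V X Y i j m u ∧ Cutter V X Y i j m v ∧ Lt X i u v ∧ Lt X j v u

/-- `v` is the first cutter that `u` meets along `u`. -/
def FirstMeet (V : Finset ℕ) (X Y : ℕ → ℕ → ℕ → Prop) (i j m u v : ℕ) : Prop :=
  (Meet V X Y i j m u v ∨ Meet V X Y i j m v u) ∧
    ∀ b, Meet V X Y i j m u b ∨ Meet V X Y i j m b u → ¬ Lt X u b v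

theorem Meet.spec (hX : Cons V X) (hY : Cons V Y) (hXY : Sub V X Y) (hi : i ∈ V) (hj : j ∈ V)
    (hij : i < j) {u v : ℕ} (h : Meet V X Y i j m u v) :
    u < v ∧ ¬ X i u v ∧ X j u v ∧ Y i u v := by
  obtain ⟨⟨hu, u1, u2, u3, u4, u5, u6⟩, ⟨hv, v1, v2, v3, v4, v5, v6⟩, h1, h2⟩ := h
  rcases lt_or_gt_of_ne h1.ne.2.2 with huv | huv
  · have q1 := hX hi hj hu hv hij u1 huv
    have q2 := hY hi hj hu hv hij u1 huv
    have q3 := hXY.four hi hj hu hv hij u1 huv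
    simp (disch := omega) only [lt_iff₁, lt_iff₄] at h1 h2
    unfold Good4 at q1 q2
    grind
  · have q1 := hX hi hj hv hu hij v1 huv
    simp (disch := omega) only [lt_iff₁, lt_iff₄] at h1 h2
    unfold Good4 at q1
    grind

theorem exists_firstMeet (hX : Cons V X) {u : ℕ}
    (h : ∃ v, Meet V X Y i j m u v ∨ Meet V X Y i j m v u) : ∃ v, FirstMeet V X Y i j m u v := by
  obtain ⟨v, hv⟩ := h
  have hu : u ∈ V := by rcases hv with hv | hv; exacts [hv.1.1, hv.2.1.1]
  have hmem : ∀ v, (Meet V X Y i j m u v ∨ Meet V X Y i j m v u) → v ∈ V := by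
    rintro v (hv | hv); exacts [hv.2.1.1, hv.1.1]
  obtain ⟨w, hw, hp, hf⟩ := exists_first_on_line hX hu
    (p := fun v => Meet V X Y i j m u v ∨ Meet V X Y i j m v u) ⟨v, hmem v hv, hv⟩
  exact ⟨w, hp, fun b hb => hf b (hmem b hb) hb⟩

theorem exists_mutual (hX : Cons V X) (hY : Cons V Y) (hXY : Sub V X Y) (hi : i ∈ V) (hj : j ∈ V)
    (hij : i < j) (hne : ∃ u v, Meet V X Y i j m u v) :
    ∃ h w, Meet V X Y i j m h w ∧ FirstMeet V X Y i j m h w ∧ FirstMeet V X Y i j m w h := by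
  obtain ⟨h, hh, ⟨w, hhw, hf⟩, hlast⟩ := exists_last_on_line hX hi
    (p := fun u => ∃ v, Meet V X Y i j m u v ∧ FirstMeet V X Y i j m u v) (by
      obtain ⟨u, v, huv⟩ := hne
      obtain ⟨a, ha, ⟨b, hb⟩, hfirst⟩ := exists_first_on_line hX hi
        (p := fun u => ∃ v, Meet V X Y i j m u v ∨ Meet V X Y i j m v u) ⟨u, huv.1.1, v, .inl huv⟩
      obtain ⟨c, hc⟩ := exists_firstMeet hX ⟨b, hb⟩
      refine ⟨a, ha, c, ?_, hc⟩
      rcases hc.1 with h | h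
      · exact h
      · exact absurd h.2.2.1 (hfirst c h.1.1 ⟨a, .inl h⟩))
  have nolast : ∀ b c, Lt X i h b → Meet V X Y i j m b c → ¬ FirstMeet V X Y i j m b c :=
    fun b c h1 h2 h3 => hlast b h2.1.1 ⟨c, h2, h3⟩ h1
  obtain ⟨z, hz⟩ := exists_firstMeet hX ⟨h, .inr hhw⟩
  have hzw : Meet V X Y i j m z w := by
    rcases hz.1 with h | h
    · exact absurd hz (nolast _ _ hhw.2.2.1 h)
    · exact h
  refine ⟨h, w, hhw, hf, ?_⟩
  by_cases hzh : z = h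
  · exact hzh ▸ hz
  exfalso
  have hzV := hzw.1.1
  have hwV := hzw.2.1.1
  have s1 := hhw.spec hX hY hXY hi hj hij
  have s2 := hzw.spec hX hY hXY hi hj hij
  have hlt : Lt X w z h :=
    (lt_or_lt (by omega) (by omega) hzh).resolve_right (hz.2 h (.inr hhw))
  have hij' := hhw.1.2.1
  have hij'' := hzw.1.2.1
  have hiz : Lt X i h z := by
    refine (lt_or_lt (by omega) (by omega) (Ne.symm hzh)).resolve_right fun hlt' => ?_
    rcases lt_or_gt_of_ne hzh with o | o
    · have q := hX hj hzV hh hwV (by omega) o s1.1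
      by_cases hc : X j z h
      · have k : Meet V X Y i j m z h := ⟨hzw.1, hhw.1, hlt', by rwa [lt_iff₄ (by omega) o]⟩
        have := hf.2 z (.inr k)
        simp (disch := omega) only [lt_iff₂, lt_iff₃] at this hlt
        grind
      · simp (disch := omega) only [lt_iff₃] at hlt
        unfold Good4 at q
        grind
    · have q := hX hi hh hzV hwV (by omega) o s2.1
      simp (disch := omega) only [lt_iff₄, lt_iff₆] at hlt hlt'
      unfold Good4 at q
      grind
  obtain ⟨y, hy⟩ := exists_firstMeet hX ⟨w, .inl hzw⟩
  have hyz : Meet V X Y i j m y z := by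
    rcases hy.1 with h | h
    · exact absurd hy (nolast _ _ hiz h)
    · exact h
  have hyV := hyz.1.1
  have s3 := hyz.spec hX hY hXY hi hj hij
  have hyw : Meet V X Y i j m y w := ⟨hyz.1, hzw.2.1,
    Lt.trans hX hi hyV hzV hwV hyz.2.2.1 hzw.2.2.1, Lt.trans hX hj hwV hzV hyV hzw.2.2.2 hyz.2.2.2⟩
  have e1 := hy.2 w (.inl hzw)
  have e2 := hz.2 y (.inr hyw)
  rw [lt_iff₅ (by omega) (by omega)] at e1
  rw [lt_iff₃ (by omega) (by omega)] at e2
  exact e2 e1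

end Cell

set_option maxHeartbeats 800000 in
/-- Felsner–Weil: inclusion of consistent sets is generated by single steps. -/
theorem exists_addable (hX : Cons V X) (hY : Cons V Y) (hXY : Sub V X Y)
    (hne : ∃ a ∈ V, ∃ b ∈ V, ∃ c ∈ V, a < b ∧ b < c ∧ Y a b c ∧ ¬ X a b c) :
    ∃ i j k, Addable V X i j k ∧ Y i j k := by
  obtain ⟨i, hi, j, hj, m, hm, hij, hjm, hy, hx, hcut⟩ := exists_top hX hY hXY hne
  have hcut' : ∀ g ∈ V, g ≠ i → g ≠ j → g ≠ m → ¬ Cutter V X Y i j m g →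
      (Below X g i j ↔ Below X g i m) ∧ (Below X g j m ↔ Below X g i m) := by
    intro g hg h1 h2 h3 h4
    rw [← uncut_iff_below hij hjm h1 h2]
    exact (hcut g hg h1 h2 h3).resolve_right fun h => h4 ⟨hg, h⟩
  have on_i : ∀ g ∈ V, g ≠ i → g ≠ j → g ≠ m → ¬ Cutter V X Y i j m g →
      ∀ h, Cutter V X Y i j m h → h ≠ g → (Below X g i h ↔ Below X g i m) := by
    rintro g hg h1 h2 h3 h4 h ⟨hh, o1, o2, n1, n2, n3, n4⟩ hne
    exact Below.conv hX hi hj hh hm hg (by rwa [lt_iff₁ hij o1]) (by rwa [lt_iff₁ (by omega) o2])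
      (hcut' g hg h1 h2 h3 h4).1 Iff.rfl
  have on_j : ∀ g ∈ V, g ≠ i → g ≠ j → g ≠ m → ¬ Cutter V X Y i j m g →
      ∀ h, Cutter V X Y i j m h → h ≠ g → (Below X g j h ↔ Below X g i m) := by
    rintro g hg h1 h2 h3 h4 h ⟨hh, o1, o2, n1, n2, n3, n4⟩ hne
    exact Below.conv hX hj hi hh hm hg (by rwa [lt_iff₂ hij o1]) (by rwa [lt_iff₁ (by omega) o2])
      ((below_comm h2 h1 hij.ne').trans (hcut' g hg h1 h2 h3 h4).1)
      (hcut' g hg h1 h2 h3 h4).2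
  by_cases hC : ∃ h, Cutter V X Y i j m h
  swap
  · push Not at hC
    exact ⟨i, j, m, ⟨hi, hj, hm, hij, hjm, hx, fun h hh h1 h2 h3 => by
      rw [uncut_iff_below hij hjm h1 h2]; exact hcut' h hh h1 h2 h3 (hC h)⟩, hy⟩
  by_cases hK : ∃ u v, Meet V X Y i j m u v
  swap
  · obtain ⟨h, hh, hc, hfirst⟩ := exists_first_on_line hX hi (hC.imp fun h hc => ⟨hc.1, hc⟩)
    have hc' := hc
    obtain ⟨_, o1, o2, n1, n2, n3, n4⟩ := hc'
    refine ⟨i, j, h, ⟨hi, hj, hh, hij, o1, n1, fun g hg h1 h2 h3 => ?_⟩, n4⟩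
    by_cases hgm : g = m
    · subst hgm
      simp (disch := omega) only [Uncut, bel_iff₃]
      simp [*]
    by_cases hgc : Cutter V X Y i j m g
    · have l1 : Lt X i h g :=
        (lt_or_lt (by omega) h1.symm (Ne.symm h3)).resolve_right (hfirst g hg hgc)
      have l2 : Lt X j h g := (lt_or_lt (by omega) h2.symm (Ne.symm h3)).resolve_right
        fun hl => hK ⟨h, g, hc, hgc, l1, hl⟩
      obtain ⟨_, m1, m2, m3, m4, m5, m6⟩ := hgc
      unfold Uncut
      rcases lt_or_gt_of_ne h3 with o | o
      · simp (disch := omega) only [bel_iff₂, bel_iff₃, lt_iff₄] at l1 l2 ⊢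
        simp [*]
      · simp (disch := omega) only [bel_iff₃, lt_iff₁] at l1 l2 ⊢
        simp [*]
    · rw [uncut_iff_below hij o1 h1 h2, on_i g hg h1 h2 hgm hgc h hc h3.symm,
        on_j g hg h1 h2 hgm hgc h hc h3.symm]
      exact ⟨(hcut' g hg h1 h2 hgm hgc).1, Iff.rfl⟩
  · obtain ⟨h, w, hhw, hf1, hf2⟩ := exists_mutual hX hY hXY hi hj hij hK
    obtain ⟨o3, x1, x2, y1⟩ := hhw.spec hX hY hXY hi hj hij
    obtain ⟨hch, hcw, -⟩ := id hhw
    obtain ⟨hh, o1, o2, n1, n2, n3, n4⟩ := id hch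
    obtain ⟨hw, p1, p2, r1, r2, r3, r4⟩ := id hcw
    refine ⟨i, h, w, ⟨hi, hh, hw, by omega, o3, x1, fun g hg h1 h2 h3 => ?_⟩, y1⟩
    by_cases hgm : g = m
    · subst hgm
      have q := hX hj hh hw hm o1 o3 p2
      simp (disch := omega) only [Uncut, bel_iff₃]
      unfold Good4 at q
      clear hK hC on_i on_j hcut hcut' hX hY hXY hf1 hf2
      grind (splits := 30)
    by_cases hgj : g = j
    · subst hgj
      simp (disch := omega) only [Uncut, bel_iff₁, bel_iff₂]
      clear hK hC on_i on_j hcut hcut' hX hY hXY hf1 hf2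
      simp [*]
    by_cases hgc : Cutter V X Y i j m g
    · have e1 := hf1.2 g
      have e2 := hf2.2 g
      obtain ⟨_, m1, m2, m3, m4, m5, m6⟩ := id hgc
      simp only [Meet, hgc, hch, hcw, true_and] at e1 e2
      unfold Uncut
      clear hf1 hf2 hK hC on_i on_j hcut hcut' hY hXY
      rcases lt_or_gt_of_ne h2 with o | o
      · have q := hX.five hi hj hg hh hw hij m1 o o3
        simp (disch := omega) only [bel_iff₂, bel_iff₁, bel_iff₃, lt_iff₁, lt_iff₂, lt_iff₃,
          lt_iff₄, lt_iff₅, lt_iff₆] at e1 e2 ⊢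
        unfold Good4 at q
        grind (splits := 30)
      rcases lt_or_gt_of_ne h3 with o' | o'
      · have q := hX.five hi hj hh hg hw hij o1 o o'
        simp (disch := omega) only [bel_iff₂, bel_iff₁, bel_iff₃, lt_iff₁, lt_iff₂, lt_iff₃,
          lt_iff₄, lt_iff₅, lt_iff₆] at e1 e2 ⊢
        unfold Good4 at q
        grind (splits := 30)
      · have q := hX.five hi hj hh hw hg hij o1 o3 o'
        simp (disch := omega) only [bel_iff₂, bel_iff₁, bel_iff₃, lt_iff₁, lt_iff₂, lt_iff₃,
          lt_iff₄, lt_iff₅, lt_iff₆] at e1 e2 ⊢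
        unfold Good4 at q
        grind (splits := 30)
    · rw [uncut_iff_below (by omega) o3 h1 h2]
      have b1 := on_i g hg h1 hgj hgm hgc h hch (Ne.symm h2)
      have b2 := on_i g hg h1 hgj hgm hgc w hcw (Ne.symm h3)
      have b3 := on_j g hg h1 hgj hgm hgc h hch (Ne.symm h2)
      rw [below_comm h1 h2 (by omega)] at b1
      rw [below_comm hgj h2 (by omega)] at b3
      rw [b2, below_comm h1 h2 (by omega), b1]
      exact ⟨Iff.rfl, Below.conv hX hh hi hw hj hg (by rwa [lt_iff₂ (by omega) o3])
        (by rwa [lt_iff₅ o1 o3]) b1 b3⟩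

variable {Z : ℕ → ℕ → ℕ → Prop}

/-- `X` together with the triple `i, j, k`. -/
def ins (X : ℕ → ℕ → ℕ → Prop) (i j k : ℕ) : ℕ → ℕ → ℕ → Prop :=
  fun a b c => X a b c ∨ (a = i ∧ b = j ∧ c = k)

theorem Addable.cons_ins (hX : Cons V X) {i j k : ℕ} (h : Addable V X i j k) :
    Cons V (ins X i j k) := by
  intro a b c d ha hb hc hd hab hbc hcd
  obtain ⟨hi, hj, hk, hij, hjk, hn, hu⟩ := h
  have q := hX ha hb hc hd hab hbc hcd
  unfold ins
  by_cases h1 : a = i ∧ b = j ∧ c = k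
  · obtain ⟨rfl, rfl, rfl⟩ := h1
    have u := hu d hd (by omega) (by omega) (by omega)
    simp (disch := omega) only [Uncut, bel_iff₁, bel_iff₂, bel_iff₃] at u
    clear hu hX
    unfold Good4 at q ⊢
    grind (splits := 30)
  by_cases h2 : a = i ∧ b = j ∧ d = k
  · obtain ⟨rfl, rfl, rfl⟩ := h2
    have u := hu c hc (by omega) (by omega) (by omega)
    simp (disch := omega) only [Uncut, bel_iff₁, bel_iff₂, bel_iff₃] at u
    clear hu hX
    unfold Good4 at q ⊢
    grind (splits := 30)
  by_cases h3 : a = i ∧ c = j ∧ d = k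
  · obtain ⟨rfl, rfl, rfl⟩ := h3
    have u := hu b hb (by omega) (by omega) (by omega)
    simp (disch := omega) only [Uncut, bel_iff₁, bel_iff₂, bel_iff₃] at u
    clear hu hX
    unfold Good4 at q ⊢
    grind (splits := 30)
  by_cases h4 : b = i ∧ c = j ∧ d = k
  · obtain ⟨rfl, rfl, rfl⟩ := h4
    have u := hu a ha (by omega) (by omega) (by omega)
    simp (disch := omega) only [Uncut, bel_iff₁, bel_iff₂, bel_iff₃] at u
    clear hu hX
    unfold Good4 at q ⊢
    grind (splits := 30)
  simpa [h1, h2, h3, h4] using q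

theorem Sub.ins (h : Sub V X Z) {i j k : ℕ} (hZ : Z i j k) : Sub V (ins X i j k) Z := by
  rintro a b c ha hb hc hab hbc (h1 | ⟨rfl, rfl, rfl⟩)
  · exact h ha hb hc hab hbc h1
  · exact hZ

/-- The crossing of `u < v` lies on the triangle side of `a` and `d`. -/
def Inner (X : ℕ → ℕ → ℕ → Prop) (a d u v : ℕ) : Prop := a < u → v < d → ¬ X a u v ∧ ¬ X u v d

/-- All vertices of the triangle `i, j, k` lie on the triangle side of `a` and `d`. -/
def Corner (X : ℕ → ℕ → ℕ → Prop) (a d i j k : ℕ) : Prop :=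
  Inner X a d i j ∧ Inner X a d i k ∧ Inner X a d j k

/-- If adding an addable triple turns a cut triple into an addable corner, then the added triple is
a corner. -/
theorem corner_of_cut (hX : Cons V X) {a d : ℕ} (ha : a ∈ V) (hd : d ∈ V)
    (had : a < d) (hmin : ∀ e ∈ V, e ≠ a → e ≠ d → a < e ∧ e < d ∧ ¬ X a e d) {i j k p q r h : ℕ}
    (ht : Addable V X i j k) (hf : Addable V (ins X i j k) p q r)
    (hc : Corner (ins X i j k) a d p q r) (hh : h ∈ V) (h1 : h ≠ p) (h2 : h ≠ q) (h3 : h ≠ r)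
    (hcut : ¬ Uncut X h p q r) : Corner X a d i j k := by
  have hcX : Corner X a d p q r := by
    unfold Corner Inner ins at *; grind
  obtain ⟨hp, hq, hr, hpq, hqr, hn, hu⟩ := hf
  obtain ⟨hi, hj, hk, hij, hjk, hn', hu'⟩ := ht
  have u := hu h hh h1 h2 h3
  have hn0 : ¬ X p q r := fun h => hn (.inl h)
  have hnt : ¬ (p = i ∧ q = j ∧ r = k) := fun h => hn (.inr h)
  have hle : ∀ e ∈ V, a ≤ e ∧ e ≤ d := by
    intro e he
    rcases eq_or_ne e a with rfl | h
    · omega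
    rcases eq_or_ne e d with rfl | h'
    · omega
    · have := hmin e he h h'; omega
  have cut : ∀ e ∈ V, e ≠ a → e ≠ d → ¬ X a e d := fun e he h h' => (hmin e he h h').2.2
  have ua : a < i → Uncut X a i j k := fun h => hu' a ha (by omega) (by omega) (by omega)
  have ud : k < d → Uncut X d i j k := fun h => hu' d hd (by omega) (by omega) (by omega)
  have a1 := hle p hp
  have a2 := hle r hr
  have a3 := hle h hh
  have c1 := cut p hp
  have c2 := cut q hq
  have c3 := cut r hr
  have c4 := cut h hh
  have ai := hle i hi
  have dk := hle k hk
  have ua' : a < i → (X a i j ↔ X a i k) ∧ (X a j k ↔ X a i k) := by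
    intro h
    simpa (disch := omega) only [Uncut, bel_iff₁] using ua h
  have ud' : k < d → (X i j d ↔ X i k d) ∧ (X j k d ↔ X i k d) := by
    intro h
    simpa (disch := omega) only [Uncut, bel_iff₃] using ud h
  clear hu hu' hn hc hmin hle cut ua ud
  rcases lt_or_gt_of_ne h1 with o1 | o1
  · have g := hX hh hp hq hr o1 hpq hqr
    simp (disch := omega) only [Uncut, bel_iff₁, bel_iff₂, bel_iff₃] at u hcut
    clear hX ha hd hp hq hr hi hj hk hh
    unfold Good4 ins Corner Inner at *
    grind (splits := 60)
  rcases lt_or_gt_of_ne h2 with o2 | o2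
  · have g := hX hp hh hq hr o1 o2 hqr
    simp (disch := omega) only [Uncut, bel_iff₁, bel_iff₂, bel_iff₃] at u hcut
    clear hX ha hd hp hq hr hi hj hk hh
    unfold Good4 ins Corner Inner at *
    grind (splits := 60)
  rcases lt_or_gt_of_ne h3 with o3 | o3
  · have g := hX hp hq hh hr hpq o2 o3
    simp (disch := omega) only [Uncut, bel_iff₁, bel_iff₂, bel_iff₃] at u hcut
    clear hX ha hd hp hq hr hi hj hk hh
    unfold Good4 ins Corner Inner at *
    grind (splits := 60)
  · have g := hX hp hq hr hh hpq hqr o3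
    simp (disch := omega) only [Uncut, bel_iff₁, bel_iff₂, bel_iff₃] at u hcut
    clear hX ha hd hp hq hr hi hj hk hh
    unfold Good4 ins Corner Inner at *
    grind (splits := 60)

theorem exists_corner {a d : ℕ} (ha : a ∈ V) (hd : d ∈ V) (had : a < d) (hX : Cons V X)
    (hZ : Cons V Z) (hXZ : Sub V X Z)
    (hmin : ∀ e ∈ V, e ≠ a → e ≠ d → a < e ∧ e < d ∧ ¬ X a e d ∧ Z a e d)
    (hne : ∃ e ∈ V, e ≠ a ∧ e ≠ d) :
    ∃ p q r, Addable V X p q r ∧ Z p q r ∧ Corner X a d p q r := by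
  classical
  obtain ⟨N, hN⟩ : ∃ N, ((V ×ˢ V ×ˢ V).filter
    fun t => Z t.1 t.2.1 t.2.2 ∧ ¬ X t.1 t.2.1 t.2.2).card = N := ⟨_, rfl⟩
  induction N using Nat.strong_induction_on generalizing X with
  | _ N ih =>
    obtain ⟨i, j, k, ht, hZt⟩ := exists_addable hX hZ hXZ (by
      obtain ⟨e, he, h1, h2⟩ := hne
      exact ⟨a, ha, e, he, d, hd, (hmin e he h1 h2).1, (hmin e he h1 h2).2.1,
        (hmin e he h1 h2).2.2.2, (hmin e he h1 h2).2.2.1⟩)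
    by_cases hc : Corner X a d i j k
    · exact ⟨i, j, k, ht, hZt, hc⟩
    have hlt : ((V ×ˢ V ×ˢ V).filter
        fun t => Z t.1 t.2.1 t.2.2 ∧ ¬ ins X i j k t.1 t.2.1 t.2.2).card < N := by
      rw [← hN]
      refine Finset.card_lt_card (Finset.ssubset_iff_of_subset (fun t => ?_) |>.2
        ⟨(i, j, k), ?_, ?_⟩)
      · rw [Finset.mem_filter, Finset.mem_filter]
        exact fun h => ⟨h.1, h.2.1, fun h' => h.2.2 (.inl h')⟩
      · simpa using ⟨⟨ht.1, ht.2.1, ht.2.2.1⟩, hZt, ht.2.2.2.2.2.1⟩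
      · simp [ins]
    have hnot : ∀ e ∈ V, e ≠ a → e ≠ d → ¬ ins X i j k a e d := by
      rintro e he h1 h2 (h | ⟨rfl, rfl, rfl⟩)
      · exact (hmin e he h1 h2).2.2.1 h
      · exact hc ⟨fun h => absurd h (lt_irrefl _), fun h => absurd h (lt_irrefl _),
          fun _ h => absurd h (lt_irrefl _)⟩
    obtain ⟨p, q, r, hf, hZf, hfc⟩ := ih _ hlt (ht.cons_ins hX) (hXZ.ins hZt)
      (fun e he h1 h2 => ⟨(hmin e he h1 h2).1, (hmin e he h1 h2).2.1, hnot e he h1 h2,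
        (hmin e he h1 h2).2.2.2⟩) rfl
    refine ⟨p, q, r, ⟨hf.1, hf.2.1, hf.2.2.1, hf.2.2.2.1, hf.2.2.2.2.1,
      fun h => hf.2.2.2.2.2.1 (.inl h), fun h hh h1 h2 h3 => by_contra fun hcut => hc ?_⟩, hZf, ?_⟩
    · exact corner_of_cut hX ha hd had (fun e he h1 h2 => ⟨(hmin e he h1 h2).1,
        (hmin e he h1 h2).2.1, (hmin e he h1 h2).2.2.1⟩) ht hf hfc hh h1 h2 h3 hcut
    · unfold Corner Inner ins at *; grind

/-- `e` cuts off the vertex of `a` and `d` from the triangle `a, b, d`, and is below it. -/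
def Tip (V : Finset ℕ) (X : ℕ → ℕ → ℕ → Prop) (a b d e : ℕ) : Prop :=
  e ∈ V ∧ e ≠ a ∧ e ≠ b ∧ e ≠ d ∧ ¬ Below X e a b ∧ ¬ Below X e b d ∧ Below X e a d

theorem Tip.spec (hX : Cons V X) {a b d e : ℕ} (ha : a ∈ V) (hb : b ∈ V) (hd : d ∈ V)
    (hab : a < b) (hbd : b < d) (hn : ¬ X a b d) (h : Tip V X a b d e) :
    a < e ∧ e < d ∧ ¬ X a e d ∧ (e < b → X a e b ∧ ¬ X e b d) ∧ (b < e → X b e d ∧ ¬ X a b e) := by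
  obtain ⟨he, h1, h2, h3, h4, h5, h6⟩ := h
  rw [← bel_iff_below h1 hab] at h4
  rw [← bel_iff_below h2 hbd] at h5
  rw [← bel_iff_below h1 (hab.trans hbd)] at h6
  rcases lt_or_gt_of_ne h1 with o | o
  · have q := hX he ha hb hd o hab hbd
    simp (disch := omega) only [bel_iff₁, bel_iff₂, bel_iff₃] at h4 h5 h6
    unfold Good4 at q; grind
  rcases lt_or_gt_of_ne h3 with o' | o'
  swap
  · have q := hX ha hb hd he hab hbd o'
    simp (disch := omega) only [bel_iff₁, bel_iff₂, bel_iff₃] at h4 h5 h6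
    unfold Good4 at q; grind
  rcases lt_or_gt_of_ne h2 with o'' | o''
  · simp (disch := omega) only [bel_iff₁, bel_iff₂, bel_iff₃] at h4 h5 h6
    grind
  · simp (disch := omega) only [bel_iff₁, bel_iff₂, bel_iff₃] at h4 h5 h6
    grind

theorem exists_addable_of_tip (hX : Cons V X) (hZ : Cons V Z) (hXZ : Sub V X Z) {a b d : ℕ}
    (ha : a ∈ V) (hb : b ∈ V) (hd : d ∈ V) (hab : a < b) (hbd : b < d) (hn : ¬ X a b d)
    (hz : Z a b d) (hne : ∃ e, Tip V X a b d e)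
    (hrest : ∀ h ∈ V, h ≠ a → h ≠ b → h ≠ d → ¬ Tip V X a b d h → Uncut X h a b d ∨
      (a < h ∧ h < d ∧ ¬ X a h d ∧ ∀ e, Tip V X a b d e → ¬ Below X e a h ∧ ¬ Below X e h d)) :
    ∃ p q r, Addable V X p q r ∧ Z p q r ∧ ∀ h ∈ V, ¬ Tip V X a b d h → h ≠ a → h ≠ d →
      Below X h a d → h ≠ p ∧ h ≠ q ∧ h ≠ r ∧ Below X h p q := by
  classical
  have had := hab.trans hbd
  have spec : ∀ e, Tip V X a b d e → _ := fun e h => h.spec hX ha hb hd hab hbd hn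
  have sgn : ∀ h ∈ V, ¬ Tip V X a b d h → h ≠ a → h ≠ d → ∀ e, Tip V X a b d e →
      (Below X h e a ↔ Below X h a d) ∧ (Below X h e d ↔ Below X h a d) := by
    intro h hh h1 h2 h3 e he
    have hhe : h ≠ e := fun hhe => h1 (hhe ▸ he)
    obtain ⟨heV, e1, e2, e3, e4, e5, e6⟩ := id he
    obtain ⟨s1, s2, s3, s4, s5⟩ := spec e he
    rw [below_comm hhe h2 e1, below_comm hhe h3 e3]
    rw [below_comm e2 e3 hbd.ne] at e5
    by_cases hhb : h = b
    · subst hhb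
      have : Lt X a h e :=
        (lt_or_lt hab.ne s1.ne hhe).resolve_right fun h => e4 (iff_of_true h s1)
      have h' : Lt X d e h :=
        (lt_or_lt e3.symm h3.symm e2).resolve_right fun h => e5 (iff_of_false h.asymm (by omega))
      have h'' : Below X h a d := by
        rw [← bel_iff_below h2 had, bel_iff₂ hab hbd]; exact hn
      unfold Below at h'' ⊢
      have := h'.asymm
      grind
    rcases hrest h hh h2 hhb h3 h1 with hu | ⟨t1, t2, t3, t4⟩
    · rw [uncut_iff_below hab hbd h2 hhb] at hu
      have l1 : Lt X a b e :=
        (lt_or_lt hab.ne s1.ne e2.symm).resolve_right fun h => e4 (iff_of_true h s1)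
      have l2 : Lt X a e d := e6.2 s1
      have l3 : Lt X d e b :=
        (lt_or_lt e3.symm hbd.ne' e2).resolve_right fun h => e5 (iff_of_false h.asymm (by omega))
      have l4 : Lt X d a e := by
        rw [lt_iff₃ s1 s2]; exact s3
      refine ⟨Below.conv hX ha hb heV hd hh l1 l2 hu.1 Iff.rfl,
        Below.conv hX hd ha heV hb hh l4 l3 (below_comm h3 h2 had.ne') ?_⟩
      rw [below_comm h3 hhb hbd.ne']; exact hu.2
    · obtain ⟨f1, f2⟩ := t4 e he
      rw [below_comm hhe.symm e3 t2.ne] at f2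
      have l1 : Lt X a h e :=
        (lt_or_lt t1.ne s1.ne hhe).resolve_right fun h => f1 (iff_of_true h s1)
      have l2 : Lt X d e h :=
        (lt_or_lt e3.symm h3.symm hhe.symm).resolve_right
          fun h => f2 (iff_of_false h.asymm (by omega))
      have h'' : Below X h a d := by
        rw [← bel_iff_below h2 had, bel_iff₂ t1 t2]; exact t3
      unfold Below at h'' ⊢
      have := l2.asymm
      grind
  set W := V.filter fun e => Tip V X a b d e ∨ e = a ∨ e = d with hW
  have hWV : ∀ {e}, e ∈ W → e ∈ V := fun h => (Finset.mem_filter.1 h).1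
  have hWm : ∀ {e}, e ∈ W → Tip V X a b d e ∨ e = a ∨ e = d := fun h => (Finset.mem_filter.1 h).2
  have sgn' : ∀ h ∈ V, h ∉ W → ∀ u ∈ W, ∀ v ∈ W, u < v → Inner X a d u v →
      (Below X h u v ↔ Below X h a d) := by
    intro h hh hhW u hu v hv huv hin
    have g : ¬ Tip V X a b d h ∧ h ≠ a ∧ h ≠ d := by
      simp only [hW, Finset.mem_filter, not_and, not_or] at hhW; exact hhW hh
    have hne : ∀ w ∈ W, h ≠ w := fun w hw h' => hhW (h' ▸ hw)
    have sg := sgn h hh g.1 g.2.1 g.2.2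
    have hne_u := hne u hu
    have hne_v := hne v hv
    rcases hWm hu with h1 | rfl | rfl
    · have su := spec u h1
      rcases hWm hv with h2 | rfl | rfl
      · have sv := spec v h2
        have hin := hin su.1 sv.2.1
        exact Below.conv hX (hWV hu) ha (hWV hv) hd hh (by rw [lt_iff₂ su.1 huv]; exact hin.1)
          (by rw [lt_iff₁ huv sv.2.1]; exact hin.2) (sg u h1).1 (sg u h1).2
      · exact absurd su.1 (by omega)
      · exact (sg u h1).2
    · rcases hWm hv with h2 | rfl | rfl
      · rw [below_comm hne_u hne_v huv.ne]; exact (sg v h2).1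
      · exact absurd huv (by omega)
      · exact Iff.rfl
    · rcases hWm hv with h2 | rfl | rfl
      · exact absurd (spec v h2).2.1 (by omega)
      · exact absurd huv (by omega)
      · exact absurd huv (by omega)
  have haW : a ∈ W := by simp [hW, ha]
  have hdW : d ∈ W := by simp [hW, hd]
  obtain ⟨p, q, r, hf, hZf, c1, c2, c3⟩ := exists_corner haW hdW had
    (fun a b c d ha hb hc hd => hX (hWV ha) (hWV hb) (hWV hc) (hWV hd))
    (fun a b c d ha hb hc hd => hZ (hWV ha) (hWV hb) (hWV hc) (hWV hd))
    (fun a b c ha hb hc => hXZ (hWV ha) (hWV hb) (hWV hc)) (by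
      intro e he h1 h2
      have ht := (hWm he).resolve_right fun h => h.elim h1 h2
      obtain ⟨s1, s2, s3, s4, s5⟩ := spec e ht
      refine ⟨s1, s2, s3, ?_⟩
      rcases lt_or_gt_of_ne ht.2.2.1 with o | o
      · have q := hZ ha (hWV he) hb hd s1 o hbd
        exact q.1 (hXZ ha (hWV he) hb s1 o (s4 o).1) hz
      · have q := hZ ha hb (hWV he) hd hab o s2
        exact q.2.2.2.1 hz (hXZ hb (hWV he) hd o s2 (s5 o).1)) (by
      obtain ⟨e, he⟩ := hne
      exact ⟨e, by simp [hW, he, he.1], he.2.1, he.2.2.2.1⟩)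
  obtain ⟨hp, hq, hr, hpq, hqr, hnf, hu⟩ := hf
  refine ⟨p, q, r, ⟨hWV hp, hWV hq, hWV hr, hpq, hqr, hnf, fun h hh h1 h2 h3 => ?_⟩, hZf, ?_⟩
  · by_cases hhW : h ∈ W
    · exact hu h hhW h1 h2 h3
    · rw [uncut_iff_below hpq hqr h1 h2, sgn' h hh hhW p hp q hq hpq c1,
        sgn' h hh hhW p hp r hr (hpq.trans hqr) c2, sgn' h hh hhW q hq r hr hqr c3]
      exact ⟨Iff.rfl, Iff.rfl⟩
  · intro h hh h1 h2 h3 h4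
    have hhW : h ∉ W := by simp [hW, h1, h2, h3]
    have hne : ∀ w ∈ W, h ≠ w := fun w hw h' => hhW (h' ▸ hw)
    exact ⟨hne p hp, hne q hq, hne r hr, (sgn' h hh hhW p hp q hq hpq c1).2 h4⟩

/-- The triples generated from `S` when the two extreme triples of a packet generate the packet. -/
inductive Gen (S : ℕ → ℕ → ℕ → Prop) : ℕ → ℕ → ℕ → Prop
  | base {a b c} : S a b c → Gen S a b c
  | left {a b c d} : a < b → b < c → c < d → Gen S a b c → Gen S b c d → Gen S a b d
  | right {a b c d} : a < b → b < c → c < d → Gen S a b c → Gen S b c d → Gen S a c d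

/-- The packet of four lines avoids `X` and is contained in `C`. -/
def Full (X C : ℕ → ℕ → ℕ → Prop) (a b c d : ℕ) : Prop :=
  (¬ X a b c ∧ ¬ X a b d ∧ ¬ X a c d ∧ ¬ X b c d) ∧ C a b c ∧ C a b d ∧ C a c d ∧ C b c d

/-- The line `h` does not cut the triangle `i, j, k`, or cuts it within a full packet. -/
def Neat (X C : ℕ → ℕ → ℕ → Prop) (h i j k : ℕ) : Prop :=
  Uncut X h i j k ∨ (i < h ∧ h < j ∧ Full X C i h j k) ∨ (j < h ∧ h < k ∧ Full X C i j h k)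

/-- All triples of `C` of width less than `D` are neat. -/
def NeatBelow (V : Finset ℕ) (X C : ℕ → ℕ → ℕ → Prop) (D : ℕ) : Prop :=
  ∀ ⦃i j k h⦄, C i j k → k < i + D → h ∈ V → h ≠ i → h ≠ j → h ≠ k → Neat X C h i j k

/-- All triples of `C` are neat. -/
def AllNeat (V : Finset ℕ) (X C : ℕ → ℕ → ℕ → Prop) : Prop :=
  ∀ ⦃i j k h⦄, C i j k → h ∈ V → h ≠ i → h ≠ j → h ≠ k → Neat X C h i j k

variable {S : ℕ → ℕ → ℕ → Prop}

theorem Gen.mem (hX : Cons V X) (hS : ∀ i j k, S i j k → Addable V X i j k) {i j k : ℕ}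
    (h : Gen S i j k) : i ∈ V ∧ j ∈ V ∧ k ∈ V ∧ i < j ∧ j < k ∧ ¬ X i j k := by
  induction h with
  | base h => have := hS _ _ _ h; exact ⟨this.1, this.2.1, this.2.2.1, this.2.2.2.1,
      this.2.2.2.2.1, this.2.2.2.2.2.1⟩
  | left h1 h2 h3 _ _ ih1 ih2 =>
    have q := hX ih1.1 ih1.2.1 ih1.2.2.1 ih2.2.2.1 h1 h2 h3
    exact ⟨ih1.1, ih1.2.1, ih2.2.2.1, h1, h2.trans h3, fun h =>
      (q.2.2.2.2.2.1 h).elim ih1.2.2.2.2.2 ih2.2.2.2.2.2⟩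
  | right h1 h2 h3 _ _ ih1 ih2 =>
    have q := hX ih1.1 ih1.2.1 ih1.2.2.1 ih2.2.2.1 h1 h2 h3
    exact ⟨ih1.1, ih1.2.2.1, ih2.2.2.1, h1.trans h2, h3, fun h =>
      (q.2.2.2.2.2.2.1 h).elim ih1.2.2.2.2.2 ih2.2.2.2.2.2⟩

theorem Gen.subset (hX : Cons V X) (hS : ∀ i j k, S i j k → Addable V X i j k) (hZ : Cons V Z)
    (hSZ : ∀ i j k, S i j k → Z i j k) {i j k : ℕ} (h : Gen S i j k) : Z i j k := by
  induction h with
  | base h => exact hSZ _ _ _ h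
  | left h1 h2 h3 g1 g2 ih1 ih2 =>
    exact (hZ (g1.mem hX hS).1 (g1.mem hX hS).2.1 (g2.mem hX hS).2.1 (g2.mem hX hS).2.2.1
      h1 h2 h3).2.1 ih1 ih2
  | right h1 h2 h3 g1 g2 ih1 ih2 =>
    exact (hZ (g1.mem hX hS).1 (g1.mem hX hS).2.1 (g2.mem hX hS).2.1 (g2.mem hX hS).2.2.1
      h1 h2 h3).2.2.1 ih1 ih2

theorem Gen.of_addable (hX : Cons V X) (hS : ∀ i j k, S i j k → Addable V X i j k) {i j k : ℕ}
    (h : Gen S i j k) (hf : Addable V X i j k) : S i j k := by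
  cases h with
  | base h => exact h
  | @left a b c d h1 h2 h3 g1 g2 =>
    have m3 := (Gen.right h1 h2 h3 g1 g2).mem hX hS
    have m1 := g1.mem hX hS
    have u := hf.2.2.2.2.2.2 c m3.2.1 (by omega) (by omega) (by omega)
    simp (disch := omega) only [Uncut, bel_iff₁, bel_iff₂, bel_iff₃] at u
    grind
  | @right a b c d h1 h2 h3 g1 g2 =>
    have m3 := (Gen.left h1 h2 h3 g1 g2).mem hX hS
    have m2 := g2.mem hX hS
    have u := hf.2.2.2.2.2.2 b m2.1 (by omega) (by omega) (by omega)
    simp (disch := omega) only [Uncut, bel_iff₁, bel_iff₂, bel_iff₃] at u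
    grind

theorem cons_union_gen (hX : Cons V X) (hS : ∀ i j k, S i j k → Addable V X i j k)
    (hN : AllNeat V X (Gen S)) : Cons V (fun i j k => X i j k ∨ Gen S i j k) := by
  intro a b c d ha hb hc hd hab hbc hcd
  have q := hX ha hb hc hd hab hbc hcd
  have n1 := fun g : Gen S a b c => And.intro (g.mem hX hS).2.2.2.2.2
    (hN g hd (by omega) (by omega) (by omega))
  have n2 := fun g : Gen S a b d => And.intro (g.mem hX hS).2.2.2.2.2
    (hN g hc (by omega) (by omega) (by omega))
  have n3 := fun g : Gen S a c d => And.intro (g.mem hX hS).2.2.2.2.2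
    (hN g hb (by omega) (by omega) (by omega))
  have n4 := fun g : Gen S b c d => And.intro (g.mem hX hS).2.2.2.2.2
    (hN g ha (by omega) (by omega) (by omega))
  have g1 := Gen.left (S := S) hab hbc hcd
  have g2 := Gen.right (S := S) hab hbc hcd
  simp (disch := omega) only [Neat, Uncut, bel_iff₁, bel_iff₂, bel_iff₃] at n1 n2 n3 n4
  clear hX hN hS
  unfold Full at *
  unfold Good4 at q ⊢
  grind (splits := 60)

/-- Below-transitivity: on a triangle outside `X`, a line below two consecutive vertices is below
the third. -/
theorem Below.trans (hX : Cons V X) {i j k h : ℕ} (hi : i ∈ V) (hj : j ∈ V) (hk : k ∈ V)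
    (hh : h ∈ V) (hij : i < j) (hjk : j < k) (hn : ¬ X i j k) (h1 : h ≠ i) (h2 : h ≠ j)
    (h3 : h ≠ k) (b1 : Below X h i j) (b2 : Below X h j k) : Below X h i k := by
  rw [← bel_iff_below (by omega) (by omega)] at *
  rcases lt_or_gt_of_ne h1 with o1 | o1
  · have q := hX hh hi hj hk o1 hij hjk
    simp (disch := omega) only [bel_iff₁, bel_iff₂, bel_iff₃] at *
    unfold Good4 at q; grind
  rcases lt_or_gt_of_ne h2 with o2 | o2
  · have q := hX hi hh hj hk o1 o2 hjk
    simp (disch := omega) only [bel_iff₁, bel_iff₂, bel_iff₃] at *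
    unfold Good4 at q; grind
  rcases lt_or_gt_of_ne h3 with o3 | o3
  · have q := hX hi hj hh hk hij o2 o3
    simp (disch := omega) only [bel_iff₁, bel_iff₂, bel_iff₃] at *
    unfold Good4 at q; grind
  · have q := hX hi hj hk hh hij hjk o3
    simp (disch := omega) only [bel_iff₁, bel_iff₂, bel_iff₃] at *
    unfold Good4 at q; grind

theorem Neat.below_iff {C : ℕ → ℕ → ℕ → Prop} {h i j k : ℕ} (hij : i < j) (hjk : j < k)
    (h1 : h ≠ i) (h2 : h ≠ j) (hN : Neat X C h i j k) :
    Below X h i k ↔ Below X h i j ∨ Below X h j k := by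
  rcases hN with hN | ⟨o1, o2, hN, -⟩ | ⟨o1, o2, hN, -⟩
  · rw [uncut_iff_below hij hjk h1 h2] at hN; tauto
  · rw [← bel_iff_below h1 hij, ← bel_iff_below h1 (hij.trans hjk), ← bel_iff_below h2 hjk]
    simp (disch := omega) only [bel_iff₁, bel_iff₂, bel_iff₃]
    tauto
  · rw [← bel_iff_below h1 hij, ← bel_iff_below h1 (hij.trans hjk), ← bel_iff_below h2 hjk]
    simp (disch := omega) only [bel_iff₁, bel_iff₂, bel_iff₃]
    tauto

variable {T : ℕ → ℕ → ℕ → Prop}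

/-- `h` is below the three vertices of the triangle `i, j, k`. -/
def LowAt (X : ℕ → ℕ → ℕ → Prop) (h i j k : ℕ) : Prop :=
  h ≠ i ∧ h ≠ j ∧ h ≠ k ∧ Below X h i j ∧ Below X h i k ∧ Below X h j k

theorem LowAt.step_left (hX : Cons V X) (hS : ∀ i j k, S i j k → Addable V X i j k) {D : ℕ}
    (hN : NeatBelow V X (Gen S) D) {a b c d h : ℕ} (hab : a < b) (hbc : b < c) (hcd : c < d)
    (g1 : Gen S a b c) (g2 : Gen S b c d) (hD : d ≤ a + D) (hh : h ∈ V) (hl : LowAt X h a b c) :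
    LowAt X h a b d ∧ LowAt X h a c d := by
  obtain ⟨h1, h2, h3, l1, l2, l3⟩ := hl
  obtain ⟨ha, hb, hc, -, -, n1⟩ := g1.mem hX hS
  obtain ⟨-, -, hd, -, -, n2⟩ := g2.mem hX hS
  obtain ⟨-, -, -, -, -, n3⟩ := (Gen.left hab hbc hcd g1 g2).mem hX hS
  have h4 : h ≠ d := by
    rintro rfl
    rw [← bel_iff_below h1 hab, bel_iff₃ hab (by omega)] at l1
    exact n3 l1
  have hu : Uncut X h b c d := by
    rcases hN g2 (by omega) hh h2 h3 h4 with hu | ⟨o1, o2, f⟩ | ⟨o1, o2, f⟩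
    · exact hu
    · have := hN f.2.1 (by omega) ha (by omega) (by omega) (by omega)
      rw [← bel_iff_below h1 hab] at l1
      simp (disch := omega) only [Neat, Uncut, bel_iff₁, bel_iff₂, bel_iff₃] at this l1
      grind
    · rw [← bel_iff_below h2 hbc, bel_iff₃ hbc (by omega)] at l3
      exact absurd l3 f.1.1
  rw [uncut_iff_below hbc hcd h2 h3] at hu
  have l4 := hu.1.1 l3
  have l5 := hu.2.2 l4
  have l6 := Below.trans hX ha hb hd hh hab (hbc.trans hcd) n3 h1 h2 h4 l1 l4
  exact ⟨⟨h1, h2, h4, l1, l6, l4⟩, ⟨h1, h3, h4, l2, l6, l5⟩⟩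

theorem LowAt.step_right (hX : Cons V X) (hS : ∀ i j k, S i j k → Addable V X i j k) {D : ℕ}
    (hN : NeatBelow V X (Gen S) D) {a b c d h : ℕ} (hab : a < b) (hbc : b < c) (hcd : c < d)
    (g1 : Gen S a b c) (g2 : Gen S b c d) (hD : d ≤ a + D) (hh : h ∈ V) (hl : LowAt X h b c d) :
    LowAt X h a b d ∧ LowAt X h a c d := by
  obtain ⟨h2, h3, h4, l1, l2, l3⟩ := hl
  obtain ⟨ha, hb, hc, -, -, n1⟩ := g1.mem hX hS
  obtain ⟨-, -, hd, -, -, n2⟩ := g2.mem hX hS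
  obtain ⟨-, -, -, -, -, n3⟩ := (Gen.right hab hbc hcd g1 g2).mem hX hS
  have h1 : h ≠ a := by
    rintro rfl
    rw [← bel_iff_below h3 hcd] at l3
    exact n3 ((bel_iff₁ (by omega) hcd).1 l3)
  have hu : Uncut X h a b c := by
    rcases hN g1 (by omega) hh h1 h2 h3 with hu | ⟨o1, o2, f⟩ | ⟨o1, o2, f⟩
    · exact hu
    · rw [← bel_iff_below h2 hbc, bel_iff₁ (by omega) hbc] at l1
      exact absurd l1 f.1.2.2.2
    · have := hN f.2.2.2.2 (by omega) hd (by omega) (by omega) (by omega)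
      rw [← bel_iff_below h3 hcd] at l3
      simp (disch := omega) only [Neat, Uncut, bel_iff₁, bel_iff₂, bel_iff₃] at this l3
      grind
  rw [uncut_iff_below hab hbc h1 h2] at hu
  have l4 := hu.2.1 l1
  have l5 := hu.1.2 l4
  have l6 := Below.trans hX ha hc hd hh (hab.trans hbc) hcd n3 h1 h3 h4 l4 l3
  exact ⟨⟨h1, h2, h4, l5, l6, l2⟩, ⟨h1, h3, h4, l4, l6, l3⟩⟩

theorem Gen.low (hX : Cons V X) (hT : ∀ i j k, T i j k → Addable V X i j k) {D : ℕ}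
    (hN : NeatBelow V X (Gen T) D) {B : ℕ → Prop} (hB : ∀ h, B h → h ∈ V)
    (hST : ∀ i j k, T i j k → S i j k ∨ ∀ h, B h → LowAt X h i j k) {i j k : ℕ}
    (g : Gen T i j k) (hD : k ≤ i + D) : Gen S i j k ∨ ∀ h, B h → LowAt X h i j k := by
  induction g with
  | base h => exact (hST _ _ _ h).imp_left .base
  | left h1 h2 h3 g1 g2 ih1 ih2 =>
    rcases ih1 (by omega) with s1 | l1
    · rcases ih2 (by omega) with s2 | l2
      · exact .inl (.left h1 h2 h3 s1 s2)
      · exact .inr fun h hh =>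
          (LowAt.step_right hX hT hN h1 h2 h3 g1 g2 hD (hB h hh) (l2 h hh)).1
    · exact .inr fun h hh => (LowAt.step_left hX hT hN h1 h2 h3 g1 g2 hD (hB h hh) (l1 h hh)).1
  | right h1 h2 h3 g1 g2 ih1 ih2 =>
    rcases ih1 (by omega) with s1 | l1
    · rcases ih2 (by omega) with s2 | l2
      · exact .inl (.right h1 h2 h3 s1 s2)
      · exact .inr fun h hh =>
          (LowAt.step_right hX hT hN h1 h2 h3 g1 g2 hD (hB h hh) (l2 h hh)).2
    · exact .inr fun h hh => (LowAt.step_left hX hT hN h1 h2 h3 g1 g2 hD (hB h hh) (l1 h hh)).2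

/-- Two generating triples and a line: either the line is a tip, or it is neat with respect to
both generated triples. -/
theorem Neat.step (hX : Cons V X) (hS : ∀ i j k, S i j k → Addable V X i j k) {D : ℕ}
    (hN : NeatBelow V X (Gen S) D) {a b c d h : ℕ} (hab : a < b) (hbc : b < c) (hcd : c < d)
    (g1 : Gen S a b c) (g2 : Gen S b c d) (hD : d ≤ a + D) (hh : h ∈ V) (h1 : h ≠ a) (h2 : h ≠ b)
    (h3 : h ≠ c) (h4 : h ≠ d) :
    Tip V X a b d h ∨ (Uncut X h a b d ∧ Uncut X h a c d) ∨
      (a < h ∧ h < b ∧ Full X (Gen S) a h b d ∧ Full X (Gen S) a h c d ∧ Gen S h b c) ∨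
      (b < h ∧ h < c ∧ Full X (Gen S) a b h d ∧ Full X (Gen S) a h c d ∧ Gen S b h c) ∨
      (c < h ∧ h < d ∧ Full X (Gen S) a b h d ∧ Full X (Gen S) a c h d ∧ Gen S b c h) := by
  obtain ⟨ha, hb, hc, -, -, n1⟩ := g1.mem hX hS
  obtain ⟨-, -, hd, -, -, n2⟩ := g2.mem hX hS
  have g3 := Gen.left hab hbc hcd g1 g2
  have g4 := Gen.right hab hbc hcd g1 g2
  obtain ⟨-, -, -, -, -, n3⟩ := g3.mem hX hS
  obtain ⟨-, -, -, -, -, n4⟩ := g4.mem hX hS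
  have full : ∀ {x y z w}, x < y → y < z → z < w → Gen S x y z → Gen S y z w →
      Full X (Gen S) x y z w := fun o1 o2 o3 e1 e2 =>
    ⟨⟨(e1.mem hX hS).2.2.2.2.2, ((Gen.left o1 o2 o3 e1 e2).mem hX hS).2.2.2.2.2,
      ((Gen.right o1 o2 o3 e1 e2).mem hX hS).2.2.2.2.2, (e2.mem hX hS).2.2.2.2.2⟩,
      e1, .left o1 o2 o3 e1 e2, .right o1 o2 o3 e1 e2, e2⟩
  have N1 := hN g1 (by omega) hh h1 h2 h3
  have N2 := hN g2 (by omega) hh h2 h3 h4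
  rcases N1 with u1 | ⟨o1, o2, f1⟩ | ⟨o1, o2, f1⟩
  · rcases N2 with u2 | ⟨o1, o2, f2⟩ | ⟨o1, o2, f2⟩
    · rw [uncut_iff_below hab hbc h1 h2] at u1
      rw [uncut_iff_below hbc hcd h2 h3] at u2
      rw [uncut_iff_below hab (hbc.trans hcd) h1 h2, uncut_iff_below (hab.trans hbc) hcd h1 h3]
      have := Below.trans hX ha hb hd hh hab (hbc.trans hcd) n3 h1 h2 h4
      unfold Tip
      grind
    · have := hN f2.2.1 (by omega) ha (by omega) (by omega) (by omega)
      have r1 := f2.1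
      simp (disch := omega) only [Neat, Uncut, bel_iff₁, bel_iff₂, bel_iff₃] at this u1
      grind
    · have f := full (by omega) (by omega) o1 g1 f2.2.1
      exact .inr (.inr (.inr (.inr ⟨o1, o2, full hab (by omega) o2 f.2.2.1 f2.2.2.2.1,
        full (by omega) o1 o2 f.2.2.2.1 f2.2.2.2.2, f2.2.1⟩)))
  · have f := full o2 hbc hcd f1.2.2.2.2 g2
    exact .inr (.inr (.inl ⟨o1, o2, full o1 o2 (by omega) f1.2.1 f.2.2.1,
      full o1 (by omega) hcd f1.2.2.1 f.2.2.2.1, f1.2.2.2.2⟩))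
  · rcases N2 with u2 | ⟨-, -, f2⟩ | ⟨o3, -, f2⟩
    · have := hN f1.2.2.2.2 (by omega) hd (by omega) (by omega) (by omega)
      have r1 := f1.1
      simp (disch := omega) only [Neat, Uncut, bel_iff₁, bel_iff₂, bel_iff₃] at this u2
      grind
    · exact .inr (.inr (.inr (.inl ⟨o1, o2, full hab o1 (by omega) f1.2.1 f2.2.2.1,
        full (by omega) o2 hcd f1.2.2.2.1 f2.2.2.2.2, f1.2.2.2.2⟩)))
    · omega

theorem exists_tip_of_not_allNeat (hX : Cons V X) (hS : ∀ i j k, S i j k → Addable V X i j k)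
    (h : ¬ AllNeat V X (Gen S)) : ∃ D a b c d e, NeatBelow V X (Gen S) D ∧ a < b ∧ b < c ∧ c < d ∧
      Gen S a b c ∧ Gen S b c d ∧ d ≤ a + D ∧ Tip V X a b d e := by
  classical
  have hex : ∃ D i j k h, Gen S i j k ∧ h ∈ V ∧ h ≠ i ∧ h ≠ j ∧ h ≠ k ∧
      ¬ Neat X (Gen S) h i j k ∧ k = i + D := by
    unfold AllNeat at h
    push Not at h
    obtain ⟨i, j, k, h, g, hh, h1, h2, h3, hn⟩ := h
    have := g.mem hX hS
    exact ⟨k - i, i, j, k, h, g, hh, h1, h2, h3, hn, by omega⟩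
  have hN : NeatBelow V X (Gen S) (Nat.find hex) := by
    intro i j k h g hk hh h1 h2 h3
    by_contra hn
    have := g.mem hX hS
    exact Nat.find_min hex (m := k - i) (by omega) ⟨i, j, k, h, g, hh, h1, h2, h3, hn, by omega⟩
  obtain ⟨i, j, k, h, g, hh, h1, h2, h3, hn, hk⟩ := Nat.find_spec hex
  refine ⟨Nat.find hex, ?_⟩
  generalize Nat.find hex = D at *
  have key : ∀ {a b c d}, a < b → b < c → c < d → Gen S a b c → Gen S b c d → d = a + D →
      h ≠ a → h ≠ b → h ≠ c → h ≠ d → ¬ (Neat X (Gen S) h a b d ∧ Neat X (Gen S) h a c d) →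
      ∃ a b c d e, NeatBelow V X (Gen S) D ∧ a < b ∧ b < c ∧ c < d ∧
      Gen S a b c ∧ Gen S b c d ∧ d ≤ a + D ∧ Tip V X a b d e := by
    intro a b c d hab hbc hcd g1 g2 hD e1 e2 e3 e4 hno
    rcases Neat.step hX hS hN hab hbc hcd g1 g2 hD.le hh e1 e2 e3 e4 with
      ht | hu | ⟨o1, o2, f1, f2, -⟩ | ⟨o1, o2, f1, f2, -⟩ | ⟨o1, o2, f1, f2, -⟩
    · exact ⟨a, b, c, d, h, hN, hab, hbc, hcd, g1, g2, hD.le, ht⟩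
    · exact absurd ⟨.inl hu.1, .inl hu.2⟩ hno
    · exact absurd ⟨.inr (.inl ⟨o1, o2, f1⟩), .inr (.inl ⟨o1, o2.trans hbc, f2⟩)⟩ hno
    · exact absurd ⟨.inr (.inr ⟨o1, o2.trans hcd, f1⟩), .inr (.inl ⟨hab.trans o1, o2, f2⟩)⟩ hno
    · exact absurd ⟨.inr (.inr ⟨hbc.trans o1, o2, f1⟩), .inr (.inr ⟨o1, o2, f2⟩)⟩ hno
  have full : ∀ {x y z w}, x < y → y < z → z < w → Gen S x y z → Gen S y z w →
      Full X (Gen S) x y z w := fun o1 o2 o3 e1 e2 =>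
    ⟨⟨(e1.mem hX hS).2.2.2.2.2, ((Gen.left o1 o2 o3 e1 e2).mem hX hS).2.2.2.2.2,
      ((Gen.right o1 o2 o3 e1 e2).mem hX hS).2.2.2.2.2, (e2.mem hX hS).2.2.2.2.2⟩,
      e1, .left o1 o2 o3 e1 e2, .right o1 o2 o3 e1 e2, e2⟩
  cases g with
  | base g => exact absurd (.inl ((hS _ _ _ g).2.2.2.2.2.2 h hh h1 h2 h3)) hn
  | @left a b c d hab hbc hcd g1 g2 =>
    by_cases hc : h = c
    · subst hc
      exact absurd (.inr (.inr ⟨hbc, hcd, full hab hbc hcd g1 g2⟩)) hn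
    · exact key hab hbc hcd g1 g2 hk h1 h2 hc h3 fun h => hn h.1
  | @right a b c d hab hbc hcd g1 g2 =>
    by_cases hb : h = b
    · subst hb
      exact absurd (.inr (.inl ⟨hab, hbc, full hab hbc hcd g1 g2⟩)) hn
    · exact key hab hbc hcd g1 g2 hk h1 hb h2 h3 fun h => hn h.2

theorem uncut_or_of_not_tip (hX : Cons V X) (hS : ∀ i j k, S i j k → Addable V X i j k) {D : ℕ}
    (hN : NeatBelow V X (Gen S) D) {a b c d : ℕ} (hab : a < b) (hbc : b < c) (hcd : c < d)
    (g1 : Gen S a b c) (g2 : Gen S b c d) (hD : d ≤ a + D) :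
    ∀ h ∈ V, h ≠ a → h ≠ b → h ≠ d → ¬ Tip V X a b d h → Uncut X h a b d ∨
      (a < h ∧ h < d ∧ ¬ X a h d ∧ ∀ e, Tip V X a b d e → ¬ Below X e a h ∧ ¬ Below X e h d) := by
  intro h hh h1 h2 h4 hT
  obtain ⟨ha, hb, hc, -, -, n1⟩ := g1.mem hX hS
  obtain ⟨-, -, hd, -, -, n2⟩ := g2.mem hX hS
  have n4 := ((Gen.right hab hbc hcd g1 g2).mem hX hS).2.2.2.2.2
  have tip : ∀ e, Tip V X a b d e → e ∈ V ∧ e ≠ a ∧ e ≠ b ∧ e ≠ c ∧ e ≠ d ∧ e ≠ h ∧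
      ¬ Below X e a b ∧ ¬ Below X e b d := by
    rintro e ⟨he, e1, e2, e3, e4, e5, e6⟩
    refine ⟨he, e1, e2, ?_, e3, ?_, e4, e5⟩
    · rintro rfl
      rw [← bel_iff_below e2 (by omega), bel_iff₂ hbc hcd] at e5
      exact e5 n2
    · rintro rfl
      exact hT ⟨he, e1, e2, e3, e4, e5, e6⟩
  have nb : ∀ {e i j k}, Gen S i j k → k < i + D → e ∈ V → e ≠ i → e ≠ j → e ≠ k →
      (Below X e i k ↔ Below X e i j ∨ Below X e j k) := fun g o he e1 e2 e3 =>
    Neat.below_iff (g.mem hX hS).2.2.2.1 (g.mem hX hS).2.2.2.2.1 e1 e2 (hN g o he e1 e2 e3)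
  by_cases h3 : h = c
  · subst h3
    refine .inr ⟨by omega, hcd, n4, fun e he => ?_⟩
    obtain ⟨he, e1, e2, e3, e4, -, e5, e6⟩ := tip e he
    have t1 := nb g1 (by omega) he e1 e2 e3
    have t2 := nb g2 (by omega) he e2 e3 e4
    grind
  rcases Neat.step hX hS hN hab hbc hcd g1 g2 hD hh h1 h2 h3 h4 with
    ht | hu | ⟨o1, o2, f1, f2, f3⟩ | ⟨o1, o2, f1, f2, f3⟩ | ⟨o1, o2, f1, f2, f3⟩
  · exact absurd ht hT
  · exact .inl hu.1
  · refine .inr ⟨o1, by omega, f1.1.2.1, fun e he => ?_⟩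
    obtain ⟨he, e1, e2, e3, e4, e7, e5, e6⟩ := tip e he
    have t1 := nb f1.2.1 (by omega) he e1 e7 e2
    have t2 := nb f1.2.2.2.2 (by omega) he e7 e2 e4
    grind
  · refine .inr ⟨by omega, by omega, f1.1.2.2.1, fun e he => ?_⟩
    obtain ⟨he, e1, e2, e3, e4, e7, e5, e6⟩ := tip e he
    have t1 := nb f1.2.1 (by omega) he e1 e2 e7
    have t2 := nb f3 (by omega) he e2 e7 e3
    have t3 := nb f2.2.2.2.2 (by omega) he e7 e3 e4
    have t4 := nb g2 (by omega) he e2 e3 e4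
    grind
  · refine .inr ⟨by omega, by omega, f1.1.2.2.1, fun e he => ?_⟩
    obtain ⟨he, e1, e2, e3, e4, e7, e5, e6⟩ := tip e he
    have t1 := nb f1.2.1 (by omega) he e1 e2 e7
    have t2 := nb f1.2.2.2.2 (by omega) he e2 e7 e4
    grind

open Classical in
/-- The lines below the three vertices of an addable triple. -/
noncomputable def lowSet (V : Finset ℕ) (X : ℕ → ℕ → ℕ → Prop) (i j k : ℕ) : Finset ℕ :=
  V.filter fun h => h ≠ i ∧ h ≠ j ∧ h ≠ k ∧ Below X h i j

theorem mem_lowSet {h i j k : ℕ} :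
    h ∈ lowSet V X i j k ↔ h ∈ V ∧ h ≠ i ∧ h ≠ j ∧ h ≠ k ∧ Below X h i j := by
  simp [lowSet]

theorem AllNeat.gen_ins (hX : Cons V X) (hZ : Cons V Z) (hXZ : Sub V X Z)
    (hS : ∀ i j k, S i j k → Addable V X i j k ∧ Z i j k) {p q r : ℕ} (hf : Addable V X p q r)
    (hfZ : Z p q r) (hmax : ∀ i j k, Addable V X i j k → Z i j k →
      (lowSet V X i j k).card ≤ (lowSet V X p q r).card) (hN : AllNeat V X (Gen S)) :
    AllNeat V X (Gen (ins S p q r)) := by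
  by_contra hno
  have hT : ∀ i j k, ins S p q r i j k → Addable V X i j k := by
    rintro i j k (h | ⟨rfl, rfl, rfl⟩)
    exacts [(hS _ _ _ h).1, hf]
  have hTZ : ∀ i j k, ins S p q r i j k → Z i j k := by
    rintro i j k (h | ⟨rfl, rfl, rfl⟩)
    exacts [(hS _ _ _ h).2, hfZ]
  obtain ⟨D, a, b, c, d, e, hND, hab, hbc, hcd, g1, g2, hD, he⟩ :=
    exists_tip_of_not_allNeat hX hT hno
  have g3 := Gen.left hab hbc hcd g1 g2
  obtain ⟨ha, hb, hd, -, hbd, n3⟩ := g3.mem hX hT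
  obtain ⟨i, j, k, hA, hAZ, hlow⟩ := exists_addable_of_tip hX hZ hXZ ha hb hd hab hbd n3
    (g3.subset hX hT hZ hTZ) ⟨e, he⟩ (uncut_or_of_not_tip hX hT hND hab hbc hcd g1 g2 hD)
  have hlowAt := (Gen.low hX hT hND (S := S) (B := (· ∈ lowSet V X p q r))
    (fun h hh => (mem_lowSet.1 hh).1) (by
      rintro i j k (h | ⟨rfl, rfl, rfl⟩)
      · exact .inl h
      · refine .inr fun h hh => ?_
        obtain ⟨hV, h1, h2, h3, h4⟩ := mem_lowSet.1 hh
        have hu := hf.2.2.2.2.2.2 h hV h1 h2 h3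
        rw [uncut_iff_below hf.2.2.2.1 hf.2.2.2.2.1 h1 h2] at hu
        exact ⟨h1, h2, h3, h4, hu.1.1 h4, hu.2.2 (hu.1.1 h4)⟩) g3 hD).resolve_left fun g => by
      obtain ⟨he, e1, e2, e3, e4, e5, e6⟩ := he
      have := Neat.below_iff hab hbd e1 e2 (hN g he e1 e2 e3)
      tauto
  have hsub : lowSet V X p q r ⊂ lowSet V X i j k := by
    refine (Finset.ssubset_iff_of_subset fun h hh => ?_).2 ⟨b, ?_, fun hb => (hlowAt b hb).2.1 rfl⟩
    · obtain ⟨h1, h2, h3, h4, h5, h6⟩ := hlowAt h hh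
      have hV := (mem_lowSet.1 hh).1
      exact mem_lowSet.2 ⟨hV, hlow h hV (fun ht => ht.2.2.2.2.1 h4) h1 h3 h5⟩
    · refine mem_lowSet.2 ⟨hb, hlow b hb (fun ht => ht.2.2.1 rfl) hab.ne' hbd.ne ?_⟩
      rw [← bel_iff_below hab.ne' (hab.trans hbd), bel_iff₂ hab hbd]
      exact n3
  exact absurd (hmax i j k hA hAZ) (not_le.2 (Finset.card_lt_card hsub))

theorem Addable.of_cons_ins (hX : Cons V X) {i j k : ℕ}
    (hi : i ∈ V) (hj : j ∈ V) (hk : k ∈ V) (hij : i < j) (hjk : j < k) (hn : ¬ X i j k)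
    (hc : Cons V (ins X i j k)) : Addable V X i j k := by
  refine ⟨hi, hj, hk, hij, hjk, hn, fun h hh h1 h2 h3 => ?_⟩
  rcases lt_or_gt_of_ne h1 with o1 | o1
  · have q := hX hh hi hj hk o1 hij hjk
    have q' := hc hh hi hj hk o1 hij hjk
    simp (disch := omega) only [Uncut, bel_iff₁, bel_iff₂, bel_iff₃]
    unfold Good4 HB.ins at *
    grind (splits := 30)
  rcases lt_or_gt_of_ne h2 with o2 | o2
  · have q := hX hi hh hj hk o1 o2 hjk
    have q' := hc hi hh hj hk o1 o2 hjk
    simp (disch := omega) only [Uncut, bel_iff₁, bel_iff₂, bel_iff₃]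
    unfold Good4 HB.ins at *
    grind (splits := 30)
  rcases lt_or_gt_of_ne h3 with o3 | o3
  · have q := hX hi hj hh hk hij o2 o3
    have q' := hc hi hj hh hk hij o2 o3
    simp (disch := omega) only [Uncut, bel_iff₁, bel_iff₂, bel_iff₃]
    unfold Good4 HB.ins at *
    grind (splits := 30)
  · have q := hX hi hj hk hh hij hjk o3
    have q' := hc hi hj hk hh hij hjk o3
    simp (disch := omega) only [Uncut, bel_iff₁, bel_iff₂, bel_iff₃]
    unfold Good4 HB.ins at *
    grind (splits := 30)

end Triples

theorem triple_inj {a b c p q r : ℕ} (hab : a < b) (hbc : b < c) (hpq : p < q) (hqr : q < r)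
    (h : ({a, b, c} : Finset ℕ) = {p, q, r}) : a = p ∧ b = q ∧ c = r := by
  simp only [Finset.ext_iff, Finset.mem_insert, Finset.mem_singleton] at h
  have h1 := h a
  have h2 := h b
  have h3 := h c
  have h4 := h p
  have h5 := h q
  have h6 := h r
  omega

theorem triple_mem_binom {n a b c : ℕ} (ha : a ∈ box n) (hb : b ∈ box n) (hc : c ∈ box n)
    (hab : a < b) (hbc : b < c) : ({a, b, c} : Finset ℕ) ∈ binom n 3 := by
  refine Finset.mem_powersetCard.2 ⟨?_, Finset.card_eq_three.2
    ⟨a, b, c, hab.ne, (hab.trans hbc).ne, hbc.ne, rfl⟩⟩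
  simp [Finset.insert_subset_iff, ha, hb, hc]

theorem exists_triple {n : ℕ} {t : Finset ℕ} (ht : t ∈ binom n 3) : ∃ a b c, a ∈ box n ∧
    b ∈ box n ∧ c ∈ box n ∧ a < b ∧ b < c ∧ t = {a, b, c} := by
  obtain ⟨hs, hc⟩ := Finset.mem_powersetCard.1 ht
  obtain ⟨x, y, z, hxy, hxz, hyz, rfl⟩ := Finset.card_eq_three.1 hc
  have hx : x ∈ box n := hs (by simp)
  have hy : y ∈ box n := hs (by simp)
  have hz : z ∈ box n := hs (by simp)
  rcases lt_or_gt_of_ne hxy with o1 | o1 <;> rcases lt_or_gt_of_ne hyz with o2 | o2 <;>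
    rcases lt_or_gt_of_ne hxz with o3 | o3
  · exact ⟨x, y, z, hx, hy, hz, o1, o2, rfl⟩
  · omega
  · exact ⟨x, z, y, hx, hz, hy, o3, o2, by ext; simp; tauto⟩
  · exact ⟨z, x, y, hz, hx, hy, o3, o1, by ext; simp; tauto⟩
  · exact ⟨y, x, z, hy, hx, hz, o1, o3, by ext; simp; tauto⟩
  · exact ⟨y, z, x, hy, hz, hx, o2, o3, by ext; simp; tauto⟩
  · omega
  · exact ⟨z, y, x, hz, hy, hx, o2, o1, by ext; simp; tauto⟩

/-- The increasing triples of a set system. -/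
def rel (X : Finset (Finset ℕ)) (a b c : ℕ) : Prop := a < b ∧ b < c ∧ {a, b, c} ∈ X

theorem isClosedSet_iff {n : ℕ} {X : Finset (Finset ℕ)} : IsClosedSet n 2 X ↔
    ∀ ⦃a b c d⦄, a ∈ box n → b ∈ box n → c ∈ box n → d ∈ box n → a < b → b < c → c < d →
      (rel X a b c → rel X a c d → rel X a b d) ∧ (rel X a b c → rel X b c d → rel X a b d) ∧
      (rel X a b c → rel X b c d → rel X a c d) ∧ (rel X a b d → rel X b c d → rel X a c d) := by
  have e1 : ∀ x i j : ℕ, ({x} ∪ {i, j} : Finset ℕ) = {x, i, j} := fun x i j => rfl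
  have e2 : ∀ x i j : ℕ, ({x} ∪ {i, j} : Finset ℕ) = {i, x, j} := fun x i j => by
    ext; grind
  have e3 : ∀ x i j : ℕ, ({x} ∪ {i, j} : Finset ℕ) = {i, j, x} := fun x i j => by
    ext; grind
  constructor
  · intro h a b c d ha hb hc hd hab hbc hcd
    have hs : ∀ x ∈ _root_.box n, ({x} : Finset ℕ) ∈ binom n (2 - 1) := fun x hx => by
      simp [binom, Finset.mem_powersetCard, hx]
    have q1 := h {a} (hs a ha) b hb c hc d hd (by simp; omega) (by simp; omega) (by simp; omega)
      hbc hcd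
    have q2 := h {b} (hs b hb) a ha c hc d hd (by simp; omega) (by simp; omega) (by simp; omega)
      (by omega) hcd
    have q3 := h {c} (hs c hc) a ha b hb d hd (by simp; omega) (by simp; omega) (by simp; omega)
      hab (by omega)
    have q4 := h {d} (hs d hd) a ha b hb c hc (by simp; omega) (by simp; omega) (by simp; omega)
      hab hbc
    rw [e1, e1, e1] at q1
    rw [e2 b a c, e1 b c d, e2 b a d] at q2
    rw [e3 c a b, e2 c b d, e2 c a d] at q3
    rw [e3, e3, e3] at q4
    exact ⟨fun h1 h2 => ⟨hab, by omega, q1 h1.2.2 h2.2.2⟩,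
      fun h1 h2 => ⟨hab, by omega, q2 h1.2.2 h2.2.2⟩,
      fun h1 h2 => ⟨by omega, hcd, q3 h1.2.2 h2.2.2⟩,
      fun h1 h2 => ⟨by omega, hcd, q4 h1.2.2 h2.2.2⟩⟩
  · intro h I hI i hi j hj k hk hiI hjI hkI hij hjk h1 h2
    obtain ⟨hs, hc⟩ := Finset.mem_powersetCard.1 hI
    obtain ⟨x, rfl⟩ := Finset.card_eq_one.1 hc
    have hx : x ∈ _root_.box n := hs (by simp)
    simp only [Finset.mem_singleton] at hiI hjI hkI
    rcases lt_or_gt_of_ne hiI with o1 | o1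
    swap
    · rw [e1] at h1 h2 ⊢
      exact ((h hx hi hj hk o1 hij hjk).1 ⟨o1, hij, h1⟩ ⟨by omega, hjk, h2⟩).2.2
    rcases lt_or_gt_of_ne hjI with o2 | o2
    swap
    · rw [e2] at h1 ⊢
      rw [e1] at h2
      exact ((h hi hx hj hk o1 o2 hjk).2.1 ⟨o1, o2, h1⟩ ⟨o2, hjk, h2⟩).2.2
    rcases lt_or_gt_of_ne hkI with o3 | o3
    swap
    · rw [e3] at h1
      rw [e2] at h2 ⊢
      exact ((h hi hj hx hk hij o2 o3).2.2.1 ⟨hij, o2, h1⟩ ⟨o2, o3, h2⟩).2.2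
    · rw [e3] at h1 h2 ⊢
      exact ((h hi hj hk hx hij hjk o3).2.2.2 ⟨hij, o2, h1⟩ ⟨hjk, o3, h2⟩).2.2

theorem consistent_iff {n : ℕ} {X : Finset (Finset ℕ)} (hX : X ⊆ binom n 3) :
    Consistent n 2 X ↔ Cons (box n) (rel X) := by
  unfold Consistent
  rw [isClosedSet_iff, isClosedSet_iff]
  have hr : ∀ {a b c}, a ∈ box n → b ∈ box n → c ∈ box n → a < b → b < c →
      (rel (binom n (2 + 1) \ X) a b c ↔ ¬ rel X a b c) := fun ha hb hc hab hbc => by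
    have := triple_mem_binom ha hb hc hab hbc
    simp [rel, hab, hbc, this]
  constructor
  · rintro ⟨-, h1, h2⟩ a b c d ha hb hc hd hab hbc hcd
    have q1 := h1 ha hb hc hd hab hbc hcd
    have q2 := h2 ha hb hc hd hab hbc hcd
    rw [hr ha hb hc hab hbc, hr ha hb hd hab (hbc.trans hcd), hr ha hc hd (hab.trans hbc) hcd,
      hr hb hc hd hbc hcd] at q2
    unfold Good4
    grind (splits := 30)
  · intro h
    refine ⟨hX, fun a b c d ha hb hc hd hab hbc hcd => ?_,
      fun a b c d ha hb hc hd hab hbc hcd => ?_⟩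
    · have q := h ha hb hc hd hab hbc hcd
      exact ⟨q.1, q.2.1, q.2.2.1, q.2.2.2.1⟩
    · have q := h ha hb hc hd hab hbc hcd
      rw [hr ha hb hc hab hbc, hr ha hb hd hab (hbc.trans hcd), hr ha hc hd (hab.trans hbc) hcd,
        hr hb hc hd hbc hcd]
      unfold Good4 at q
      grind (splits := 30)

theorem rel_insert {X : Finset (Finset ℕ)} {i j k : ℕ} (hij : i < j) (hjk : j < k) :
    rel (insert {i, j, k} X) = HB.ins (rel X) i j k := by
  ext a b c
  simp only [rel, HB.ins, Finset.mem_insert]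
  constructor
  · rintro ⟨h1, h2, h | h⟩
    · exact .inr (triple_inj h1 h2 hij hjk h)
    · exact .inl ⟨h1, h2, h⟩
  · rintro (⟨h1, h2, h⟩ | ⟨rfl, rfl, rfl⟩)
    · exact ⟨h1, h2, .inr h⟩
    · exact ⟨hij, hjk, .inl rfl⟩

theorem subset_of_rel {n : ℕ} {X Y : Finset (Finset ℕ)} (hX : X ⊆ binom n 3)
    (h : ∀ a b c, rel X a b c → rel Y a b c) : X ⊆ Y := by
  intro t ht
  obtain ⟨a, b, c, -, -, -, hab, hbc, rfl⟩ := exists_triple (hX ht)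
  exact (h a b c ⟨hab, hbc, ht⟩).2.2

theorem mem_ascSet_iff {n : ℕ} {X Z : Finset (Finset ℕ)} (hX : Consistent n 2 X) {i j k : ℕ}
    (hij : i < j) (hjk : j < k) (hZ : Z ⊆ binom n 3) : {i, j, k} ∈ ascSet n 2 X Z ↔
      Addable (box n) (rel X) i j k ∧ rel Z i j k := by
  have hc := (consistent_iff hX.1).1 hX
  simp only [ascSet, Finset.mem_filter, Finset.mem_sdiff]
  have hins : X ∪ {{i, j, k}} = insert {i, j, k} X := by ext; simp
  rw [hins]
  constructor
  · rintro ⟨⟨h1, h2⟩, h3⟩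
    have hb := (Finset.mem_powersetCard.1 (hZ h1)).1
    simp only [Finset.insert_subset_iff, Finset.singleton_subset_iff] at hb
    have h3' := (consistent_iff h3.1).1 h3
    rw [rel_insert hij hjk] at h3'
    exact ⟨.of_cons_ins hc hb.1 hb.2.1 hb.2.2 hij hjk (fun h => h2 h.2.2) h3', hij, hjk, h1⟩
  · rintro ⟨h1, h2⟩
    refine ⟨⟨h2.2.2, fun h => h1.2.2.2.2.2.1 ⟨hij, hjk, h⟩⟩, ?_⟩
    rw [consistent_iff (Finset.insert_subset (hZ h2.2.2) hX.1), rel_insert hij hjk]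
    exact h1.cons_ins hc

open Classical in
/-- `X` together with the triples generated by `S`. -/
noncomputable def span (n : ℕ) (X S : Finset (Finset ℕ)) : Finset (Finset ℕ) :=
  (binom n 3).filter fun t => t ∈ X ∨ ∃ a b c, t = {a, b, c} ∧ Gen (rel S) a b c

section Span

variable {n : ℕ} {X Z S : Finset (Finset ℕ)}

theorem addable_of_subset_ascSet (hX : Consistent n 2 X) (hZ : Z ⊆ binom n 3)
    (hS : S ⊆ ascSet n 2 X Z) : ∀ i j k, rel S i j k →
      Addable (box n) (rel X) i j k ∧ rel Z i j k :=
  fun _ _ _ h => (mem_ascSet_iff hX h.1 h.2.1 hZ).1 (hS h.2.2)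

theorem mem_span {t : Finset ℕ} : t ∈ span n X S ↔
    t ∈ binom n 3 ∧ (t ∈ X ∨ ∃ a b c, t = {a, b, c} ∧ Gen (rel S) a b c) := by
  classical simp [span]

theorem mem_closureHB {t : Finset ℕ} : t ∈ closureHB n 2 S ↔
    t ∈ binom n 3 ∧ ∀ T ⊆ binom n 3, S ⊆ T → IsClosedSet n 2 T → t ∈ T := by
  classical simp [closureHB]

theorem rel_span (hX : Consistent n 2 X) (hS : ∀ i j k, rel S i j k →
    Addable (box n) (rel X) i j k) :
    rel (span n X S) = fun a b c => rel X a b c ∨ Gen (rel S) a b c := by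
  have hc := (consistent_iff hX.1).1 hX
  ext a b c
  simp only [rel, mem_span]
  constructor
  · rintro ⟨h1, h2, h3, h4 | ⟨p, q, r, h5, h6⟩⟩
    · exact .inl ⟨h1, h2, h4⟩
    · have := h6.mem hc hS
      obtain ⟨rfl, rfl, rfl⟩ := triple_inj h1 h2 this.2.2.2.1 this.2.2.2.2.1 h5
      exact .inr h6
  · rintro (⟨h1, h2, h3⟩ | h)
    · exact ⟨h1, h2, hX.1 h3, .inl h3⟩
    · have := h.mem hc hS
      exact ⟨this.2.2.2.1, this.2.2.2.2.1, triple_mem_binom this.1 this.2.1 this.2.2.1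
        this.2.2.2.1 this.2.2.2.2.1, .inr ⟨a, b, c, rfl, h⟩⟩

theorem span_subset_binom : span n X S ⊆ binom n 3 := fun _ h => (mem_span.1 h).1

theorem subset_span (hX : Consistent n 2 X) : X ⊆ span n X S := fun _ ht =>
  mem_span.2 ⟨hX.1 ht, .inl ht⟩

theorem subset_span' (hS : S ⊆ binom n 3) : S ⊆ span n X S := fun t ht => by
  obtain ⟨a, b, c, -, -, -, hab, hbc, rfl⟩ := exists_triple (hS ht)
  exact mem_span.2 ⟨hS ht, .inr ⟨a, b, c, rfl, .base ⟨hab, hbc, ht⟩⟩⟩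

theorem span_subset (hX : Consistent n 2 X) (hS : ∀ i j k, rel S i j k →
    Addable (box n) (rel X) i j k) (hZ : Consistent n 2 Z) (hXZ : X ⊆ Z) (hSZ : S ⊆ Z) :
    span n X S ⊆ Z := by
  refine subset_of_rel span_subset_binom fun a b c h => ?_
  rw [rel_span hX hS] at h
  rcases h with h | h
  · exact ⟨h.1, h.2.1, hXZ h.2.2⟩
  · exact h.subset ((consistent_iff hX.1).1 hX) hS ((consistent_iff hZ.1).1 hZ)
      fun i j k h => ⟨h.1, h.2.1, hSZ h.2.2⟩

theorem consistent_span (hX : Consistent n 2 X) (hS : ∀ i j k, rel S i j k →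
    Addable (box n) (rel X) i j k) (hN : AllNeat (box n) (rel X) (Gen (rel S))) :
    Consistent n 2 (span n X S) := by
  rw [consistent_iff span_subset_binom, rel_span hX hS]
  exact cons_union_gen ((consistent_iff hX.1).1 hX) hS hN

theorem union_closureHB (hX : Consistent n 2 X) (hSb : S ⊆ binom n 3)
    (hS : ∀ i j k, rel S i j k → Addable (box n) (rel X) i j k)
    (hN : AllNeat (box n) (rel X) (Gen (rel S))) : X ∪ closureHB n 2 S = span n X S := by
  refine Finset.Subset.antisymm (Finset.union_subset (subset_span hX) fun t ht => ?_) ?_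
  · exact (mem_closureHB.1 ht).2 _ span_subset_binom (subset_span' hSb)
      (consistent_span hX hS hN).2.1
  · refine subset_of_rel span_subset_binom fun a b c h => ?_
    rw [rel_span hX hS] at h
    have hc := (consistent_iff hX.1).1 hX
    rcases h with h | h
    · exact ⟨h.1, h.2.1, Finset.mem_union_left _ h.2.2⟩
    · have hm := h.mem hc hS
      refine ⟨hm.2.2.2.1, hm.2.2.2.2.1, Finset.mem_union_right _ (mem_closureHB.2
        ⟨triple_mem_binom hm.1 hm.2.1 hm.2.2.1 hm.2.2.2.1 hm.2.2.2.2.1, fun T hT hST hTc => ?_⟩)⟩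
      rw [isClosedSet_iff] at hTc
      suffices rel T a b c from this.2.2
      clear hm
      induction h with
      | base h => exact ⟨h.1, h.2.1, hST h.2.2⟩
      | left h1 h2 h3 g1 g2 ih1 ih2 =>
        exact (hTc (g1.mem hc hS).1 (g1.mem hc hS).2.1 (g2.mem hc hS).2.1 (g2.mem hc hS).2.2.1
          h1 h2 h3).2.1 ih1 ih2
      | right h1 h2 h3 g1 g2 ih1 ih2 =>
        exact (hTc (g1.mem hc hS).1 (g1.mem hc hS).2.1 (g2.mem hc hS).2.1 (g2.mem hc hS).2.2.1
          h1 h2 h3).2.2.1 ih1 ih2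

end Span

section Moebius

theorem mu_eq_zero_of_signed_cover {P ι : Type*} [PartialOrder P] [LocallyFiniteOrder P]
    [DecidableEq P] [DecidableLE P] {a b : P} (hab : a ≤ b) (s : Finset ι) (w : ι → ℤ) (u : ι → P)
    (ha : ∀ i ∈ s, a ≤ u i) (hb : ∀ i ∈ s, u i ≠ b)
    (hw : ∀ z ∈ Finset.Icc a b, ∑ i ∈ s with u i ≤ z, w i = if z = a then 1 else 0) :
    IncidenceAlgebra.mu ℤ a b = 0 := by
  have h1 : ∀ i ∈ s, ∑ z ∈ Finset.Icc a b with u i ≤ z, IncidenceAlgebra.mu ℤ z b = 0 := by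
    intro i hi
    have he : (Finset.Icc a b).filter (u i ≤ ·) = Finset.Icc (u i) b := by
      ext z
      simp only [Finset.mem_filter, Finset.mem_Icc]
      exact ⟨fun h => ⟨h.2, h.1.2⟩, fun h => ⟨⟨(ha i hi).trans h.1, h.2⟩, h.1⟩⟩
    rw [he, IncidenceAlgebra.sum_Icc_mu_left, if_neg (hb i hi)]
  calc IncidenceAlgebra.mu ℤ a b
      = ∑ z ∈ Finset.Icc a b, (if z = a then 1 else 0) * IncidenceAlgebra.mu ℤ z b := by
        simp [hab]
    _ = ∑ z ∈ Finset.Icc a b, ∑ i ∈ s,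
          if u i ≤ z then w i * IncidenceAlgebra.mu ℤ z b else 0 := by
        refine Finset.sum_congr rfl fun z hz => ?_
        rw [← hw z hz, Finset.sum_mul, Finset.sum_filter]
    _ = ∑ i ∈ s, w i * ∑ z ∈ Finset.Icc a b with u i ≤ z, IncidenceAlgebra.mu ℤ z b := by
        rw [Finset.sum_comm]
        refine Finset.sum_congr rfl fun i _ => ?_
        rw [Finset.mul_sum, Finset.sum_filter]
    _ = 0 := Finset.sum_eq_zero fun i hi => by rw [h1 i hi, mul_zero]

theorem sum_neg_one_pow_card_eq_zero {α : Type*} [DecidableEq α] (D : Finset (Finset α)) (x : α)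
    (h1 : ∀ S ∈ D, insert x S ∈ D) (h2 : ∀ S ∈ D, S.erase x ∈ D) :
    ∑ S ∈ D, (-1 : ℤ) ^ S.card = 0 := by
  refine Finset.sum_involution (fun S _ => if x ∈ S then S.erase x else insert x S)
    (fun S hS => ?_) (fun S hS _ => ?_) (fun S hS => ?_) (fun S hS => ?_)
  · split_ifs with h
    · rw [← Finset.card_erase_add_one h, pow_succ]
      ring
    · rw [Finset.card_insert_of_notMem h, pow_succ]
      ring
  · split_ifs with h
    · exact fun he => (he ▸ Finset.notMem_erase x S) h
    · exact fun he => h (he ▸ Finset.mem_insert_self x S)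
  · split_ifs with h
    exacts [h2 S hS, h1 S hS]
  · by_cases h : x ∈ S <;> simp [h]

variable {n : ℕ} {X Y Z S : Finset (Finset ℕ)}

/-- All subfamilies of `S` generate neat families of triples over `X`. -/
def NeatFam (n : ℕ) (X S : Finset (Finset ℕ)) : Prop :=
  ∀ S' ⊆ S, AllNeat (_root_.box n) (rel X) (Gen (rel S'))

theorem sub_rel (hXZ : X ⊆ Z) : Sub (_root_.box n) (rel X) (rel Z) :=
  fun _ _ _ _ _ _ _ _ h => ⟨h.1, h.2.1, hXZ h.2.2⟩

theorem exists_ascent (hX : Consistent n 2 X) (hZ : Consistent n 2 Z) (hXZ : X ⊂ Z) :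
    ∃ f ∈ ascSet n 2 X Z, ∀ S ⊆ ascSet n 2 X Z, NeatFam n X S → NeatFam n X (insert f S) := by
  classical
  have hcX := (consistent_iff hX.1).1 hX
  have hcZ := (consistent_iff hZ.1).1 hZ
  have hne : ∃ i j k, Addable (_root_.box n) (rel X) i j k ∧ rel Z i j k := by
    refine exists_addable hcX hcZ (sub_rel hXZ.1) ?_
    obtain ⟨t, ht, htX⟩ := Finset.exists_of_ssubset hXZ
    obtain ⟨a, b, c, ha, hb, hc, hab, hbc, rfl⟩ := exists_triple (hZ.1 ht)
    exact ⟨a, ha, b, hb, c, hc, hab, hbc, ⟨hab, hbc, ht⟩, fun h => htX h.2.2⟩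
  obtain ⟨⟨p, q, r⟩, hm, hmax⟩ := Finset.exists_max_image
    (((_root_.box n) ×ˢ (_root_.box n) ×ˢ (_root_.box n)).filter fun t =>
      Addable (_root_.box n) (rel X) t.1 t.2.1 t.2.2 ∧ rel Z t.1 t.2.1 t.2.2)
    (fun t => (lowSet (_root_.box n) (rel X) t.1 t.2.1 t.2.2).card) (by
      obtain ⟨i, j, k, h1, h2⟩ := hne
      exact ⟨(i, j, k), by simp [h1, h2, h1.1, h1.2.1, h1.2.2.1]⟩)
  obtain ⟨hf, hfZ⟩ := (Finset.mem_filter.1 hm).2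
  refine ⟨{p, q, r}, (mem_ascSet_iff hX hfZ.1 hfZ.2.1 hZ.1).2 ⟨hf, hfZ⟩, fun S hS hN S' hS' => ?_⟩
  have hsub : S'.erase {p, q, r} ⊆ S := Finset.subset_insert_iff.1 hS'
  by_cases h : {p, q, r} ∈ S'
  · rw [← Finset.insert_erase h, rel_insert hfZ.1 hfZ.2.1]
    exact (hN _ hsub).gen_ins hcX hcZ (sub_rel hXZ.1)
      (addable_of_subset_ascSet hX hZ.1 (hsub.trans hS)) hf hfZ fun i j k h1 h2 =>
        hmax (i, j, k) (by simp [h1, h2, h1.1, h1.2.1, h1.2.2.1])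
  · rw [Finset.erase_eq_of_notMem h] at hsub
    exact hN _ hsub

theorem NeatFam.mono {T : Finset (Finset ℕ)} (h : NeatFam n X S) (hT : T ⊆ S) : NeatFam n X T :=
  fun S' hS' => h S' (hS'.trans hT)

theorem neatFam_empty : NeatFam n X ∅ := fun S' hS' => by
  obtain rfl := Finset.subset_empty.1 hS'
  have : ∀ i j k, ¬ Gen (rel ∅) i j k := fun i j k h => by
    induction h with
    | base h => exact absurd h.2.2 (Finset.notMem_empty _)
    | left _ _ _ _ _ ih => exact ih
    | right _ _ _ _ _ ih => exact ih
  exact fun i j k _ h => absurd h (this i j k)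

theorem sum_neatFam (hX : Consistent n 2 X) (hZ : Consistent n 2 Z) (hXZ : X ⊆ Z)
    (D : Finset (Finset (Finset ℕ)))
    (hD : ∀ S, S ∈ D ↔ S ⊆ ascSet n 2 X Z ∧ NeatFam n X S) :
    ∑ S ∈ D, (-1 : ℤ) ^ S.card = if Z = X then 1 else 0 := by
  split_ifs with h
  · subst h
    have : D = {∅} := by
      ext S
      simp only [hD, ascSet, Finset.sdiff_self, Finset.filter_empty, Finset.subset_empty,
        Finset.mem_singleton]
      exact ⟨fun h => h.1, fun h => ⟨h, h ▸ neatFam_empty⟩⟩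
    simp [this]
  · obtain ⟨f, hf, hfN⟩ := exists_ascent hX hZ (Finset.ssubset_iff_subset_ne.2 ⟨hXZ, Ne.symm h⟩)
    refine sum_neg_one_pow_card_eq_zero D f (fun S hS => ?_) (fun S hS => ?_) <;> rw [hD] at *
    · exact ⟨Finset.insert_subset hf hS.1, hfN S hS.1 hS.2⟩
    · exact ⟨(Finset.erase_subset _ _).trans hS.1, hS.2.mono (Finset.erase_subset _ _)⟩

theorem ascSet_subset : ascSet n 2 X Z ⊆ Z \ X := by
  classical exact Finset.filter_subset _ _

theorem facial_of_span_eq (hX : Consistent n 2 X) (hY : Consistent n 2 Y) (hXY : X ⊆ Y)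
    (hS : S ⊆ ascSet n 2 X Y) (hN : NeatFam n X S) (he : span n X S = Y) : Facial n X Y := by
  have hSA : ∀ T ⊆ ascSet n 2 X Y, ∀ i j k, rel T i j k → Addable (_root_.box n) (rel X) i j k :=
    fun T hT i j k h => (addable_of_subset_ascSet hX hY.1 hT i j k h).1
  have hb : ascSet n 2 X Y ⊆ binom n 3 := ascSet_subset.trans (Finset.sdiff_subset.trans hY.1)
  have hSe : S = ascSet n 2 X Y := by
    refine Finset.Subset.antisymm hS fun f hf => ?_
    obtain ⟨a, b, c, -, -, -, hab, hbc, rfl⟩ := exists_triple (hb hf)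
    have hfa := (mem_ascSet_iff hX hab hbc hY.1).1 hf
    have hfY := hfa.2
    rw [← he, rel_span hX (hSA S hS)] at hfY
    rcases hfY with h | h
    · exact absurd h hfa.1.2.2.2.2.2.1
    · exact (h.of_addable ((consistent_iff hX.1).1 hX) (hSA S hS) hfa.1).2.2
  subst hSe
  refine ⟨hX, hY, hXY, ?_, fun T hT => ?_⟩
  · rw [union_closureHB hX hb (hSA _ hS) (hN _ subset_rfl), he]
  · rw [union_closureHB hX (hT.trans hb) (hSA T hT) (hN T hT)]
    exact consistent_span hX (hSA T hT) (hN T hT)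

end Moebius

end HB

/-- For a non-facial pair `X ⊊ Y` the Möbius function of the poset of consistent
subsets of `binom([n],3)` satisfies `μ(X,Y) = 0`. -/
theorem mu_not_facial (n : ℕ) (hn : 1 ≤ n) (X Y : Finset (Finset ℕ))
    (hX : Consistent n 2 X) (hY : Consistent n 2 Y) (hXY : X ⊂ Y)
    (hfac : ¬ Facial n X Y) :
    muHB n ⟨X, hX⟩ ⟨Y, hY⟩ = 0 := by
  classical
  have hA : ∀ S ⊆ ascSet n 2 X Y, ∀ i j k, HB.rel S i j k →
      HB.Addable (_root_.box n) (HB.rel X) i j k :=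
    fun S hS i j k h => (HB.addable_of_subset_ascSet hX hY.1 hS i j k h).1
  have hb : ascSet n 2 X Y ⊆ binom n 3 :=
    HB.ascSet_subset.trans (Finset.sdiff_subset.trans hY.1)
  let D := (ascSet n 2 X Y).powerset.filter (HB.NeatFam n X)
  have hD : ∀ S, S ∈ D ↔ S ⊆ ascSet n 2 X Y ∧ HB.NeatFam n X S := fun S => by simp [D]
  let u : Finset (Finset ℕ) → ConsPoset n := fun S =>
    if h : Consistent n 2 (HB.span n X S) then ⟨_, h⟩ else ⟨X, hX⟩
  have hu : ∀ S ∈ D, (u S).1 = HB.span n X S := fun S hS => by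
    obtain ⟨h1, h2⟩ := (hD S).1 hS
    simp [u, HB.consistent_span hX (hA S h1) (h2 S subset_rfl)]
  refine HB.mu_eq_zero_of_signed_cover (show (⟨X, hX⟩ : ConsPoset n) ≤ ⟨Y, hY⟩ from hXY.1) D
    (fun S => (-1) ^ S.card) u (fun S hS => ?_) (fun S hS he => ?_) (fun Z hZ => ?_)
  · change X ⊆ (u S).1
    rw [hu S hS]
    exact HB.subset_span hX
  · obtain ⟨h1, h2⟩ := (hD S).1 hS
    exact hfac (HB.facial_of_span_eq hX hY hXY.1 h1 h2 ((hu S hS).symm.trans (by rw [he])))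
  · obtain ⟨Z, hcZ⟩ := Z
    have hXZ : X ⊆ Z := (Finset.mem_Icc.1 hZ).1
    have hZY : Z ⊆ Y := (Finset.mem_Icc.1 hZ).2
    have hasc : ascSet n 2 X Z = ascSet n 2 X Y ∩ Z := by
      ext t
      simp only [ascSet, Finset.mem_filter, Finset.mem_sdiff, Finset.mem_inter]
      exact ⟨fun h => ⟨⟨⟨hZY h.1.1, h.1.2⟩, h.2⟩, h.1.1⟩, fun h => ⟨⟨h.2, h.1.1.2⟩, h.1.2⟩⟩
    rw [HB.sum_neatFam hX hcZ hXZ]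
    · exact if_congr ⟨fun h => Subtype.ext h, congrArg Subtype.val⟩ rfl rfl
    · intro S
      rw [Finset.mem_filter, hD, hasc, Finset.subset_inter_iff]
      constructor
      · rintro ⟨⟨h1, h2⟩, h3⟩
        have h3' : (u S).1 ⊆ Z := h3
        rw [hu S ((hD S).2 ⟨h1, h2⟩)] at h3'
        exact ⟨⟨h1, (HB.subset_span' (h1.trans hb)).trans h3'⟩, h2⟩
      · rintro ⟨⟨h1, h2⟩, h3⟩
        refine ⟨⟨h1, h3⟩, ?_⟩
        change (u S).1 ⊆ Z
        rw [hu S ((hD S).2 ⟨h1, h3⟩)]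
        exact HB.span_subset hX (hA S h1) hcZ hXZ h2
end

section
/- Let n, d ∈ ℕ with d ≥ 1 and let X ⊆ binom([n], d+1). Then X is consistent if and only if for every (d+2)-element subset P = {i_0 < i_1 < ⋯ < i_{d+1}} of [n], the restriction X|_P has the form {P∖{i_s} : s ∈ S} where S ⊆ {0, 1, …, d+1} is either an upper interval S = {t, t+1, …, d+1} for some t, or a lower interval S = {0, 1, …, t} for some t, or empty. -/
open Finset

/-- Closedness, read off from the facets `P.erase x` of the `(d+2)`-subsets `P` of `[n]`. -/
theorem isClosedSet_iff_erase {n d : ℕ} (hd : 1 ≤ d) (Y : Finset (Finset ℕ)) :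
    IsClosedSet n d Y ↔ ∀ P ∈ binom n (d + 2), ∀ i ∈ P, ∀ j ∈ P, ∀ k ∈ P, i < j → j < k →
      P.erase k ∈ Y → P.erase i ∈ Y → P.erase j ∈ Y := by
  constructor
  · intro h P hP i hi j hj k hk hij hjk hPk hPi
    obtain ⟨hPn, hcard⟩ := Finset.mem_powersetCard.1 hP
    have hI : P \ {i, j, k} ∈ binom n (d - 1) := by
      refine Finset.mem_powersetCard.2 ⟨Finset.sdiff_subset.trans hPn, ?_⟩
      have hsub : ({i, j, k} : Finset ℕ) ⊆ P := by grind
      have hthree : ({i, j, k} : Finset ℕ).card = 3 :=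
        Finset.card_eq_three.2 ⟨i, j, k, by lia, by lia, by lia, rfl⟩
      rw [Finset.card_sdiff_of_subset hsub, hthree]
      lia
    have hk' : P \ {i, j, k} ∪ {i, j} = P.erase k := by ext x; grind
    have hi' : P \ {i, j, k} ∪ {j, k} = P.erase i := by ext x; grind
    have hj' : P \ {i, j, k} ∪ {i, k} = P.erase j := by ext x; grind
    have := h _ hI i (hPn hi) j (hPn hj) k (hPn hk) (by simp) (by simp) (by simp) hij hjk
    rw [hk', hi', hj'] at this
    exact this hPk hPi
  · intro h I hI i hi j hj k hk hiI hjI hkI hij hjk hIij hIjk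
    obtain ⟨hIn, hcard⟩ := Finset.mem_powersetCard.1 hI
    have hP : I ∪ {i, j, k} ∈ binom n (d + 2) := by
      refine Finset.mem_powersetCard.2 ⟨by grind, ?_⟩
      have hthree : ({i, j, k} : Finset ℕ).card = 3 :=
        Finset.card_eq_three.2 ⟨i, j, k, by lia, by lia, by lia, rfl⟩
      rw [Finset.card_union_of_disjoint (by simp [hiI, hjI, hkI]), hthree]
      lia
    have hk' : (I ∪ {i, j, k}).erase k = I ∪ {i, j} := by ext x; grind
    have hi' : (I ∪ {i, j, k}).erase i = I ∪ {j, k} := by ext x; grind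
    have hj' : (I ∪ {i, j, k}).erase j = I ∪ {i, k} := by ext x; grind
    have := h _ hP i (by simp) j (by simp) k (by simp) hij hjk
    rw [hk', hi', hj'] at this
    exact this hIij hIjk

theorem erase_mem_binom {n m x : ℕ} {P : Finset ℕ} (hP : P ∈ binom n (m + 1)) (hx : x ∈ P) :
    P.erase x ∈ binom n m := by
  obtain ⟨hPn, hcard⟩ := Finset.mem_powersetCard.1 hP
  refine Finset.mem_powersetCard.2 ⟨(Finset.erase_subset _ _).trans hPn, ?_⟩
  rw [Finset.card_erase_of_mem hx, hcard, Nat.add_sub_cancel]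

/-- A set of naturals below `N` is convex with convex complement iff it is empty, an upper
interval or a lower interval. -/
theorem convex_and_compl_convex_iff {N : ℕ} {S : Finset ℕ} (hS : S ⊆ Finset.range N) :
    (∀ a b c, a < b → b < c → c < N →
      (a ∈ S → c ∈ S → b ∈ S) ∧ (a ∉ S → c ∉ S → b ∉ S)) ↔
    (S = ∅ ∨ (∃ t, t < N ∧ S = Finset.Ico t N) ∨ (∃ t, t < N ∧ S = Finset.Iic t)) := by
  constructor
  · intro h
    rcases S.eq_empty_or_nonempty with hne | hne
    · exact Or.inl hne
    refine Or.inr ?_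
    have hlt : ∀ s ∈ S, s < N := fun s hs => Finset.mem_range.1 (hS hs)
    by_cases h0 : 0 ∈ S
    · have hmax := S.max'_mem hne
      refine Or.inr ⟨S.max' hne, hlt _ hmax, ?_⟩
      ext s
      rw [Finset.mem_Iic]
      refine ⟨S.le_max' s, fun hs => ?_⟩
      rcases hs.eq_or_lt with rfl | hs
      · exact hmax
      rcases s.eq_zero_or_pos with rfl | hpos
      · exact h0
      exact (h 0 s _ hpos hs (hlt _ hmax)).1 h0 hmax
    · have hmin := S.min'_mem hne
      refine Or.inl ⟨S.min' hne, hlt _ hmin, ?_⟩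
      ext s
      rw [Finset.mem_Ico]
      refine ⟨fun hs => ⟨S.min'_le s hs, hlt s hs⟩, fun ⟨hs, hsN⟩ => ?_⟩
      by_contra hsS
      have hpos : 0 < S.min' hne := Nat.pos_of_ne_zero fun h' => h0 (h' ▸ hmin)
      have hlt' : S.min' hne < s := lt_of_le_of_ne hs fun h' => hsS (h' ▸ hmin)
      exact (h 0 _ s hpos hlt' hsN).2 h0 hsS hmin
  · rintro (rfl | ⟨t, -, rfl⟩ | ⟨t, -, rfl⟩) a b c hab hbc hc
    · simp
    · simp only [Finset.mem_Ico]; lia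
    · simp only [Finset.mem_Iic]; lia

/-- Consistency, read off from the facets `P.erase x` of the `(d+2)`-subsets `P` of `[n]`. -/
theorem consistent_iff_erase {n d : ℕ} (hd : 1 ≤ d) {X : Finset (Finset ℕ)}
    (hX : X ⊆ binom n (d + 1)) :
    Consistent n d X ↔ ∀ P ∈ binom n (d + 2), ∀ i ∈ P, ∀ j ∈ P, ∀ k ∈ P, i < j → j < k →
      (P.erase i ∈ X → P.erase k ∈ X → P.erase j ∈ X) ∧
      (P.erase i ∉ X → P.erase k ∉ X → P.erase j ∉ X) := by
  have hmem : ∀ P ∈ binom n (d + 2), ∀ x ∈ P,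
      (P.erase x ∈ binom n (d + 1) \ X ↔ P.erase x ∉ X) := fun P hP x hx => by
    simp [erase_mem_binom hP hx]
  rw [Consistent, isClosedSet_iff_erase hd, isClosedSet_iff_erase hd]
  constructor
  · rintro ⟨-, h₁, h₂⟩ P hP i hi j hj k hk hij hjk
    have h₂' := h₂ P hP i hi j hj k hk hij hjk
    rw [hmem P hP i hi, hmem P hP j hj, hmem P hP k hk] at h₂'
    exact ⟨fun a c => h₁ P hP i hi j hj k hk hij hjk c a, fun a c => h₂' c a⟩
  · intro h
    refine ⟨hX, fun P hP i hi j hj k hk hij hjk c a =>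
      (h P hP i hi j hj k hk hij hjk).1 a c, fun P hP i hi j hj k hk hij hjk => ?_⟩
    rw [hmem P hP i hi, hmem P hP j hj, hmem P hP k hk]
    exact fun c a => (h P hP i hi j hj k hk hij hjk).2 a c

/-- A family of `m`-sets, restricted to an `(m+1)`-set `P` enumerated by `e`, consists of the
facets `P.erase (e s)` belonging to it. -/
theorem filter_subset_eq_image_erase {n m : ℕ} {X : Finset (Finset ℕ)} (hX : X ⊆ binom n m)
    {e : ℕ → ℕ} {P : Finset ℕ} (hcard : P.card = m + 1)
    (hPe : P = (Finset.range (m + 1)).image e) :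
    X.filter (fun I => I ⊆ P) =
      ((Finset.range (m + 1)).filter fun s => P.erase (e s) ∈ X).image
        fun s => P.erase (e s) := by
  ext I
  simp only [Finset.mem_filter, Finset.mem_image]
  constructor
  · rintro ⟨hI, hIP⟩
    have hIcard := (Finset.mem_powersetCard.1 (hX hI)).2
    obtain ⟨x, hx, hxI⟩ := Finset.exists_mem_notMem_of_card_lt_card (s := I) (t := P) (by lia)
    have hIx : P.erase x = I := by
      refine (Finset.eq_of_subset_of_card_le (Finset.subset_erase.2 ⟨hIP, hxI⟩) ?_).symm
      rw [Finset.card_erase_of_mem hx]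
      lia
    rw [hPe] at hx
    obtain ⟨s, hs, rfl⟩ := Finset.mem_image.1 hx
    exact ⟨s, ⟨hs, hIx ▸ hI⟩, hIx⟩
  · rintro ⟨s, ⟨-, hs⟩, rfl⟩
    exact ⟨hs, Finset.erase_subset _ _⟩

theorem lt_of_lt_succ_below {e : ℕ → ℕ} {m : ℕ} (he : ∀ s, s < m → e s < e (s + 1)) {a b : ℕ}
    (hab : a < b) (hb : b ≤ m) : e a < e b := by
  induction b, hab using Nat.le_induction with
  | base => exact he a hb
  | succ b _ ih => exact (ih (by lia)).trans (he b hb)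

/-- Every set of `m + 1` naturals is enumerated increasingly. -/
theorem exists_increasing_enumeration {m : ℕ} {P : Finset ℕ} (hP : P.card = m + 1) :
    ∃ e : ℕ → ℕ, (∀ s, s < m → e s < e (s + 1)) ∧ P = (Finset.range (m + 1)).image e := by
  refine ⟨fun s => if h : s < m + 1 then P.orderEmbOfFin hP ⟨s, h⟩ else 0, fun s hs => ?_, ?_⟩
  · simp [hs, hs.trans (Nat.lt_succ_self m)]
  · ext x
    rw [← Finset.mem_coe, ← Finset.range_orderEmbOfFin P hP, Finset.mem_image]
    constructor
    · rintro ⟨s, rfl⟩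
      exact ⟨s, Finset.mem_range.2 s.2, dif_pos s.2⟩
    · rintro ⟨s, hs, rfl⟩
      exact ⟨⟨s, Finset.mem_range.1 hs⟩, by simp [Finset.mem_range.1 hs]⟩

/-- `X ⊆ binom([n],d+1)` is consistent iff, for every `(d+2)`-subset
`P = {i₀ < ⋯ < i_{d+1}}` of `[n]`, the restriction `X|_P` is of the form
`{P ∖ {i_s} : s ∈ S}` for `S` an upper interval, a lower interval, or empty. -/
theorem consistent_iff_restrictions (n d : ℕ) (hd : 1 ≤ d) (X : Finset (Finset ℕ))
    (hXsub : X ⊆ binom n (d + 1)) :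
    Consistent n d X ↔
      ∀ P ∈ binom n (d + 2), ∀ e : ℕ → ℕ,
        (∀ s, s < d + 1 → e s < e (s + 1)) →
        P = (Finset.range (d + 2)).image e →
        ∃ S ⊆ Finset.range (d + 2),
          (S = ∅ ∨ (∃ t, t < d + 2 ∧ S = Finset.Ico t (d + 2)) ∨
            (∃ t, t < d + 2 ∧ S = Finset.Iic t)) ∧
          X.filter (fun I => I ⊆ P) = S.image (fun s => P.erase (e s)) := by
  rw [consistent_iff_erase hd hXsub]
  constructor
  · intro h P hP e he hPe
    have hmem : ∀ s, s < d + 2 → e s ∈ P := fun s hs =>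
      hPe ▸ Finset.mem_image_of_mem e (Finset.mem_range.2 hs)
    refine ⟨(Finset.range (d + 2)).filter fun s => P.erase (e s) ∈ X, Finset.filter_subset _ _,
      (convex_and_compl_convex_iff (Finset.filter_subset _ _)).1 fun a b c hab hbc hc => ?_,
      filter_subset_eq_image_erase hXsub (Finset.mem_powersetCard.1 hP).2 hPe⟩
    have hb : b < d + 2 := hbc.trans hc
    have ha : a < d + 2 := hab.trans hb
    simpa [ha, hb, hc] using h P hP (e a) (hmem a ha) (e b) (hmem b hb) (e c) (hmem c hc)
      (lt_of_lt_succ_below he hab (by lia)) (lt_of_lt_succ_below he hbc (by lia))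
  · intro h P hP i hi j hj k hk hij hjk
    obtain ⟨e, he, hPe⟩ := exists_increasing_enumeration (Finset.mem_powersetCard.1 hP).2
    obtain ⟨S, hS, hform, hXS⟩ := h P hP e he hPe
    have hmono : StrictMonoOn e (Set.Iio (d + 2)) := fun a _ b hb hab =>
      lt_of_lt_succ_below he hab (Nat.le_of_lt_succ hb)
    have hmem : ∀ s, s < d + 2 → (P.erase (e s) ∈ X ↔ s ∈ S) := by
      intro s hs
      have hsP : e s ∈ P := hPe ▸ Finset.mem_image_of_mem e (Finset.mem_range.2 hs)
      have hiff : P.erase (e s) ∈ X ↔ P.erase (e s) ∈ X.filter fun I => I ⊆ P := by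
        simp [Finset.erase_subset]
      rw [hiff, hXS, Finset.mem_image]
      refine ⟨fun ⟨r, hr, hrs⟩ => ?_, fun hs => ⟨s, hs, rfl⟩⟩
      have hers : e s = e r := (Finset.erase_inj P hsP).1 hrs.symm
      exact hmono.injOn hs (Finset.mem_range.1 (hS hr)) hers ▸ hr
    have hidx : ∀ x ∈ P, ∃ s < d + 2, e s = x := fun x hx => by
      rw [hPe] at hx
      simpa only [Finset.mem_image, Finset.mem_range] using hx
    obtain ⟨a, ha, rfl⟩ := hidx i hi
    obtain ⟨b, hb, rfl⟩ := hidx j hj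
    obtain ⟨c, hc, rfl⟩ := hidx k hk
    rw [hmem a ha, hmem b hb, hmem c hc]
    exact (convex_and_compl_convex_iff hS).2 hform a b c ((hmono.lt_iff_lt ha hb).1 hij)
      ((hmono.lt_iff_lt hb hc).1 hjk) hc
end

section
/- Let n ≥ 1 and let X be a consistent subset of binom([n], 3). Consider the graph on the ascent set Asc(X) in which distinct ascents I and J are adjacent when |I ∩ J| = 2, and let A and B be distinct connected components of this graph with |[A] ∩ [B]| ≥ 2, where [𝓐] denotes the union of the members of 𝓐. Then, after possibly exchanging A and B, one has [A] ∩ [B] = {min [B], max [B]} and X ∪ cl(A) is not consistent. -/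
open Finset

/-- Adjacency of the graph on a collection `A` of triples: distinct members sharing
two elements. -/
def AdjAsc (A : Finset (Finset ℕ)) (I J : Finset ℕ) : Prop :=
  I ∈ A ∧ J ∈ A ∧ I ≠ J ∧ (I ∩ J).card = 2

open Classical in
/-- The connected component of `I` in the graph on `A` with adjacency `AdjAsc A`. -/
noncomputable def component (A : Finset (Finset ℕ)) (I : Finset ℕ) : Finset (Finset ℕ) :=
  A.filter fun J => Relation.ReflTransGen (AdjAsc A) I J

/-- `[𝓐]`, the union of the members of `𝓐`. -/
def unionSet (A : Finset (Finset ℕ)) : Finset ℕ := A.biUnion id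

/-- The closure condition on increasing triples, one four-element packet at a time. -/
def ClosedRel (n : ℕ) (T : ℕ → ℕ → ℕ → Prop) : Prop :=
  ∀ a b c d, 1 ≤ a → a < b → b < c → c < d → d ≤ n →
    (T a b c → T a c d → T a b d) ∧ (T a b c → T b c d → T a b d ∧ T a c d) ∧
      (T a b d → T b c d → T a c d)

/-- The crossing of the pseudolines `p < q` lies above the pseudoline `x`. -/
def Above (T : ℕ → ℕ → ℕ → Prop) (p q x : ℕ) : Prop :=
  (x < p ∧ T x p q) ∨ (p < x ∧ x < q ∧ ¬ T p x q) ∨ (q < x ∧ T p q x)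

/-- `p < q` are consecutive elements of `S`. -/
def Consec (S : Finset ℕ) (p q : ℕ) : Prop :=
  p ∈ S ∧ q ∈ S ∧ p < q ∧ ∀ r ∈ S, ¬ (p < r ∧ r < q)

/-- The properties of the support of a component of ascents that are used below. -/
structure IsSupport (n : ℕ) (T : ℕ → ℕ → ℕ → Prop) (S : Finset ℕ) : Prop where
  bounds : ∀ x ∈ S, 1 ≤ x ∧ x ≤ n
  not_mem : ∀ a ∈ S, ∀ b ∈ S, ∀ c ∈ S, a < b → b < c → ¬ T a b c
  above_iff : ∀ p q p' q' x, Consec S p q → Consec S p' q' → 1 ≤ x → x ≤ n → x ∉ S →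
    (Above T p q x ↔ Above T p' q' x)
  card : 3 ≤ S.card

theorem exists_consec_right {S : Finset ℕ} {p q : ℕ} (hp : p ∈ S) (hq : q ∈ S) (h : p < q) :
    ∃ x, Consec S p x ∧ x ≤ q := by
  have hne : (S.filter (p < ·)).Nonempty := ⟨q, by simp [hq, h]⟩
  have hm := Finset.min'_mem _ hne
  have hl := Finset.min'_le (S.filter (p < ·))
  simp only [Finset.mem_filter] at hm hl
  exact ⟨_, ⟨hp, hm.1, hm.2, fun r hr hr' => absurd (hl r ⟨hr, hr'.1⟩) (by omega)⟩,
    hl q ⟨hq, h⟩⟩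

theorem exists_consec_left {S : Finset ℕ} {p q : ℕ} (hp : p ∈ S) (hq : q ∈ S) (h : p < q) :
    ∃ x, Consec S x q ∧ p ≤ x := by
  have hne : (S.filter (· < q)).Nonempty := ⟨p, by simp [hp, h]⟩
  have hm := Finset.max'_mem _ hne
  have hl := Finset.le_max' (S.filter (· < q))
  simp only [Finset.mem_filter] at hm hl
  exact ⟨_, ⟨hm.1, hq, hm.2, fun r hr hr' => absurd (hl r ⟨hr, hr'.2⟩) (by omega)⟩,
    hl p ⟨hp, h⟩⟩

theorem above_right {T : ℕ → ℕ → ℕ → Prop} {p q x : ℕ} (h : p < q) (hx : q < x) :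
    Above T p q x ↔ T p q x := by unfold Above; grind

theorem above_left {T : ℕ → ℕ → ℕ → Prop} {p q x : ℕ} (h : p < q) (hx : x < p) :
    Above T p q x ↔ T x p q := by unfold Above; grind

theorem above_mid {T : ℕ → ℕ → ℕ → Prop} {p q x : ℕ} (h : p < x) (hx : x < q) :
    Above T p q x ↔ ¬ T p x q := by unfold Above; grind

section Supports

variable {n : ℕ} {T : ℕ → ℕ → ℕ → Prop} {A B : Finset ℕ}

theorem IsSupport.min_of_above (hT : ClosedRel n T)
    (hT' : ClosedRel n fun a b c => ¬ T a b c) (hA : IsSupport n T A) (hB : IsSupport n T B)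
    {p q x : ℕ} (hpA : p ∈ A) (hpB : p ∈ B) (hqA : q ∈ A) (hqB : q ∈ B)
    (hx : Consec A p x) (hxq : x < q)
    (hab : ∀ u v, Consec B u v → Above T u v x) : ∀ z ∈ B, p ≤ z := by
  intro z₀ hz₀
  by_contra! hlt
  obtain ⟨z, hz, -⟩ := exists_consec_left hz₀ hpB hlt
  obtain ⟨x', hx', hxx'⟩ := exists_consec_left hx.2.1 hqA hxq
  have h1 : T z p x := (above_right hz.2.2.1 hx.2.2.1).1 (hab _ _ hz)
  have hzp := hz.2.2.1
  have hpx := hx.2.2.1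
  have hx'q := hx'.2.2.1
  have hb := hB.bounds z hz.1
  have hbq := hA.bounds q hqA
  by_cases hzA : z ∈ A
  · exact hA.not_mem z hzA p hpA x hx.2.1 hzp hpx h1
  · have h2 := hA.above_iff p x x' q z hx hx' hb.1 hb.2 hzA
    rw [above_left hpx hzp, above_left hx'q (by omega)] at h2
    have h3 : T z x' q := h2.1 h1
    have h4 : ¬ T z p q := hB.not_mem z hz.1 p hpB q hqB hzp (by omega)
    have h5 : ¬ T z x q := fun h =>
      h4 ((hT z p x q hb.1 hzp hpx hxq hbq.2).1 h1 h)
    rcases hxx'.eq_or_lt with rfl | hlt'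
    · exact h5 h3
    · have h6 := hA.not_mem x hx.2.1 x' hx'.1 q hqA hlt' hx'q
      exact (hT' z x x' q hb.1 (by omega) hlt' hx'q hbq.2).2.2 h5 h6 h3

theorem IsSupport.max_of_above (hT : ClosedRel n T)
    (hT' : ClosedRel n fun a b c => ¬ T a b c) (hA : IsSupport n T A) (hB : IsSupport n T B)
    {p q x : ℕ} (hpA : p ∈ A) (hpB : p ∈ B) (hqA : q ∈ A) (hqB : q ∈ B)
    (hx : Consec A p x) (hxq : x < q)
    (hab : ∀ u v, Consec B u v → Above T u v x) : ∀ z ∈ B, z ≤ q := by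
  intro z₀ hz₀
  by_contra! hlt
  obtain ⟨w, hw, -⟩ := exists_consec_right hqB hz₀ hlt
  obtain ⟨x', hx', hxx'⟩ := exists_consec_left hx.2.1 hqA hxq
  have hqw := hw.2.2.1
  have h1 : T x q w := (above_left hqw hxq).1 (hab _ _ hw)
  have hpx := hx.2.2.1
  have hx'q := hx'.2.2.1
  have hb := hB.bounds w hw.2.1
  have hbp := hA.bounds p hpA
  by_cases hwA : w ∈ A
  · exact hA.not_mem x hx.2.1 q hqA w hwA hxq hqw h1
  · have h2 := hA.above_iff p x x' q w hx hx' hb.1 hb.2 hwA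
    rw [above_right hpx (by omega), above_right hx'q hqw] at h2
    have h4 : ¬ T p q w := hB.not_mem p hpB q hqB w hw.2.1 (by omega) hqw
    have h3 : ¬ T p x w := fun h =>
      h4 ((hT p x q w hbp.1 hpx hxq hqw hb.2).2.2 h h1)
    rcases hxx'.eq_or_lt with rfl | hlt'
    · exact h3 (h2.2 h1)
    · have h6 := hA.not_mem x hx.2.1 x' hx'.1 q hqA hlt' hx'q
      exact ((hT' x x' q w (by omega) hlt' hx'q hqw hb.2).2.1 h6 (fun h => h3 (h2.2 h))).2 h1

/-- The configuration of two supports meeting exactly in the extreme elements of `B`, with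
the witnesses obstructing the consistency of adding all triples of `A`. -/
def Nested (T : ℕ → ℕ → ℕ → Prop) (A B : Finset ℕ) : Prop :=
  ∃ p q x y, p ∈ B ∧ q ∈ B ∧ (∀ z ∈ B, p ≤ z ∧ z ≤ q) ∧ A ∩ B = {p, q} ∧
    x ∈ A ∧ y ∈ B ∧ y ∉ A ∧ p < x ∧ x < q ∧ p < y ∧ y < q ∧
    (x < y ∧ ¬ T p x y ∨ y < x ∧ T p y x)

theorem inter_eq_pair {p q : ℕ} (hC : Consec (A ∩ B) p q) (h : ∀ z ∈ B, p ≤ z ∧ z ≤ q) :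
    A ∩ B = {p, q} := by
  obtain ⟨hp, hq, -, hr⟩ := hC
  ext z
  simp only [Finset.mem_insert, Finset.mem_singleton]
  constructor
  · intro hz
    have h1 := hr z hz
    have h2 := h z (Finset.mem_inter.1 hz).2
    omega
  · rintro (rfl | rfl) <;> assumption

theorem not_consec_of_consec (hT : ClosedRel n T)
    (hT' : ClosedRel n fun a b c => ¬ T a b c) (hA : IsSupport n T A) (hB : IsSupport n T B)
    {p q x : ℕ} (hC : Consec (A ∩ B) p q) (hx : Consec A p x) (hxq : x < q) (hxB : x ∉ B) :
    ¬ Consec B p q := by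
  intro hpq
  obtain ⟨hp, hq, -, -⟩ := hC
  rw [Finset.mem_inter] at hp hq
  have hb := hA.bounds x hx.2.1
  have hab : ∀ u v, Consec B u v → Above T u v x := by
    intro u v huv
    rw [hB.above_iff u v p q x huv hpq hb.1 hb.2 hxB, above_mid hx.2.2.1 hxq]
    exact hA.not_mem p hp.1 x hx.2.1 q hq.1 hx.2.2.1 hxq
  have h1 := hA.min_of_above hT hT' hB hp.1 hp.2 hq.1 hq.2 hx hxq hab
  have h2 := hA.max_of_above hT hT' hB hp.1 hp.2 hq.1 hq.2 hx hxq hab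
  have h3 : B ⊆ {p, q} := by
    intro z hz
    have := h1 z hz
    have := h2 z hz
    have := hpq.2.2.2 z hz
    simp only [Finset.mem_insert, Finset.mem_singleton]
    omega
  have := Finset.card_le_card h3
  have := Finset.card_le_two (a := p) (b := q)
  have := hB.card
  omega

theorem nested_of_above (hT : ClosedRel n T)
    (hT' : ClosedRel n fun a b c => ¬ T a b c) (hA : IsSupport n T A) (hB : IsSupport n T B)
    {p q x y : ℕ} (hC : Consec (A ∩ B) p q) (hx : Consec A p x) (hxq : x < q) (hxB : x ∉ B)
    (hy : Consec B p y) (hyq : y < q) (hyA : y ∉ A) (hab : Above T p y x) : Nested T A B := by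
  obtain ⟨hp, hq, -, -⟩ := id hC
  rw [Finset.mem_inter] at hp hq
  have hb := hA.bounds x hx.2.1
  have hab' : ∀ u v, Consec B u v → Above T u v x := fun u v huv =>
    (hB.above_iff u v p y x huv hy hb.1 hb.2 hxB).2 hab
  have h1 := hA.min_of_above hT hT' hB hp.1 hp.2 hq.1 hq.2 hx hxq hab'
  have h2 := hA.max_of_above hT hT' hB hp.1 hp.2 hq.1 hq.2 hx hxq hab'
  have h3 : ∀ z ∈ B, p ≤ z ∧ z ≤ q := fun z hz => ⟨h1 z hz, h2 z hz⟩
  refine ⟨p, q, x, y, hp.2, hq.2, h3, inter_eq_pair hC h3, hx.2.1, hy.2.1, hyA,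
    hx.2.2.1, hxq, hy.2.2.1, hyq, ?_⟩
  rcases lt_trichotomy x y with h | h | h
  · exact Or.inl ⟨h, (above_mid hx.2.2.1 h).1 hab⟩
  · exact absurd (h ▸ hy.2.1) hxB
  · exact Or.inr ⟨h, (above_right hy.2.2.1 h).1 hab⟩

theorem nested_or_nested (hT : ClosedRel n T)
    (hT' : ClosedRel n fun a b c => ¬ T a b c) (hA : IsSupport n T A) (hB : IsSupport n T B)
    (hAB : ∀ p q, Consec A p q → ¬ Consec B p q) (hcard : 2 ≤ (A ∩ B).card) :
    Nested T A B ∨ Nested T B A := by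
  obtain ⟨u, hu, v, hv, huv⟩ := Finset.one_lt_card.1 hcard
  obtain ⟨p, q, hC⟩ : ∃ p q, Consec (A ∩ B) p q := by
    rcases huv.lt_or_gt with h | h
    · obtain ⟨x, hx, -⟩ := exists_consec_right hu hv h
      exact ⟨_, _, hx⟩
    · obtain ⟨x, hx, -⟩ := exists_consec_right hv hu h
      exact ⟨_, _, hx⟩
  obtain ⟨hp, hq, hpq, hr⟩ := id hC
  rw [Finset.mem_inter] at hp hq
  have hC' : Consec (B ∩ A) p q := Finset.inter_comm A B ▸ hC
  obtain ⟨x, hx, hxq⟩ := exists_consec_right hp.1 hq.1 hpq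
  obtain ⟨y, hy, hyq⟩ := exists_consec_right hp.2 hq.2 hpq
  have hxB : x < q → x ∉ B := fun h h' =>
    hr x (Finset.mem_inter.2 ⟨hx.2.1, h'⟩) ⟨hx.2.2.1, h⟩
  have hyA : y < q → y ∉ A := fun h h' =>
    hr y (Finset.mem_inter.2 ⟨h', hy.2.1⟩) ⟨hy.2.2.1, h⟩
  have hxq' : x < q := by
    refine hxq.lt_of_ne ?_
    rintro rfl
    rcases hyq.eq_or_lt with rfl | h
    · exact hAB _ _ hx hy
    · exact not_consec_of_consec hT hT' hB hA hC' hy h (hyA h) hx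
  have hyq' : y < q := by
    refine hyq.lt_of_ne ?_
    rintro rfl
    exact not_consec_of_consec hT hT' hA hB hC hx hxq' (hxB hxq') hy
  by_cases hab : Above T p y x
  · exact Or.inl (nested_of_above hT hT' hA hB hC hx hxq' (hxB hxq') hy hyq' (hyA hyq') hab)
  · refine Or.inr (nested_of_above hT hT' hB hA hC' hy hyq' (hyA hyq') hx hxq' (hxB hxq') ?_)
    rcases lt_trichotomy x y with h | h | h
    · rw [above_mid hx.2.2.1 h, not_not] at hab
      exact (above_right hx.2.2.1 h).2 hab
    · exact absurd (h ▸ hy.2.1) (hxB hxq')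
    · rw [above_right hy.2.2.1 h] at hab
      exact (above_mid hy.2.2.1 h).2 hab

end Supports

/-- The combinatorial content of `{a < b < c}` being an ascent: no other pseudoline cuts
the triangle. -/
structure IsAscent (n : ℕ) (T : ℕ → ℕ → ℕ → Prop) (a b c : ℕ) : Prop where
  one_le : 1 ≤ a
  lt_left : a < b
  lt_right : b < c
  le : c ≤ n
  not_mem : ¬ T a b c
  above_iff : ∀ x, 1 ≤ x → x ≤ n → x ≠ a → x ≠ b → x ≠ c →
    (Above T a b x ↔ Above T b c x) ∧ (Above T a b x ↔ Above T a c x)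

theorem triple_eq_iff {a b c u v w : ℕ} (hab : a < b) (hbc : b < c) (huv : u < v)
    (hvw : v < w) : ({u, v, w} : Finset ℕ) = {a, b, c} ↔ u = a ∧ v = b ∧ w = c := by
  constructor
  · intro h
    have h' : ∀ x, (x = u ∨ x = v ∨ x = w) ↔ (x = a ∨ x = b ∨ x = c) := fun x => by
      simpa using Finset.ext_iff.1 h x
    have := (h' u).1 (by simp)
    have := (h' v).1 (by simp)
    have := (h' w).1 (by simp)
    omega
  · rintro ⟨rfl, rfl, rfl⟩
    rfl

theorem triple_mem_powersetCard {S : Finset ℕ} {a b c : ℕ} (hab : a < b) (hbc : b < c) :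
    ({a, b, c} : Finset ℕ) ∈ Finset.powersetCard 3 S ↔ a ∈ S ∧ b ∈ S ∧ c ∈ S := by
  have hcard : ({a, b, c} : Finset ℕ).card = 3 :=
    Finset.card_eq_three.2 ⟨a, b, c, by omega, by omega, by omega, rfl⟩
  simp [Finset.mem_powersetCard, hcard, Finset.insert_subset_iff]

theorem triple_mem_binom {n a b c : ℕ} (ha : 1 ≤ a) (hab : a < b) (hbc : b < c) (hc : c ≤ n) :
    ({a, b, c} : Finset ℕ) ∈ binom n 3 := by
  rw [binom, triple_mem_powersetCard hab hbc]
  simp only [_root_.box, Finset.mem_Icc]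
  omega

theorem exists_sorted_of_card_eq_three {I : Finset ℕ} (h : I.card = 3) :
    ∃ a b c, a < b ∧ b < c ∧ I = {a, b, c} := by
  obtain ⟨x, y, z, hxy, hxz, hyz, rfl⟩ := Finset.card_eq_three.1 h
  rcases hxy.lt_or_gt with h1 | h1 <;> rcases hxz.lt_or_gt with h2 | h2 <;>
    rcases hyz.lt_or_gt with h3 | h3
  · exact ⟨x, y, z, h1, h3, rfl⟩
  · exact ⟨x, z, y, h2, h3, by grind⟩
  · omega
  · exact ⟨z, x, y, h2, h1, by grind⟩
  · exact ⟨y, x, z, h1, h2, by grind⟩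
  · omega
  · exact ⟨y, z, x, h3, h2, by grind⟩
  · exact ⟨z, y, x, h3, h1, by grind⟩

theorem exists_sorted_of_mem_binom {n : ℕ} {I : Finset ℕ} (h : I ∈ binom n 3) :
    ∃ a b c, 1 ≤ a ∧ a < b ∧ b < c ∧ c ≤ n ∧ I = {a, b, c} := by
  obtain ⟨a, b, c, hab, hbc, rfl⟩ :=
    exists_sorted_of_card_eq_three (Finset.mem_powersetCard.1 h).2
  rw [binom, triple_mem_powersetCard hab hbc] at h
  simp only [_root_.box, Finset.mem_Icc] at h
  exact ⟨a, b, c, h.1.1, hab, hbc, h.2.2.2, rfl⟩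

theorem IsClosedSet.closedRel {n : ℕ} {X : Finset (Finset ℕ)} (hX : IsClosedSet n 2 X) :
    ClosedRel n fun a b c => ({a, b, c} : Finset ℕ) ∈ X := by
  have key : ∀ h i j k, 1 ≤ h → h ≤ n → 1 ≤ i → i < j → j < k → k ≤ n → i ≠ h → j ≠ h → k ≠ h →
      ({h, i, j} : Finset ℕ) ∈ X → ({h, j, k} : Finset ℕ) ∈ X → ({h, i, k} : Finset ℕ) ∈ X := by
    intro h i j k h1 h2 h3 h4 h5 h6 h7 h8 h9 hij hjk
    refine hX {h} ?_ i ?_ j ?_ k ?_ ?_ ?_ ?_ h4 h5 hij hjk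
    · exact Finset.mem_powersetCard.2 ⟨Finset.singleton_subset_iff.2
        (Finset.mem_Icc.2 ⟨h1, h2⟩), Finset.card_singleton _⟩
    all_goals
      simp only [_root_.box, Finset.mem_Icc, Finset.mem_singleton]
      omega
  intro a b c d ha hab hbc hcd hd
  have k1 := key a b c d
  have k2 := key b a c d
  have k3 := key c a b d
  have k4 := key d a b c
  have rot : ∀ x y z : ℕ, ({z, x, y} : Finset ℕ) = {x, y, z} := fun x y z => by
    rw [Finset.insert_comm, Finset.pair_comm]
  rw [Finset.insert_comm b a {c}, Finset.insert_comm b a {d}] at k2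
  rw [rot a b c, Finset.insert_comm c b {d}, Finset.insert_comm c a {d}] at k3
  rw [rot a b d, rot b c d, rot a c d] at k4
  refine ⟨fun h h' => k1 ?_ ?_ ?_ ?_ ?_ ?_ ?_ ?_ ?_ h h',
    fun h h' => ⟨k2 ?_ ?_ ?_ ?_ ?_ ?_ ?_ ?_ ?_ h h', k3 ?_ ?_ ?_ ?_ ?_ ?_ ?_ ?_ ?_ h h'⟩,
    fun h h' => k4 ?_ ?_ ?_ ?_ ?_ ?_ ?_ ?_ ?_ h h'⟩
  all_goals omega

theorem Consistent.closedRel_not {n : ℕ} {X : Finset (Finset ℕ)} (hX : Consistent n 2 X) :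
    ClosedRel n fun a b c => ({a, b, c} : Finset ℕ) ∉ X := by
  intro a b c d ha hab hbc hcd hd
  have h := (show IsClosedSet n 2 (binom n 3 \ X) from hX.2.2).closedRel
    a b c d ha hab hbc hcd hd
  have h1 := triple_mem_binom (n := n) ha hab hbc (by omega)
  have h2 := triple_mem_binom (n := n) ha hab (hbc.trans hcd) (by omega)
  have h3 := triple_mem_binom (n := n) ha (hab.trans hbc) hcd (by omega)
  have h4 := triple_mem_binom (n := n) (a := b) (by omega) hbc hcd (by omega)
  simpa only [Finset.mem_sdiff, h1, h2, h3, h4, true_and] using h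

theorem isAscent_of_closedRel {n : ℕ} {T T' : ℕ → ℕ → ℕ → Prop} {a b c : ℕ} (ha : 1 ≤ a)
    (hab : a < b) (hbc : b < c) (hc : c ≤ n) (hT : ClosedRel n T)
    (hTn : ClosedRel n fun u v w => ¬ T u v w) (hT' : ClosedRel n T')
    (hTn' : ClosedRel n fun u v w => ¬ T' u v w) (habc : ¬ T a b c)
    (h : ∀ u v w, u < v → v < w → (T' u v w ↔ T u v w ∨ (u = a ∧ v = b ∧ w = c))) :
    IsAscent n T a b c := by
  refine ⟨ha, hab, hbc, hc, habc, fun x hx hxn hxa hxb hxc => ?_⟩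
  rcases lt_or_gt_of_ne hxa with h1 | h1
  · rw [above_left hab h1, above_left hbc (by omega), above_left (hab.trans hbc) h1]
    have := hT x a b c hx h1 hab hbc hc
    have := hTn x a b c hx h1 hab hbc hc
    have := hT' x a b c hx h1 hab hbc hc
    have := hTn' x a b c hx h1 hab hbc hc
    grind
  rcases lt_or_gt_of_ne hxb with h2 | h2
  · rw [above_mid h1 h2, above_left hbc h2, above_mid h1 (by omega)]
    have := hT a x b c ha h1 h2 hbc hc
    have := hTn a x b c ha h1 h2 hbc hc
    have := hT' a x b c ha h1 h2 hbc hc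
    have := hTn' a x b c ha h1 h2 hbc hc
    grind
  rcases lt_or_gt_of_ne hxc with h3 | h3
  · rw [above_right hab h2, above_mid h2 h3, above_mid h1 h3]
    have := hT a b x c ha hab h2 h3 hc
    have := hTn a b x c ha hab h2 h3 hc
    have := hT' a b x c ha hab h2 h3 hc
    have := hTn' a b x c ha hab h2 h3 hc
    grind
  · rw [above_right hab h2, above_right hbc h3, above_right (hab.trans hbc) h3]
    have := hT a b c x ha hab hbc h3 hxn
    have := hTn a b c x ha hab hbc h3 hxn
    have := hT' a b c x ha hab hbc h3 hxn
    have := hTn' a b c x ha hab hbc h3 hxn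
    grind

theorem isAscent_of_mem_ascSet {n : ℕ} {X : Finset (Finset ℕ)} (hX : Consistent n 2 X)
    {a b c : ℕ} (hab : a < b) (hbc : b < c)
    (h : ({a, b, c} : Finset ℕ) ∈ ascSet n 2 X (binom n 3)) :
    IsAscent n (fun u v w => ({u, v, w} : Finset ℕ) ∈ X) a b c := by
  simp only [ascSet, Finset.mem_filter, Finset.mem_sdiff] at h
  obtain ⟨⟨h, habc⟩, h'⟩ := h
  rw [binom, triple_mem_powersetCard hab hbc] at h
  simp only [_root_.box, Finset.mem_Icc] at h
  refine isAscent_of_closedRel h.1.1 hab hbc h.2.2.2 hX.2.1.closedRel hX.closedRel_not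
    h'.2.1.closedRel h'.closedRel_not habc fun u v w huv hvw => ?_
  rw [Finset.mem_union, Finset.mem_singleton, triple_eq_iff hab hbc huv hvw]

section Packet

variable {n : ℕ} {T : ℕ → ℕ → ℕ → Prop} {a b c d : ℕ}

theorem IsAscent.not_abd (h : IsAscent n T a b c) (hcd : c < d) : ¬ IsAscent n T a b d := by
  rintro ⟨h1, h2, h3, h4, h5, h6⟩
  have := h.lt_right
  have := h.above_iff d (by omega) h4 (by omega) (by omega) (by omega)
  have := h6 c (by omega) (by omega) (by omega) (by omega) (by omega)
  have := h.not_mem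
  unfold Above at *
  grind

theorem IsAscent.not_acd (h : IsAscent n T a b c) : ¬ IsAscent n T a c d := by
  rintro ⟨h1, h2, h3, h4, h5, h6⟩
  have := h.lt_right
  have := h.lt_left
  have := h.above_iff d (by omega) h4 (by omega) (by omega) (by omega)
  have := h6 b (by omega) (by omega) (by omega) (by omega) (by omega)
  have := h.not_mem
  unfold Above at *
  grind

theorem IsAscent.not_acd_of_abd (h : IsAscent n T a b d) (hbc : b < c) :
    ¬ IsAscent n T a c d := by
  rintro ⟨h1, h2, h3, h4, h5, h6⟩
  have := h.lt_right
  have := h.lt_left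
  have := h.above_iff c (by omega) (by omega) (by omega) (by omega) (by omega)
  have := h6 b (by omega) (by omega) (by omega) (by omega) (by omega)
  have := h.not_mem
  unfold Above at *
  grind

theorem IsAscent.not_bcd_of_abd (h : IsAscent n T a b d) : ¬ IsAscent n T b c d := by
  rintro ⟨h1, h2, h3, h4, h5, h6⟩
  have := h.lt_right
  have := h.lt_left
  have := h.one_le
  have := h.above_iff c (by omega) (by omega) (by omega) (by omega) (by omega)
  have := h6 a (by omega) (by omega) (by omega) (by omega) (by omega)
  have := h.not_mem
  unfold Above at *
  grind

theorem IsAscent.not_bcd_of_acd (h : IsAscent n T a c d) (hab : a < b) :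
    ¬ IsAscent n T b c d := by
  rintro ⟨h1, h2, h3, h4, h5, h6⟩
  have := h.lt_right
  have := h.one_le
  have := h.above_iff b (by omega) (by omega) (by omega) (by omega) (by omega)
  have := h6 a (by omega) (by omega) (by omega) (by omega) (by omega)
  have := h.not_mem
  unfold Above at *
  grind

theorem IsAscent.right_unique (h : IsAscent n T a b c) (h' : IsAscent n T a b d) : c = d := by
  rcases lt_trichotomy c d with h1 | h1 | h1
  · exact absurd h' (h.not_abd h1)
  · exact h1
  · exact absurd h (h'.not_abd h1)

theorem IsAscent.mid_unique (h : IsAscent n T a b d) (h' : IsAscent n T a c d) : b = c := by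
  rcases lt_trichotomy b c with h1 | h1 | h1
  · exact absurd h' (h.not_acd_of_abd h1)
  · exact h1
  · exact absurd h (h'.not_acd_of_abd h1)

theorem IsAscent.left_unique (h : IsAscent n T a c d) (h' : IsAscent n T b c d) : a = b := by
  rcases lt_trichotomy a b with h1 | h1 | h1
  · exact absurd h' (h.not_bcd_of_acd h1)
  · exact h1
  · exact absurd h (h'.not_bcd_of_acd h1)

theorem IsAscent.eq_or_shift {p q r u v w s t : ℕ} (h : IsAscent n T p q r)
    (h' : IsAscent n T u v w) (hst : s < t) (hs : s = p ∨ s = q ∨ s = r)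
    (ht : t = p ∨ t = q ∨ t = r) (hs' : s = u ∨ s = v ∨ s = w)
    (ht' : t = u ∨ t = v ∨ t = w) :
    (p = u ∧ q = v ∧ r = w) ∨ (q = u ∧ r = v) ∨ (p = v ∧ q = w) := by
  have h1 := h.lt_left
  have h2 := h.lt_right
  have h3 := h'.lt_left
  have h4 := h'.lt_right
  obtain ⟨rfl, rfl⟩ | ⟨rfl, rfl⟩ | ⟨rfl, rfl⟩ :
      (s = p ∧ t = q) ∨ (s = p ∧ t = r) ∨ (s = q ∧ t = r) := by omega
  all_goals
    obtain ⟨rfl, rfl⟩ | ⟨rfl, rfl⟩ | ⟨rfl, rfl⟩ :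
        (s = u ∧ t = v) ∨ (s = u ∧ t = w) ∨ (s = v ∧ t = w) := by omega
  · exact Or.inl ⟨rfl, rfl, h.right_unique h'⟩
  · exact absurd h h'.not_acd
  · exact Or.inr (Or.inr ⟨rfl, rfl⟩)
  · exact absurd h' h.not_acd
  · exact Or.inl ⟨rfl, h.mid_unique h', rfl⟩
  · exact absurd h h'.not_bcd_of_abd
  · exact Or.inr (Or.inl ⟨rfl, rfl⟩)
  · exact absurd h' h.not_bcd_of_abd
  · exact Or.inl ⟨h.left_unique h', rfl, rfl⟩

end Packet

/-- The consecutive triples of `a 0 < ⋯ < a (m + 1)` all belong to `A`. -/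
def TripleChain (A : Finset (Finset ℕ)) (a : ℕ → ℕ) (m : ℕ) : Prop :=
  0 < m ∧ ∀ i < m, a i < a (i + 1) ∧ a (i + 1) < a (i + 2) ∧
    ({a i, a (i + 1), a (i + 2)} : Finset ℕ) ∈ A

theorem ClosedRel.of_consecutive {n : ℕ} {R : ℕ → ℕ → ℕ → Prop} (hR : ClosedRel n R)
    {a : ℕ → ℕ} {m : ℕ} (hmono : ∀ i j, i < j → j ≤ m + 1 → a i < a j) (h1 : 1 ≤ a 0)
    (hn : a (m + 1) ≤ n) (hcons : ∀ i < m, R (a i) (a (i + 1)) (a (i + 2))) :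
    ∀ d i j k, k - i ≤ d → i < j → j < k → k ≤ m + 1 → R (a i) (a j) (a k) := by
  have hlow : ∀ i ≤ m + 1, 1 ≤ a i := fun i hi => by
    rcases Nat.eq_zero_or_pos i with rfl | h
    · exact h1
    · exact h1.trans (hmono 0 i h hi).le
  have hup : ∀ i ≤ m + 1, a i ≤ n := fun i hi => by
    rcases hi.eq_or_lt with rfl | h
    · exact hn
    · exact (hmono i _ h le_rfl).le.trans hn
  intro d
  induction d with
  | zero => intro i j k; omega
  | succ d ih =>
    intro i j k hd hij hjk hk
    by_cases hj : j = i + 1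
    · by_cases hk' : k = i + 2
      · subst hj hk'
        exact hcons i (by omega)
      · exact ((hR (a i) (a j) (a (k - 1)) (a k) (hlow i (by omega)) (hmono _ _ hij (by omega))
          (hmono _ _ (by omega) (by omega)) (hmono _ _ (by omega) hk) (hup k hk)).2.1
          (ih i j (k - 1) (by omega) hij (by omega) (by omega))
          (ih j (k - 1) k (by omega) (by omega) (by omega) hk)).1
    · exact ((hR (a i) (a (i + 1)) (a j) (a k) (hlow i (by omega))
        (hmono _ _ (by omega) (by omega)) (hmono _ _ (by omega) (by omega))
        (hmono _ _ hjk hk) (hup k hk)).2.1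
        (ih i (i + 1) j (by omega) (by omega) (by omega) (by omega))
        (ih (i + 1) j k (by omega) (by omega) hjk hk)).2

namespace TripleChain

variable {A : Finset (Finset ℕ)} {a : ℕ → ℕ} {m : ℕ}

theorem lt_succ (h : TripleChain A a m) {i : ℕ} (hi : i ≤ m) : a i < a (i + 1) := by
  have h0 := h.1
  rcases hi.eq_or_lt with rfl | hi
  · obtain ⟨k, rfl⟩ : ∃ k, i = k + 1 := ⟨i - 1, by omega⟩
    exact (h.2 k (by omega)).2.1
  · exact (h.2 i hi).1

theorem lt_of_lt (h : TripleChain A a m) : ∀ i j, i < j → j ≤ m + 1 → a i < a j := by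
  intro i j hij
  induction j, hij using Nat.le_induction with
  | base => intro hj; exact h.lt_succ (by omega)
  | succ j _ ih => intro hj; exact (ih (by omega)).trans (h.lt_succ (by omega))

theorem add_le (h : TripleChain A a m) : ∀ i ≤ m + 1, a 0 + i ≤ a i := by
  intro i
  induction i with
  | zero => simp
  | succ i ih =>
    intro hi
    have := h.lt_succ (i := i) (by omega)
    have := ih (by omega)
    omega

theorem snoc (h : TripleChain A a m) {w : ℕ} (hw : a (m + 1) < w)
    (hA : ({a m, a (m + 1), w} : Finset ℕ) ∈ A) :
    TripleChain A (Function.update a (m + 2) w) (m + 1) := by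
  refine ⟨by omega, fun i hi => ?_⟩
  rw [Function.update_of_ne (by omega), Function.update_of_ne (by omega)]
  rcases (Nat.lt_succ_iff.1 hi).eq_or_lt with rfl | hi'
  · rw [Function.update_self]
    exact ⟨h.lt_succ le_rfl, hw, hA⟩
  · rw [Function.update_of_ne (by omega)]
    exact h.2 i hi'

theorem cons (h : TripleChain A a m) {u : ℕ} (hu : u < a 0)
    (hA : ({u, a 0, a 1} : Finset ℕ) ∈ A) :
    TripleChain A (fun i => Nat.casesOn i u a) (m + 1) := by
  refine ⟨by omega, fun i hi => ?_⟩
  cases i with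
  | zero => exact ⟨hu, h.lt_succ (Nat.zero_le _), hA⟩
  | succ i => exact h.2 i (by omega)

theorem reflTransGen (h : TripleChain A a m) {i : ℕ} (hi : i < m) :
    Relation.ReflTransGen (AdjAsc A) {a 0, a 1, a 2} {a i, a (i + 1), a (i + 2)} := by
  induction i with
  | zero => exact .refl
  | succ i ih =>
    obtain ⟨h1, h2, h3⟩ := h.2 i (by omega)
    obtain ⟨-, h4, h5⟩ := h.2 (i + 1) hi
    refine (ih (by omega)).tail ⟨h3, h5, ?_, ?_⟩
    · rw [Ne, triple_eq_iff h2 h4 h1 h2]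
      omega
    · have : ({a i, a (i + 1), a (i + 2)} ∩ {a (i + 1), a (i + 1 + 1), a (i + 1 + 2)} :
          Finset ℕ) = {a (i + 1), a (i + 2)} := by
        ext x
        simp only [Finset.mem_inter, Finset.mem_insert, Finset.mem_singleton]
        have e : i + 1 + 1 = i + 2 := rfl
        rw [e] at *
        omega
      rw [this, Finset.card_pair h2.ne]

end TripleChain

theorem adjAsc_symm {A : Finset (Finset ℕ)} : Std.Symm (AdjAsc A) :=
  ⟨fun I J h => ⟨h.2.1, h.1, h.2.2.1.symm, by rw [Finset.inter_comm]; exact h.2.2.2⟩⟩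

theorem reflTransGen_adjAsc_symm {A : Finset (Finset ℕ)} {I J : Finset ℕ}
    (h : Relation.ReflTransGen (AdjAsc A) I J) : Relation.ReflTransGen (AdjAsc A) J I :=
  have := adjAsc_symm (A := A)
  Std.Symm.symm _ _ h

theorem exists_maximal_tripleChain {n : ℕ} {A : Finset (Finset ℕ)} (hA : A ⊆ binom n 3)
    {I₀ : Finset ℕ} (hI₀ : I₀ ∈ A) :
    ∃ a m, TripleChain A a m ∧ (∃ i < m, I₀ = {a i, a (i + 1), a (i + 2)}) ∧
      ∀ a', TripleChain A a' (m + 1) →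
        ¬ ∃ i < m + 1, I₀ = {a' i, a' (i + 1), a' (i + 2)} := by
  classical
  let P : ℕ → Prop := fun m => ∃ a, TripleChain A a m ∧ ∃ i < m, I₀ = {a i, a (i + 1), a (i + 2)}
  have hP : ∀ m, P m → m ≤ n := by
    rintro m ⟨a, ha, -⟩
    obtain ⟨h1, h2, h3⟩ := ha.2 (m - 1) (by have := ha.1; omega)
    have h4 := hA h3
    rw [binom, triple_mem_powersetCard h1 h2] at h4
    simp only [_root_.box, Finset.mem_Icc] at h4
    have := ha.add_le (m - 1) (by omega)
    omega
  have h1 : P 1 := by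
    obtain ⟨a, b, c, -, hab, hbc, -, rfl⟩ := exists_sorted_of_mem_binom (hA hI₀)
    refine ⟨fun i => if i = 0 then a else if i = 1 then b else c, ⟨by omega, ?_⟩, 0, by omega, rfl⟩
    intro i hi
    obtain rfl : i = 0 := by omega
    exact ⟨hab, hbc, hI₀⟩
  obtain ⟨a, ha, hi⟩ := Nat.findGreatest_spec (hP 1 h1) h1
  refine ⟨a, _, ha, hi, fun a' ha' hi' => ?_⟩
  exact Nat.findGreatest_is_greatest (Nat.lt_succ_self _) (hP _ ⟨a', ha', hi'⟩) ⟨a', ha', hi'⟩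

theorem mem_component {A : Finset (Finset ℕ)} {I J : Finset ℕ} :
    J ∈ component A I ↔ J ∈ A ∧ Relation.ReflTransGen (AdjAsc A) I J := by
  simp only [component, Finset.mem_filter]

theorem exists_lt_of_card_inter {I J : Finset ℕ} (h : (I ∩ J).card = 2) :
    ∃ s t, s < t ∧ s ∈ I ∧ t ∈ I ∧ s ∈ J ∧ t ∈ J := by
  obtain ⟨s, hs, t, ht, hst⟩ := Finset.one_lt_card.1 (by omega : 1 < (I ∩ J).card)
  rw [Finset.mem_inter] at hs ht
  rcases hst.lt_or_gt with h | h
  · exact ⟨s, t, h, hs.1, ht.1, hs.2, ht.2⟩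
  · exact ⟨t, s, h, ht.1, hs.1, ht.2, hs.2⟩

section Component

variable {n : ℕ} {T : ℕ → ℕ → ℕ → Prop} {A : Finset (Finset ℕ)}

theorem exists_tripleChain_component (hA : A ⊆ binom n 3)
    (hT : ∀ a b c, a < b → b < c → ({a, b, c} : Finset ℕ) ∈ A → IsAscent n T a b c)
    {I₀ : Finset ℕ} (hI₀ : I₀ ∈ A) :
    ∃ a m, TripleChain A a m ∧
      ∀ J, J ∈ component A I₀ ↔ ∃ i < m, J = {a i, a (i + 1), a (i + 2)} := by
  obtain ⟨a, m, ha, ⟨i₀, hi₀, hI⟩, hmax⟩ := exists_maximal_tripleChain hA hI₀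
  refine ⟨a, m, ha, fun J => ?_⟩
  rw [mem_component]
  constructor
  · rintro ⟨-, hJ⟩
    induction hJ with
    | refl => exact ⟨i₀, hi₀, hI⟩
    | @tail J K _ hJK ih =>
      obtain ⟨i, hi, rfl⟩ := ih
      obtain ⟨-, hK, hne, hcard⟩ := hJK
      obtain ⟨u, v, w, -, huv, hvw, -, rfl⟩ := exists_sorted_of_mem_binom (hA hK)
      obtain ⟨s, t, hst, hs, ht, hs', ht'⟩ := exists_lt_of_card_inter hcard
      simp only [Finset.mem_insert, Finset.mem_singleton] at hs ht hs' ht'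
      obtain ⟨h1, h2, h3⟩ := ha.2 i hi
      have hasc := hT _ _ _ huv hvw hK
      rcases (hT _ _ _ h1 h2 h3).eq_or_shift hasc hst hs ht hs' ht' with
        ⟨rfl, rfl, rfl⟩ | ⟨rfl, rfl⟩ | ⟨rfl, rfl⟩
      · exact absurd rfl hne
      · by_cases him : i + 1 < m
        · obtain ⟨h4, h5, h6⟩ := ha.2 (i + 1) him
          refine ⟨i + 1, him, ?_⟩
          rw [hasc.right_unique (hT _ _ _ h4 h5 h6)]
        · obtain rfl : m = i + 1 := by omega
          refine absurd ⟨i₀, by omega, ?_⟩ (hmax _ (ha.snoc hvw hK))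
          rw [Function.update_of_ne (by omega), Function.update_of_ne (by omega),
            Function.update_of_ne (by omega), hI]
      · rcases Nat.eq_zero_or_pos i with rfl | hpos
        · exact absurd ⟨i₀ + 1, by omega, hI⟩ (hmax _ (ha.cons huv hK))
        · obtain ⟨k, rfl⟩ : ∃ k, i = k + 1 := ⟨i - 1, by omega⟩
          obtain ⟨h4, h5, h6⟩ := ha.2 k (by omega)
          refine ⟨k, by omega, ?_⟩
          rw [hasc.left_unique (hT _ _ _ h4 h5 h6)]
  · rintro ⟨i, hi, rfl⟩
    refine ⟨(ha.2 i hi).2.2, ?_⟩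
    rw [hI]
    exact (reflTransGen_adjAsc_symm (ha.reflTransGen hi₀)).trans (ha.reflTransGen hi)

theorem mem_unionSet_of_chain {C : Finset (Finset ℕ)} {a : ℕ → ℕ} {m : ℕ} (hm : 0 < m)
    (hC : ∀ J, J ∈ C ↔ ∃ i < m, J = {a i, a (i + 1), a (i + 2)}) (x : ℕ) :
    x ∈ unionSet C ↔ ∃ i ≤ m + 1, x = a i := by
  simp only [unionSet, Finset.mem_biUnion, id]
  constructor
  · rintro ⟨J, hJ, hx⟩
    obtain ⟨i, hi, rfl⟩ := (hC J).1 hJ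
    simp only [Finset.mem_insert, Finset.mem_singleton] at hx
    rcases hx with rfl | rfl | rfl
    exacts [⟨i, by omega, rfl⟩, ⟨i + 1, by omega, rfl⟩, ⟨i + 2, by omega, rfl⟩]
  · rintro ⟨i, hi, rfl⟩
    rcases Nat.lt_or_ge i m with h | h
    · exact ⟨_, (hC _).2 ⟨i, h, rfl⟩, by simp⟩
    · rcases h.eq_or_lt with rfl | h'
      · exact ⟨_, (hC _).2 ⟨m - 1, by omega, rfl⟩, by simp [Nat.sub_add_cancel hm]⟩
      · obtain rfl : i = m + 1 := by omega
        refine ⟨_, (hC _).2 ⟨m - 1, by omega, rfl⟩, ?_⟩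
        have : m - 1 + 2 = m + 1 := by omega
        simp [this]

theorem isSupport_unionSet_component (hA : A ⊆ binom n 3)
    (hTn : ClosedRel n fun a b c => ¬ T a b c)
    (hT : ∀ a b c, a < b → b < c → ({a, b, c} : Finset ℕ) ∈ A → IsAscent n T a b c)
    {I₀ : Finset ℕ} (hI₀ : I₀ ∈ A) :
    IsSupport n T (unionSet (component A I₀)) ∧
    (∀ p q, Consec (unionSet (component A I₀)) p q → ∃ I ∈ component A I₀, p ∈ I ∧ q ∈ I) ∧
    (∀ R, ClosedRel n R → (∀ a b c, a < b → b < c → ({a, b, c} : Finset ℕ) ∈ component A I₀ →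
      R a b c) → ∀ x ∈ unionSet (component A I₀), ∀ y ∈ unionSet (component A I₀),
      ∀ z ∈ unionSet (component A I₀), x < y → y < z → R x y z) := by
  obtain ⟨a, m, ha, hC⟩ := exists_tripleChain_component hA hT hI₀
  have hm := ha.1
  have hU := mem_unionSet_of_chain hm hC
  have hasc : ∀ i < m, IsAscent n T (a i) (a (i + 1)) (a (i + 2)) := fun i hi =>
    hT _ _ _ (ha.2 i hi).1 (ha.2 i hi).2.1 (ha.2 i hi).2.2
  have hlow : ∀ i ≤ m + 1, 1 ≤ a i := fun i hi =>
    (hasc 0 hm).one_le.trans (le_trans (Nat.le_add_right _ i) (ha.add_le i hi))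
  have hlast : a (m + 1) ≤ n := by
    have := (hasc (m - 1) (by omega)).le
    rwa [show m - 1 + 2 = m + 1 by omega] at this
  have hup : ∀ i ≤ m + 1, a i ≤ n := fun i hi => by
    rcases hi.eq_or_lt with rfl | h
    · exact hlast
    · exact (ha.lt_of_lt i _ h le_rfl).le.trans hlast
  have hidx : ∀ i j, i ≤ m + 1 → j ≤ m + 1 → a i < a j → i < j := fun i j hi hj h => by
    by_contra! hji
    rcases hji.eq_or_lt with rfl | h'
    · exact lt_irrefl _ h
    · exact lt_asymm h (ha.lt_of_lt j i h' hi)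
  have hcons : ∀ p q, Consec (unionSet (component A I₀)) p q →
      ∃ i ≤ m, p = a i ∧ q = a (i + 1) := by
    rintro p q ⟨hp, hq, hpq, hr⟩
    obtain ⟨i, hi, rfl⟩ := (hU p).1 hp
    obtain ⟨j, hj, rfl⟩ := (hU q).1 hq
    have hij := hidx i j hi hj hpq
    refine ⟨i, by omega, rfl, ?_⟩
    have : j = i + 1 := by
      by_contra hne
      exact hr (a (i + 1)) ((hU _).2 ⟨i + 1, by omega, rfl⟩)
        ⟨ha.lt_of_lt _ _ (by omega) (by omega), ha.lt_of_lt _ _ (by omega) hj⟩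
    rw [this]
  have hclosed : ∀ R, ClosedRel n R → (∀ a b c, a < b → b < c →
      ({a, b, c} : Finset ℕ) ∈ component A I₀ → R a b c) →
      ∀ x ∈ unionSet (component A I₀), ∀ y ∈ unionSet (component A I₀),
      ∀ z ∈ unionSet (component A I₀), x < y → y < z → R x y z := by
    intro R hR hRc x hx y hy z hz hxy hyz
    obtain ⟨i, hi, rfl⟩ := (hU x).1 hx
    obtain ⟨j, hj, rfl⟩ := (hU y).1 hy
    obtain ⟨k, hk, rfl⟩ := (hU z).1 hz
    exact hR.of_consecutive ha.lt_of_lt (hlow 0 (by omega)) hlast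
      (fun i hi => hRc _ _ _ (ha.2 i hi).1 (ha.2 i hi).2.1 ((hC _).2 ⟨i, hi, rfl⟩))
      _ i j k le_rfl (hidx i j hi hj hxy) (hidx j k hj hk hyz) hk
  refine ⟨⟨?_, ?_, ?_, ?_⟩, ?_, hclosed⟩
  · intro x hx
    obtain ⟨i, hi, rfl⟩ := (hU x).1 hx
    exact ⟨hlow i hi, hup i hi⟩
  · intro x hx y hy z hz
    refine hclosed _ hTn (fun a b c hab hbc h => ?_) x hx y hy z hz
    exact (hT a b c hab hbc (mem_component.1 h).1).not_mem
  · have key : ∀ x, 1 ≤ x → x ≤ n → x ∉ unionSet (component A I₀) → ∀ i ≤ m,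
        (Above T (a i) (a (i + 1)) x ↔ Above T (a 0) (a 1) x) := by
      intro x hx hxn hxU i
      have hne : ∀ i ≤ m + 1, x ≠ a i := fun i hi h => hxU ((hU x).2 ⟨i, hi, h⟩)
      induction i with
      | zero => exact fun _ => Iff.rfl
      | succ i ih =>
        intro hi
        rw [← ih (by omega)]
        exact ((hasc i hi).above_iff x hx hxn (hne _ (by omega)) (hne _ (by omega))
          (hne _ (by omega))).1.symm
    intro p q p' q' x h h' hx hxn hxU
    obtain ⟨i, hi, rfl, rfl⟩ := hcons p q h
    obtain ⟨j, hj, rfl, rfl⟩ := hcons p' q' h'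
    rw [key x hx hxn hxU i hi, key x hx hxn hxU j hj]
  · have hsub : ({a 0, a 1, a 2} : Finset ℕ) ⊆ unionSet (component A I₀) := by
      intro x hx
      simp only [Finset.mem_insert, Finset.mem_singleton] at hx
      rcases hx with rfl | rfl | rfl
      exacts [(hU _).2 ⟨0, by omega, rfl⟩, (hU _).2 ⟨1, by omega, rfl⟩,
        (hU _).2 ⟨2, by omega, rfl⟩]
    have h := hasc 0 hm
    have h1 := h.lt_left
    have h2 := h.lt_right
    rw [← Finset.card_eq_three.2 ⟨a 0, a 1, a 2, h1.ne, (h1.trans h2).ne, h2.ne, rfl⟩]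
    exact Finset.card_le_card hsub
  · intro p q hpq
    obtain ⟨i, hi, rfl, rfl⟩ := hcons p q hpq
    rcases hi.eq_or_lt with rfl | h
    · exact ⟨_, (hC _).2 ⟨i - 1, by omega, rfl⟩, by simp [Nat.sub_add_cancel hm],
        by simp [show i - 1 + 2 = i + 1 by omega]⟩
    · exact ⟨_, (hC _).2 ⟨i, h, rfl⟩, by simp, by simp⟩

end Component

theorem triple_mem_closureHB {n : ℕ} {C : Finset (Finset ℕ)} {a b c : ℕ}
    (hbin : ({a, b, c} : Finset ℕ) ∈ binom n 3)
    (h : ∀ R, ClosedRel n R →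
      (∀ x y z, x < y → y < z → ({x, y, z} : Finset ℕ) ∈ C → R x y z) → R a b c) :
    ({a, b, c} : Finset ℕ) ∈ closureHB n 2 C := by
  simp only [closureHB, Finset.mem_filter]
  exact ⟨hbin, fun T _ hCT hT => h _ hT.closedRel fun x y z _ _ hxyz => hCT hxyz⟩

theorem isClosedSet_powersetCard (n : ℕ) (S : Finset ℕ) :
    IsClosedSet n 2 (Finset.powersetCard 3 S) := by
  intro I hI i _ j _ k _ hi hj hk hij hjk h1 h2
  obtain ⟨h, rfl⟩ := Finset.card_eq_one.1 (Finset.mem_powersetCard.1 hI).2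
  rw [Finset.mem_powersetCard] at h1 h2 ⊢
  rw [Finset.mem_singleton] at hi hk
  refine ⟨fun x hx => ?_, Finset.card_eq_three.2
    ⟨h, i, k, Ne.symm hi, Ne.symm hk, (hij.trans hjk).ne, rfl⟩⟩
  simp only [Finset.mem_union, Finset.mem_insert, Finset.mem_singleton] at hx
  rcases hx with rfl | rfl | rfl
  exacts [h1.1 (by simp), h1.1 (by simp), h2.1 (by simp)]

theorem closureHB_subset_powersetCard {n : ℕ} {C : Finset (Finset ℕ)} (hC : C ⊆ binom n 3) :
    closureHB n 2 C ⊆ Finset.powersetCard 3 (unionSet C) := by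
  intro I hI
  simp only [closureHB, Finset.mem_filter] at hI
  refine hI.2 _ (Finset.powersetCard_mono fun x hx => ?_) (fun J hJ => ?_)
    (isClosedSet_powersetCard n _)
  · obtain ⟨J, hJ, hx⟩ := Finset.mem_biUnion.1 hx
    exact (Finset.mem_powersetCard.1 (hC hJ)).1 hx
  · exact Finset.mem_powersetCard.2
      ⟨fun x hx => Finset.mem_biUnion.2 ⟨J, hJ, hx⟩, (Finset.mem_powersetCard.1 (hC hJ)).2⟩

theorem not_consistent_of_nested {n : ℕ} {X D : Finset (Finset ℕ)} {A B : Finset ℕ}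
    (hD : D ⊆ Finset.powersetCard 3 A)
    (hAD : ∀ a ∈ A, ∀ b ∈ A, ∀ c ∈ A, a < b → b < c → ({a, b, c} : Finset ℕ) ∈ D)
    (hB : IsSupport n (fun u v w => ({u, v, w} : Finset ℕ) ∈ X) B)
    (h : Nested (fun u v w => ({u, v, w} : Finset ℕ) ∈ X) A B) : ¬ Consistent n 2 (X ∪ D) := by
  intro hcon
  obtain ⟨p, q, x, y, hp, hq, -, hAB, hx, hy, hyA, hpx, hxq, hpy, hyq, hxy⟩ := h
  have hpA : p ∈ A := Finset.mem_of_mem_inter_left (hAB ▸ Finset.mem_insert_self p {q})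
  have hqA : q ∈ A := Finset.mem_of_mem_inter_left
    (hAB ▸ Finset.mem_insert_of_mem (Finset.mem_singleton_self q))
  have hpxq : ({p, x, q} : Finset ℕ) ∈ X ∪ D :=
    Finset.mem_union_right _ (hAD p hpA x hx q hqA hpx hxq)
  have hnD : ∀ J ∈ D, y ∉ J := fun J hJ hyJ => hyA ((Finset.mem_powersetCard.1 (hD hJ)).1 hyJ)
  have hpyq : ({p, y, q} : Finset ℕ) ∉ X ∪ D := by
    rw [Finset.mem_union, not_or]
    exact ⟨hB.not_mem p hp y hy q hq hpy hyq, fun h => hnD _ h (by simp)⟩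
  have hp1 := (hB.bounds p hp).1
  have hqn := (hB.bounds q hq).2
  rcases hxy with ⟨hxy, hnot⟩ | ⟨hyx, hmem⟩
  · refine (hcon.closedRel_not p x y q hp1 hpx hxy hyq hqn).1 ?_ hpyq hpxq
    refine fun h => (Finset.mem_union.1 h).elim hnot fun h => hnD _ h (by simp)
  · exact hpyq ((hcon.2.1.closedRel p y x q hp1 hpy hyx hxq hqn).1
      (Finset.mem_union_left _ hmem) hpxq)

theorem ascSet_subset {n : ℕ} {X Y : Finset (Finset ℕ)} : ascSet n 2 X Y ⊆ Y := by
  intro I hI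
  simp only [ascSet, Finset.mem_filter, Finset.mem_sdiff] at hI
  exact hI.1.1

theorem nested_conclusion {n : ℕ} {X : Finset (Finset ℕ)} (hX : Consistent n 2 X)
    {K₀ L₀ : Finset ℕ} (hK₀ : K₀ ∈ ascSet n 2 X (binom n 3))
    (hL₀ : L₀ ∈ ascSet n 2 X (binom n 3))
    (h : Nested (fun u v w => ({u, v, w} : Finset ℕ) ∈ X)
      (unionSet (component (ascSet n 2 X (binom n 3)) K₀))
      (unionSet (component (ascSet n 2 X (binom n 3)) L₀))) :
    (∃ a ∈ unionSet (component (ascSet n 2 X (binom n 3)) L₀),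
      ∃ b ∈ unionSet (component (ascSet n 2 X (binom n 3)) L₀),
      (∀ x ∈ unionSet (component (ascSet n 2 X (binom n 3)) L₀), a ≤ x ∧ x ≤ b) ∧
      unionSet (component (ascSet n 2 X (binom n 3)) K₀) ∩
        unionSet (component (ascSet n 2 X (binom n 3)) L₀) = {a, b}) ∧
    ¬ Consistent n 2 (X ∪ closureHB n 2 (component (ascSet n 2 X (binom n 3)) K₀)) := by
  have hasc := fun a b c hab hbc => isAscent_of_mem_ascSet hX (a := a) (b := b) (c := c) hab hbc
  obtain ⟨hA, -, hA'⟩ :=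
    isSupport_unionSet_component ascSet_subset hX.closedRel_not hasc hK₀
  obtain ⟨hB, -, -⟩ := isSupport_unionSet_component ascSet_subset hX.closedRel_not hasc hL₀
  refine ⟨?_, not_consistent_of_nested (closureHB_subset_powersetCard fun I hI =>
    ascSet_subset (mem_component.1 hI).1) (fun a ha b hb c hc hab hbc => ?_) hB h⟩
  · obtain ⟨p, q, -, -, hp, hq, hpq, hAB, -⟩ := h
    exact ⟨p, hp, q, hq, hpq, hAB⟩
  · exact triple_mem_closureHB
      (triple_mem_binom (hA.bounds a ha).1 hab hbc (hA.bounds c hc).2)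
      fun R hR hRc => hA' R hR hRc a ha b hb c hc hab hbc

theorem reflTransGen_of_common_pair {n : ℕ} {A : Finset (Finset ℕ)}
    (hA : A ⊆ binom n 3) {I J : Finset ℕ} (hI : I ∈ A) (hJ : J ∈ A) {p q : ℕ} (hpq : p < q)
    (hpI : p ∈ I) (hqI : q ∈ I) (hpJ : p ∈ J) (hqJ : q ∈ J) :
    Relation.ReflTransGen (AdjAsc A) I J := by
  by_cases hIJ : I = J
  · rw [hIJ]
  · refine .single ⟨hI, hJ, hIJ, le_antisymm ?_ ?_⟩
    · have hcI := (Finset.mem_powersetCard.1 (hA hI)).2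
      have hcJ := (Finset.mem_powersetCard.1 (hA hJ)).2
      by_contra! hlt
      have h1 : I ∩ J = I := Finset.eq_of_subset_of_card_le Finset.inter_subset_left (by omega)
      exact hIJ (Finset.eq_of_subset_of_card_le (Finset.inter_eq_left.1 h1) (by omega))
    · rw [← Finset.card_pair hpq.ne]
      refine Finset.card_le_card fun x hx => ?_
      rw [Finset.mem_insert, Finset.mem_singleton] at hx
      rcases hx with rfl | rfl <;> simp [*]

/-- If `A` and `B` are distinct connected components of the graph on `Asc(X)`
(adjacency: sharing two elements) with `|[A] ∩ [B]| ≥ 2`, then after possibly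
exchanging `A` and `B`, `[A] ∩ [B] = {min [B], max [B]}` and `X ∪ cl(A)` is not
consistent. -/
theorem components_sharing_two (n : ℕ) (hn : 1 ≤ n) (X : Finset (Finset ℕ))
    (hX : Consistent n 2 X) (I₀ J₀ : Finset ℕ)
    (hI₀ : I₀ ∈ ascSet n 2 X (binom n 3)) (hJ₀ : J₀ ∈ ascSet n 2 X (binom n 3))
    (hdiff : ¬ Relation.ReflTransGen (AdjAsc (ascSet n 2 X (binom n 3))) I₀ J₀)
    (hbig : 2 ≤ (unionSet (component (ascSet n 2 X (binom n 3)) I₀) ∩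
      unionSet (component (ascSet n 2 X (binom n 3)) J₀)).card) :
    ∃ K₀ L₀ : Finset ℕ, ({K₀, L₀} : Finset (Finset ℕ)) = {I₀, J₀} ∧
      (∃ a ∈ unionSet (component (ascSet n 2 X (binom n 3)) L₀),
        ∃ b ∈ unionSet (component (ascSet n 2 X (binom n 3)) L₀),
        (∀ x ∈ unionSet (component (ascSet n 2 X (binom n 3)) L₀), a ≤ x ∧ x ≤ b) ∧
        unionSet (component (ascSet n 2 X (binom n 3)) K₀) ∩
          unionSet (component (ascSet n 2 X (binom n 3)) L₀) = {a, b}) ∧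
      ¬ Consistent n 2 (X ∪ closureHB n 2 (component (ascSet n 2 X (binom n 3)) K₀)) := by
  have hasc := fun a b c hab hbc => isAscent_of_mem_ascSet hX (a := a) (b := b) (c := c) hab hbc
  obtain ⟨hA, hA', -⟩ :=
    isSupport_unionSet_component ascSet_subset hX.closedRel_not hasc hI₀
  obtain ⟨hB, hB', -⟩ :=
    isSupport_unionSet_component ascSet_subset hX.closedRel_not hasc hJ₀
  have hAB : ∀ p q, Consec (unionSet (component (ascSet n 2 X (binom n 3)) I₀)) p q →
      ¬ Consec (unionSet (component (ascSet n 2 X (binom n 3)) J₀)) p q := by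
    intro p q h1 h2
    obtain ⟨I, hI, hpI, hqI⟩ := hA' p q h1
    obtain ⟨J, hJ, hpJ, hqJ⟩ := hB' p q h2
    rw [mem_component] at hI hJ
    exact hdiff ((hI.2.trans (reflTransGen_of_common_pair ascSet_subset hI.1 hJ.1 h1.2.2.1
      hpI hqI hpJ hqJ)).trans (reflTransGen_adjAsc_symm hJ.2))
  rcases nested_or_nested hX.2.1.closedRel hX.closedRel_not hA hB hAB hbig with h | h
  · exact ⟨I₀, J₀, rfl, nested_conclusion hX hI₀ hJ₀ h⟩
  · exact ⟨J₀, I₀, Finset.pair_comm _ _, nested_conclusion hX hJ₀ hI₀ h⟩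
end

section
/- Let n ≥ 1 and let X ⊆ Y be consistent subsets of binom([n], 3) such that the pair (X, Y) is facial. Then the map 𝓘 ↦ X ∪ cl(𝓘) from subsets of Asc(X, Y) to consistent subsets of binom([n], 3) contained in [X, Y] is an order embedding: for all 𝓘, 𝓙 ⊆ Asc(X,Y), one has X ∪ cl(𝓘) ⊆ X ∪ cl(𝓙) if and only if 𝓘 ⊆ 𝓙. In particular the map is injective, so the Boolean lattice of subsets of Asc(X,Y) embeds into the interval [X, Y] of the inclusion order on consistent sets. -/
open Finset

theorem mem_ascSet {n d : ℕ} {X Y : Finset (Finset ℕ)} {I : Finset ℕ} :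
    I ∈ ascSet n d X Y ↔ I ∈ Y \ X ∧ Consistent n d (X ∪ {I}) := by
  simp only [ascSet, mem_filter]

theorem closureHB_mono (n d : ℕ) {S T : Finset (Finset ℕ)} (h : S ⊆ T) :
    closureHB n d S ⊆ closureHB n d T := by
  intro I hI
  simp only [closureHB, mem_filter] at hI ⊢
  exact ⟨hI.1, fun U hU hTU hc => hI.2 U hU (h.trans hTU) hc⟩

theorem closureHB_subset {n d : ℕ} {S T : Finset (Finset ℕ)} (hT : T ⊆ binom n (d + 1))
    (hST : S ⊆ T) (hc : IsClosedSet n d T) : closureHB n d S ⊆ T := by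
  intro I hI
  simp only [closureHB, mem_filter] at hI
  exact hI.2 T hT hST hc

/-- An ascent outside `T` is not in the closure of `T`, because the complement of `X ∪ {I}`
is a closed set containing `T`. -/
theorem notMem_closureHB_of_mem_ascSet {n d : ℕ} {X Y T : Finset (Finset ℕ)}
    (hY : Y ⊆ binom n (d + 1)) (hT : T ⊆ ascSet n d X Y) {I : Finset ℕ}
    (hI : I ∈ ascSet n d X Y) (hIT : I ∉ T) : I ∉ closureHB n d T := by
  have hcons : Consistent n d (X ∪ {I}) := (mem_ascSet.mp hI).2
  have hsub : T ⊆ binom n (d + 1) \ (X ∪ {I}) := by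
    intro J hJ
    obtain ⟨hJY, hJX⟩ := mem_sdiff.mp (mem_ascSet.mp (hT hJ)).1
    have hne : J ≠ I := fun h => hIT (h ▸ hJ)
    simp [hY hJY, hJX, hne]
  intro h
  have := closureHB_subset sdiff_subset hsub hcons.2.2 h
  simp at this

theorem subset_closureHB {n d : ℕ} {S : Finset (Finset ℕ)} (hS : S ⊆ binom n (d + 1)) :
    S ⊆ closureHB n d S := by
  intro I hI
  simp only [closureHB, mem_filter]
  exact ⟨hS hI, fun _ _ hSU _ => hSU hI⟩

/-- For a facial pair `(X, Y)`, the map `𝓘 ↦ X ∪ cl(𝓘)` is an order embedding of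
the Boolean lattice of subsets of `Asc(X,Y)` into the interval `[X, Y]` of the
inclusion order on consistent sets. -/
theorem facial_boolean_embedding (n : ℕ) (hn : 1 ≤ n) (X Y : Finset (Finset ℕ))
    (hX : Consistent n 2 X) (hY : Consistent n 2 Y) (hXY : X ⊆ Y)
    (hfac : Facial n X Y) :
    (∀ S ⊆ ascSet n 2 X Y, Consistent n 2 (X ∪ closureHB n 2 S) ∧
      X ⊆ X ∪ closureHB n 2 S ∧ X ∪ closureHB n 2 S ⊆ Y) ∧
    (∀ S ⊆ ascSet n 2 X Y, ∀ T ⊆ ascSet n 2 X Y,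
      (X ∪ closureHB n 2 S ⊆ X ∪ closureHB n 2 T ↔ S ⊆ T)) := by
  obtain ⟨-, -, -, hYeq, hcons⟩ := hfac
  have hasc : ascSet n 2 X Y ⊆ Y \ X := fun I hI => (mem_ascSet.mp hI).1
  refine ⟨fun S hS => ⟨hcons S hS, subset_union_left, ?_⟩, fun S hS T hT => ⟨?_, fun h =>
    union_subset_union_right (closureHB_mono n 2 h)⟩⟩
  · calc X ∪ closureHB n 2 S ⊆ X ∪ closureHB n 2 (ascSet n 2 X Y) :=
          union_subset_union_right (closureHB_mono n 2 hS)
      _ = Y := hYeq.symm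
  · intro h I hI
    by_contra hIT
    have hIY := mem_sdiff.mp (hasc (hS hI))
    have hSb : S ⊆ binom n (2 + 1) := fun J hJ => hY.1 (mem_sdiff.mp (hasc (hS hJ))).1
    rcases mem_union.mp (h (mem_union_right _ (subset_closureHB hSb hI))) with hX' | hcl
    · exact hIY.2 hX'
    · exact notMem_closureHB_of_mem_ascSet hY.1 hT (hS hI) hIT hcl
end
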